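/- arXiv:1910.11145 — 3 statements merged into one kernel-verified Lean document; each statement's English description precedes it below -/
import Mathlib

section
/- A finite group G satisfies maol(G) ≤ 3 if and only if G is isomorphic to one of the following groups: the cyclic group Z/mZ with m ∈ {1, 2, 3, 4, 6}, the Klein four group (Z/2Z)², or the symmetric group Sym(3) of degree 3. -/
/-- `maol G` is the maximum length of an orbit of the natural action of `Aut(G)` on `G`. -/
noncomputable def maol (G : Type*) [Group G] : ℕ :=
  ⨆ g : G, Nat.card (MulAction.orbit (MulAut G) g)

section Orbits

variable {G : Type*} [Group G] [Finite G]

theorem mem_orbit_mulAut_of_injective (φ : G →* G) (hφ : ∀ x, φ x = 1 → x = 1) (g : G) :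
    φ g ∈ MulAction.orbit (MulAut G) g :=
  ⟨MulEquiv.ofBijective φ (Finite.injective_iff_bijective.mp
    ((injective_iff_map_eq_one φ).mpr hφ)), rfl⟩

omit [Finite G] in
theorem conj_mem_orbit_mulAut (g x : G) : x * g * x⁻¹ ∈ MulAction.orbit (MulAut G) g :=
  ⟨MulAut.conj x, rfl⟩

theorem card_orbit_le_maol (g : G) : Nat.card (MulAction.orbit (MulAut G) g) ≤ maol G :=
  le_ciSup (f := fun g : G => Nat.card (MulAction.orbit (MulAut G) g))
    (Set.finite_range _).bddAbove g

/-- If `maol G ≤ 3`, two of any four members of an orbit coincide. -/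
theorem exists_eq_of_maol_le_three (hG : maol G ≤ 3) {g a b c d : G}
    (ha : a ∈ MulAction.orbit (MulAut G) g) (hb : b ∈ MulAction.orbit (MulAut G) g)
    (hc : c ∈ MulAction.orbit (MulAut G) g) (hd : d ∈ MulAction.orbit (MulAut G) g) :
    a = b ∨ a = c ∨ a = d ∨ b = c ∨ b = d ∨ c = d := by
  classical
  by_contra! h
  obtain ⟨h1, h2, h3, h4, h5, h6⟩ := h
  have hs : (({a, b, c, d} : Finset G) : Set G) ⊆ MulAction.orbit (MulAut G) g := by
    intro x hx
    simp only [Finset.coe_insert, Finset.coe_singleton, Set.mem_insert_iff,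
      Set.mem_singleton_iff] at hx
    rcases hx with rfl | rfl | rfl | rfl <;> assumption
  have h7 := Nat.card_mono (Set.toFinite _) hs
  have h8 : ({a, b, c, d} : Finset G).card = 4 := by
    rw [Finset.card_insert_of_notMem, Finset.card_insert_of_notMem, Finset.card_pair h6] <;>
      simp [*]
  have h9 : Nat.card (({a, b, c, d} : Finset G) : Set G) = 4 := by simpa using h8
  have := card_orbit_le_maol g
  omega

end Orbits

section Examples

theorem maol_le_three_of_mulEquiv {G H : Type*} [Group G] [Group H] [Fintype H] [DecidableEq H]
    (e : G ≃* H)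
    (h : ∀ g : H, (Finset.univ.filter fun x : H =>
      (x ^ 2 = 1 ↔ g ^ 2 = 1) ∧ (x ^ 3 = 1 ↔ g ^ 3 = 1)).card ≤ 3) : maol G ≤ 3 := by
  refine ciSup_le fun g => le_trans ?_ (h (e g))
  rw [← Nat.card_eq_finsetCard]
  have := Finite.of_equiv H e.symm.toEquiv
  refine Nat.card_le_card_of_injective (fun x => ⟨e x.1, ?_⟩) fun x y hxy =>
    Subtype.ext (e.injective (congrArg Subtype.val hxy))
  obtain ⟨_, φ, rfl⟩ := x
  simp [← map_pow]

end Examples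

/-- If `f` takes values in the cyclic group generated by `ζ` and the order of `w` divides that of
`ζ`, then `f` followed by `ζ ^ k ↦ w ^ k` is an endomorphism. -/
theorem exists_endomorphism_of_zpowers {G M : Type*} [Group G] [Group M] (f : G →* M) {ζ : M}
    (hf : ∀ x, f x ∈ Subgroup.zpowers ζ) {w : G} (hw : orderOf w ∣ orderOf ζ) :
    ∃ p : G →* G, ∀ x (k : ℤ), f x = ζ ^ k → p x = w ^ k := by
  have hgen : ∀ x : Subgroup.zpowers ζ,
      x ∈ Subgroup.zpowers (⟨ζ, Subgroup.mem_zpowers ζ⟩ : Subgroup.zpowers ζ) := by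
    rintro ⟨x, k, rfl⟩
    exact ⟨k, rfl⟩
  have hord : orderOf w ∣ orderOf (⟨ζ, Subgroup.mem_zpowers ζ⟩ : Subgroup.zpowers ζ) := by
    rwa [Subgroup.orderOf_mk]
  refine ⟨(monoidHomOfForallMemZpowers hgen hord).comp (f.codRestrict _ hf), fun x k hk => ?_⟩
  have : f.codRestrict _ hf x = (⟨ζ, Subgroup.mem_zpowers ζ⟩ : Subgroup.zpowers ζ) ^ k :=
    Subtype.ext hk
  rw [MonoidHom.comp_apply, this, map_zpow, monoidHomOfForallMemZpowers_apply_gen]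

section Commutative

variable {A : Type*} [CommGroup A] [Finite A]

/-- An element of maximal order in a finite abelian group is separated from a complement by a
character. -/
theorem exists_character_of_orderOf_eq_exponent {g : A} (hg : orderOf g = Monoid.exponent A) :
    ∃ χ : A →* ℂˣ, orderOf (χ g) = orderOf g ∧ ∀ x, χ x ∈ Subgroup.zpowers (χ g) := by
  have : NeZero (Monoid.exponent A) := ⟨Monoid.exponent_ne_zero_of_finite⟩
  obtain ⟨ζ, hζ⟩ := HasEnoughRootsOfUnity.exists_primitiveRoot ℂ (Monoid.exponent A)
  obtain ⟨u, rfl⟩ := hζ.isUnit (NeZero.ne _)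
  have hu : orderOf u = orderOf g := by
    rw [hg, ← orderOf_units, hζ.eq_orderOf]
  have hgen : ∀ x : Subgroup.zpowers g,
      x ∈ Subgroup.zpowers (⟨g, Subgroup.mem_zpowers g⟩ : Subgroup.zpowers g) := by
    rintro ⟨x, k, rfl⟩
    exact ⟨k, rfl⟩
  have hord : orderOf u ∣ orderOf (⟨g, Subgroup.mem_zpowers g⟩ : Subgroup.zpowers g) := by
    rw [Subgroup.orderOf_mk, hu]
  obtain ⟨χ, hχ⟩ := MonoidHom.domRestrict_surjective ℂ (Subgroup.zpowers g)
    (monoidHomOfForallMemZpowers hgen hord)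
  have hχg : χ g = u := by
    have := DFunLike.congr_fun hχ ⟨g, Subgroup.mem_zpowers g⟩
    rwa [monoidHomOfForallMemZpowers_apply_gen] at this
  refine ⟨χ, by rw [hχg, hu], fun x => ?_⟩
  rw [hχg]
  have h1 : IsPrimitiveRoot u (Monoid.exponent A) := IsPrimitiveRoot.coe_units_iff.mp hζ
  rw [h1.zpowers_eq, mem_rootsOfUnity, ← map_pow, Monoid.pow_exponent_eq_one, map_one]

theorem mul_mem_orbit_of_orderOf_eq_exponent {g : A} {χ : A →* ℂˣ}
    (hg : orderOf g = Monoid.exponent A) (hχ : orderOf (χ g) = orderOf g)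
    (hχ' : ∀ x, χ x ∈ Subgroup.zpowers (χ g)) {h : A} (hh : χ h = 1) :
    g * h ∈ MulAction.orbit (MulAut A) g := by
  obtain ⟨p, hp⟩ := exists_endomorphism_of_zpowers χ hχ' (w := h)
    (by rw [hχ, hg]; exact Monoid.order_dvd_exponent h)
  have hpg : p g = h := by simpa using hp g 1 (by simp)
  have := mem_orbit_mulAut_of_injective (MonoidHom.id A * p) (fun x hx => ?_) g
  · simpa [hpg] using this
  · obtain ⟨k, hk⟩ := hχ' x
    have hk' := hp x k hk.symm
    simp only [MonoidHom.mul_apply, MonoidHom.id_apply, hk'] at hx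
    have h2 : χ x = 1 := by simpa [hh] using congrArg χ hx
    have h3 := hp x 0 (by simpa using h2)
    rw [hk'] at h3
    simpa [h3] using hx

theorem mem_of_totient_le_three {n : ℕ} (hn : 0 < n) (h : n.totient ≤ 3) :
    n ∈ ({1, 2, 3, 4, 6} : Set ℕ) := by
  have hle : ∀ m, m ∣ n → m.totient ≤ 3 := fun m hm =>
    (Nat.le_of_dvd (Nat.totient_pos.mpr hn) (Nat.totient_dvd_of_dvd hm)).trans h
  have h12 : n ∣ 12 := by
    rw [Nat.dvd_iff_prime_pow_dvd_dvd]
    intro p k hp hpk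
    rcases Nat.eq_zero_or_pos k with rfl | hk
    · simp
    have hp3 : p < 5 := by
      have := hle p ((dvd_pow_self p hk.ne').trans hpk)
      rw [Nat.totient_prime hp] at this
      omega
    have hk3 : ∀ j, j ≤ k → (p ^ j).totient ≤ 3 := fun j hj => hle _ ((pow_dvd_pow p hj).trans hpk)
    interval_cases p
    · exact absurd hp (by norm_num)
    · exact absurd hp (by norm_num)
    · have : k < 3 := by
        by_contra! hk'
        exact absurd (hk3 3 hk') (by decide)
      interval_cases k <;> norm_num
    · have : k < 2 := by
        by_contra! hk'
        exact absurd (hk3 2 hk') (by decide)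
      interval_cases k; norm_num
    · exact absurd hp (by norm_num)
  have hn12 := Nat.le_of_dvd (by norm_num) h12
  have hne : n ≠ 12 := by
    rintro rfl
    exact absurd h (by decide)
  interval_cases n <;> first | simp; done | omega

theorem totient_exponent_le_maol : (Monoid.exponent A).totient ≤ maol A := by
  classical
  obtain ⟨g, hg⟩ := Monoid.exists_orderOf_eq_exponent (Monoid.ExponentExists.of_finite (G := A))
  refine le_trans ?_ (card_orbit_le_maol g)
  rw [Nat.totient_eq_card_coprime, ← Nat.card_eq_finsetCard]
  refine Nat.card_le_card_of_injective (fun k => ⟨g ^ k.1, ?_⟩) fun k l hkl => ?_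
  · refine mem_orbit_mulAut_of_injective (powMonoidHom k.1) (fun x hx => ?_) g
    have hk : (Monoid.exponent A).Coprime k.1 := (Finset.mem_filter.mp k.2).2
    have := Nat.dvd_gcd (Monoid.order_dvd_exponent x) (orderOf_dvd_of_pow_eq_one hx)
    rw [hk, Nat.dvd_one] at this
    exact orderOf_eq_one_iff.mp this
  · have hk : k.1 < orderOf g :=
      hg.symm ▸ Finset.mem_range.mp (Finset.mem_filter.mp k.2).1
    have hl : l.1 < orderOf g :=
      hg.symm ▸ Finset.mem_range.mp (Finset.mem_filter.mp l.2).1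
    exact Subtype.ext (pow_injOn_Iio_orderOf hk hl (congrArg Subtype.val hkl))

omit [Finite A] in
theorem mulEquiv_zmod_of_mem_zpowers {g : A} (h : ∀ x, x ∈ Subgroup.zpowers g) :
    Nonempty (A ≃* Multiplicative (ZMod (orderOf g))) := by
  have : IsCyclic A := ⟨g, h⟩
  rw [orderOf_eq_card_of_forall_mem_zpowers h]
  exact ⟨(zmodCyclicMulEquiv this).symm⟩

theorem mulEquiv_of_maol_le_three_of_comm (hA : maol A ≤ 3) :
    (∃ m ∈ ({1, 2, 3, 4, 6} : Set ℕ), Nonempty (A ≃* Multiplicative (ZMod m))) ∨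
      Nonempty (A ≃* Multiplicative (ZMod 2 × ZMod 2)) := by
  classical
  obtain ⟨g, hg⟩ := Monoid.exists_orderOf_eq_exponent (Monoid.ExponentExists.of_finite (G := A))
  have hn := mem_of_totient_le_three (orderOf_pos g)
    ((hg ▸ totient_exponent_le_maol (A := A)).trans hA)
  obtain ⟨χ, hχ, hχ'⟩ := exists_character_of_orderOf_eq_exponent hg
  have horb : ∀ h, χ h = 1 → g * h ∈ MulAction.orbit (MulAut A) g := fun h hh =>
    mul_mem_orbit_of_orderOf_eq_exponent hg hχ hχ' hh
  by_cases hker : ∀ h, χ h = 1 → h = 1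
  · refine Or.inl ⟨orderOf g, hn, mulEquiv_zmod_of_mem_zpowers fun x => ?_⟩
    obtain ⟨k, hk⟩ := hχ' x
    refine ⟨k, (mul_inv_eq_one.mp (hker _ ?_)).symm⟩
    simpa [mul_inv_eq_one] using hk.symm
  push Not at hker
  obtain ⟨h, hh, hne⟩ := hker
  have hinv : ∀ x ∈ MulAction.orbit (MulAut A) g, x⁻¹ ∈ MulAction.orbit (MulAut A) g := by
    rintro _ ⟨φ, rfl⟩
    exact ⟨φ.trans (MulEquiv.inv A), rfl⟩
  have hgg := MulAction.mem_orbit_self (M := MulAut A) g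
  have hχ2 : χ g ^ 2 = 1 := by
    rcases exists_eq_of_maol_le_three hA hgg (horb h hh) (hinv _ hgg) (hinv _ (horb h hh))
      with h1 | h1 | h1 | h1 | h1 | h1
    · exact absurd (by simpa using h1) hne
    · have := congrArg χ h1
      rwa [map_inv, eq_inv_iff_mul_eq_one, ← sq] at this
    · have := congrArg χ h1
      rwa [map_inv, map_mul, hh, mul_one, eq_inv_iff_mul_eq_one, ← sq] at this
    · have := congrArg χ h1
      rwa [map_inv, map_mul, hh, mul_one, eq_inv_iff_mul_eq_one, ← sq] at this
    · have := congrArg χ h1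
      rwa [map_inv, map_mul, hh, mul_one, eq_inv_iff_mul_eq_one, ← sq] at this
    · exact absurd (by simpa using h1) hne
  have hg2 : orderOf g = 2 := by
    have h2 := orderOf_dvd_of_pow_eq_one hχ2
    rw [hχ] at h2
    have hle := Nat.le_of_dvd two_pos h2
    have hpos := orderOf_pos g
    have : orderOf g ≠ 1 := fun h1 => by
      have h3 := Monoid.pow_exponent_eq_one h
      rw [← hg, h1, pow_one] at h3
      exact hne h3
    omega
  have hχg : χ g ≠ 1 := fun h1 => by
    rw [h1, orderOf_one, hg2] at hχ
    omega
  have hker : ∀ k, χ k = 1 → k = 1 ∨ k = h := fun k hk => by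
    rcases exists_eq_of_maol_le_three hA hgg (horb h hh) (horb k hk)
      (horb (h * k) (by rw [map_mul, hh, hk, one_mul])) with h1 | h1 | h1 | h1 | h1 | h1
    · exact absurd (by simpa using h1) hne
    · exact Or.inl (by simpa using h1)
    · have hsq : h * h = 1 := by
        rw [← sq, ← hg2, hg, Monoid.pow_exponent_eq_one]
      have h2 : h * k = 1 := by simpa using h1
      exact Or.inr (mul_left_cancel (h2.trans hsq.symm))
    · exact Or.inr (mul_left_cancel h1).symm
    · exact Or.inl (by simpa using h1)
    · exact absurd (by simpa using h1) hne
  have huniv : (Set.univ : Set A) = ({1, h, g, g * h} : Finset A) := by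
    refine (Set.eq_univ_of_forall fun x => ?_).symm
    obtain ⟨k, hk⟩ := hχ' x
    simp only [Finset.coe_insert, Finset.coe_singleton, Set.mem_insert_iff,
      Set.mem_singleton_iff]
    rcases Int.even_or_odd' k with ⟨j, rfl | rfl⟩
    · have : χ x = 1 := by rw [← hk]; simp [zpow_mul, hχ2]
      rcases hker x this with h1 | h1 <;> simp [h1]
    · have : χ (g⁻¹ * x) = 1 := by
        rw [map_mul, ← hk]
        simp [zpow_add, zpow_mul, hχ2]
      rcases hker _ this with h1 | h1
      · simp [(inv_mul_eq_one.mp h1).symm]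
      · simp [inv_mul_eq_iff_eq_mul.mp h1]
  have hcard : Nat.card A = 4 := by
    rw [← Nat.card_univ, huniv]
    have hgh : h ≠ g := fun h1 => hχg (h1 ▸ hh)
    have hg1 : g ≠ 1 := fun h1 => hχg (by rw [h1, map_one])
    have hgh1 : g * h ≠ 1 := fun h1 => hχg (by simpa [hh] using congrArg χ h1)
    have : ({1, h, g, g * h} : Finset A).card = 4 := by
      rw [Finset.card_insert_of_notMem, Finset.card_insert_of_notMem, Finset.card_pair] <;>
        simp [hne, hne.symm, hgh, hg1.symm, hg1, hgh1.symm]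
    simpa using this
  have : IsKleinFour A := ⟨hcard, hg ▸ hg2⟩
  exact Or.inr IsKleinFour.nonempty_mulEquiv

end Commutative

theorem maol_le_three_of_mulEquiv_zmod {G : Type*} [Group G] {m : ℕ}
    (hm : m ∈ ({1, 2, 3, 4, 6} : Set ℕ)) (e : G ≃* Multiplicative (ZMod m)) : maol G ≤ 3 := by
  rcases hm with rfl | rfl | rfl | rfl | rfl <;>
    exact maol_le_three_of_mulEquiv e (by decide)

theorem maol_le_three_of_mulEquiv_klein {G : Type*} [Group G]
    (e : G ≃* Multiplicative (ZMod 2 × ZMod 2)) : maol G ≤ 3 :=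
  maol_le_three_of_mulEquiv e (by decide)

theorem maol_le_three_of_mulEquiv_perm {G : Type*} [Group G]
    (e : G ≃* Equiv.Perm (Fin 3)) : maol G ≤ 3 :=
  maol_le_three_of_mulEquiv e (by decide)

section UniqueRoots

variable {Z : Type*} [CommGroup Z] [Finite Z]

theorem exists_sq_of_unique_involution {z : Z} (hz : z ≠ 1) (hz2 : z ^ 2 = 1)
    (h : ∀ c : Z, c ^ 2 = 1 → c = 1 ∨ c = z) (a b : Z) :
    (∃ d : Z, d ^ 2 = a) ∨ (∃ d : Z, d ^ 2 = b) ∨ ∃ d : Z, d ^ 2 = a * b := by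
  have hker : ((powMonoidHom 2 : Z →* Z).ker : Set Z) = {1, z} := by
    ext c
    simp only [SetLike.mem_coe, MonoidHom.mem_ker, powMonoidHom_apply, Set.mem_insert_iff,
      Set.mem_singleton_iff]
    exact ⟨h c, by rintro (rfl | rfl) <;> simp [hz2]⟩
  have hidx : (powMonoidHom 2 : Z →* Z).range.index = 2 := by
    rw [Subgroup.index_range, ← SetLike.coe_sort_coe, hker, Nat.card_coe_set_eq,
      Set.ncard_pair hz.symm]
  have := Subgroup.mul_mem_iff_of_index_two hidx (a := a) (b := b)
  simp only [MonoidHom.mem_range, powMonoidHom_apply] at this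
  tauto

theorem exists_cube_of_unique_roots {z : Z} (hz : z ≠ 1) (hz3 : z ^ 3 = 1)
    (h : ∀ c : Z, c ^ 3 = 1 → c = 1 ∨ c = z ∨ c = z ^ 2) (a b : Z) :
    (∃ d : Z, d ^ 3 = a) ∨ (∃ d : Z, d ^ 3 = b) ∨ (∃ d : Z, d ^ 3 = a * b) ∨
      ∃ d : Z, d ^ 3 = a * b ^ 2 := by
  have hdec : ∀ u v : Multiplicative (ZMod 3), u = 1 ∨ v = 1 ∨ u * v = 1 ∨ u * v ^ 2 = 1 := by
    decide
  have hker : (powMonoidHom 3 : Z →* Z).ker = Subgroup.zpowers z := by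
    ext c
    simp only [MonoidHom.mem_ker, powMonoidHom_apply]
    refine ⟨fun hc => ?_, ?_⟩
    · rcases h c hc with rfl | rfl | rfl
      · exact one_mem _
      · exact Subgroup.mem_zpowers _
      · exact pow_mem (Subgroup.mem_zpowers _) 2
    · rintro ⟨k, rfl⟩
      simp only
      rw [← zpow_natCast, ← zpow_mul, mul_comm, zpow_mul, zpow_natCast, hz3, one_zpow]
  have hcard : Nat.card (Z ⧸ (powMonoidHom 3 : Z →* Z).range) = 3 := by
    rw [← Subgroup.index_eq_card, Subgroup.index_range, hker, Nat.card_zpowers]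
    have : Fact (Nat.Prime 3) := ⟨Nat.prime_three⟩
    exact orderOf_eq_prime hz3 hz
  have : Fact (Nat.Prime 3) := ⟨Nat.prime_three⟩
  have hcyc := isCyclic_of_prime_card hcard
  have e := zmodCyclicMulEquiv hcyc
  rw [hcard] at e
  have hq : ∀ x : Z, e.symm (QuotientGroup.mk x) = 1 ↔ ∃ d : Z, d ^ 3 = x := fun x => by
    rw [EmbeddingLike.map_eq_one_iff, QuotientGroup.eq_one_iff]
    simp
  have := hdec (e.symm (QuotientGroup.mk a)) (e.symm (QuotientGroup.mk b))
  rwa [← map_pow, ← map_mul, ← map_mul, ← QuotientGroup.mk_pow, ← QuotientGroup.mk_mul,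
    ← QuotientGroup.mk_mul, hq, hq, hq, hq] at this

end UniqueRoots

section IndexTwo

variable {G : Type*} [Group G] [Finite G]

/-- If `C` has index at most two, `w ∈ C` centralizes `C` and is inverted by some `y ∉ C`,
then multiplying the elements outside `C` by `w` is an automorphism. -/
theorem mul_mem_orbit_of_inverted {C : Subgroup G} (hC : ∀ x y, x ∉ C → y ∉ C → x * y ∈ C)
    {y w : G} (hy : y ∉ C) (hw : w ∈ C) (hcomm : ∀ c ∈ C, c * w = w * c)
    (hinv : y * w = w⁻¹ * y) {g : G} (hg : g ∉ C) :
    g * w ∈ MulAction.orbit (MulAut G) g := by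
  classical
  have hinv' : ∀ x, x ∉ C → x * w = w⁻¹ * x := fun x hx => by
    have hc := hC x y⁻¹ hx (by simpa using hy)
    have h1 : x * y⁻¹ * w⁻¹ = w⁻¹ * (x * y⁻¹) := by
      rw [mul_inv_eq_iff_eq_mul, mul_assoc, hcomm _ hc, inv_mul_cancel_left]
    calc x * w = x * y⁻¹ * (y * w) := by group
      _ = (x * y⁻¹ * w⁻¹) * y := by rw [hinv]; group
      _ = w⁻¹ * x := by rw [h1]; group
  let φ : G →* G := MonoidHom.mk' (fun x => if x ∈ C then x else x * w) fun x t => by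
    by_cases hx : x ∈ C <;> by_cases ht : t ∈ C
    · simp [hx, ht, mul_mem hx ht]
    · simp [hx, ht, C.mul_mem_cancel_left hx, mul_assoc]
    · simp [hx, ht, C.mul_mem_cancel_right ht, mul_assoc, hcomm t ht]
    · simp [hx, ht, hC x t hx ht, mul_assoc, hinv' t ht]
  have hφ : φ g = g * w := if_neg hg
  rw [← hφ]
  refine mem_orbit_mulAut_of_injective φ (fun x hx => ?_) g
  change (if x ∈ C then x else x * w) = 1 at hx
  split_ifs at hx with h
  · exact hx
  · exact absurd (by rw [mul_eq_one_iff_eq_inv.mp hx]; exact inv_mem hw) h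

open scoped IsMulCommutative in
/-- If all commutators lie in `{1, z}` and `z` is the only central involution, then `maol G ≤ 3`
forces `G` to be abelian. -/
theorem commute_of_commutators_involution (hG : maol G ≤ 3) {z : G}
    (hzc : ∀ x, x * z = z * x) (hz : z ≠ 1) (hz2 : z * z = 1)
    (hcomm : ∀ x y, x * y = y * x ∨ x * y = y * x * z)
    (huniq : ∀ c, (∀ x, x * c = c * x) → c * c = 1 → c = 1 ∨ c = z) (a b : G) :
    a * b = b * a := by
  by_contra hab
  have hzinv : z⁻¹ = z := inv_eq_of_mul_eq_one_left hz2
  have hroot : ∀ g, g * g = z → ∀ k, k * g = g * k := by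
    intro g hg k
    by_contra hk
    have hC : ∀ x t, x ∉ Subgroup.centralizer {g} → t ∉ Subgroup.centralizer {g} →
        x * t ∈ Subgroup.centralizer {g} := by
      intro x t hx ht
      rw [Subgroup.mem_centralizer_singleton_iff] at *
      have h1 := (hcomm x g).resolve_left hx
      have h2 := (hcomm t g).resolve_left ht
      calc x * t * g = x * (t * g) := by group
        _ = x * g * t * z := by rw [h2]; group
        _ = g * x * (z * t) * z := by rw [h1]; group
        _ = g * (x * t) * (z * z) := by rw [← hzc t]; group
        _ = g * (x * t) := by rw [hz2, mul_one]
    have hk' : k ∉ Subgroup.centralizer {g} := by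
      rwa [Subgroup.mem_centralizer_singleton_iff]
    have hginv : g⁻¹ = g * z := by
      rw [inv_eq_iff_mul_eq_one, ← mul_assoc, hg, hz2]
    have hinv : k * g = g⁻¹ * k := by
      rw [hginv, (hcomm k g).resolve_left hk, mul_assoc, hzc, mul_assoc]
    have hcg : ∀ c ∈ Subgroup.centralizer {g}, c * g = g * c := fun c hc =>
      Subgroup.mem_centralizer_singleton_iff.mp hc
    have hgC : g ∈ Subgroup.centralizer {g} := by
      rw [Subgroup.mem_centralizer_singleton_iff]
    have o1 := mul_mem_orbit_of_inverted hC hk' hgC hcg hinv hk'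
    have o2 := mul_mem_orbit_of_inverted hC hk' (mul_mem hgC hgC)
      (fun c hc => by rw [← mul_assoc, hcg c hc, mul_assoc, hcg c hc, mul_assoc])
      (by rw [hg, hzc, hzinv]) hk'
    have o3 := mul_mem_orbit_of_inverted hC hk' (inv_mem hgC)
      (fun c hc => by rw [mul_inv_eq_iff_eq_mul, mul_assoc, hcg c hc, inv_mul_cancel_left])
      (by rw [mul_inv_eq_iff_eq_mul, inv_inv, mul_assoc, hinv, mul_inv_cancel_left]) hk'
    have hg1 : g ≠ 1 := fun h => hz (by rw [← hg, h, one_mul])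
    rcases exists_eq_of_maol_le_three hG (MulAction.mem_orbit_self k) o1 o2 o3
      with h | h | h | h | h | h
    · exact hg1 (by simpa using h)
    · exact hz (by simpa [hg] using h)
    · exact hg1 (by simpa using h)
    · exact hg1 (by simpa using h)
    · exact hz (by rw [← hg]; exact eq_inv_iff_mul_eq_one.mp (mul_left_cancel h))
    · have h1 := mul_left_cancel h
      rw [hg, hginv] at h1
      exact hg1 (by simpa using h1)
  have hsq : ∀ x, x * x ∈ Subgroup.center G := fun x => by
    refine Subgroup.mem_center_iff.mpr fun t => ?_
    rcases hcomm t x with h | h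
    · rw [← mul_assoc, h, mul_assoc, h, mul_assoc]
    · calc t * (x * x) = t * x * x := by group
        _ = x * t * (z * x) := by rw [h]; group
        _ = x * (t * x) * z := by rw [← hzc]; group
        _ = x * x * t * (z * z) := by rw [h]; group
        _ = x * x * t := by rw [hz2, mul_one]
  have hzZ : z ∈ Subgroup.center G := Subgroup.mem_center_iff.mpr hzc
  have key : ∀ h, (∃ d : Subgroup.center G, d ^ 2 = ⟨h * h, hsq h⟩ * ⟨z, hzZ⟩) →
      ∀ k, k * h = h * k := by
    rintro h ⟨⟨d, hd⟩, hd2⟩ k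
    have hd2' : d * d = h * h * z := by simpa [sq] using congrArg Subtype.val hd2
    have hdc := Subgroup.mem_center_iff.mp hd
    have h3 : (h * d⁻¹) * (h * d⁻¹) = z := by
      have h4 : d⁻¹ * h = h * d⁻¹ := by
        rw [inv_mul_eq_iff_eq_mul, ← mul_assoc, ← hdc, mul_inv_cancel_right]
      calc (h * d⁻¹) * (h * d⁻¹) = h * (d⁻¹ * h) * d⁻¹ := by group
        _ = h * h * (d * d)⁻¹ := by rw [h4]; group
        _ = z⁻¹ := by rw [hd2', hzc]; group
        _ = z := hzinv
    have h5 := hroot _ h3 k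
    calc k * h = k * (h * d⁻¹) * d := by group
      _ = h * d⁻¹ * (k * d) := by rw [h5]; group
      _ = h * k := by rw [hdc k]; group
  have hab2 : (a * b) * (a * b) * z = (a * a * z) * (b * b * z) := by
    have h1 := (hcomm a b).resolve_left hab
    calc (a * b) * (a * b) * z = a * b * (b * a * z) * z := by rw [h1]
      _ = a * (b * b * a) * (z * z) := by group
      _ = a * (a * (b * b)) * (z * z) := by rw [Subgroup.mem_center_iff.mp (hsq b) a]
      _ = a * a * (b * b * z) * z := by group
      _ = a * a * (z * (b * b * z)) := by rw [mul_assoc (a * a), hzc]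
      _ = (a * a * z) * (b * b * z) := by group
  rcases exists_sq_of_unique_involution (Z := Subgroup.center G) (z := ⟨z, hzZ⟩)
    (fun h => hz (congrArg Subtype.val h)) (Subtype.ext (by simpa [sq] using hz2))
    (fun c hc => (huniq c (Subgroup.mem_center_iff.mp c.2)
      (by simpa [sq] using congrArg Subtype.val hc)).imp Subtype.ext Subtype.ext)
    (⟨a * a, hsq a⟩ * ⟨z, hzZ⟩) (⟨b * b, hsq b⟩ * ⟨z, hzZ⟩) with h | h | ⟨d, h⟩
  · exact hab (key a h b).symm
  · exact hab (key b h a)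
  · have := key (a * b) ⟨d, h.trans (Subtype.ext hab2.symm)⟩ a
    exact hab (mul_left_cancel (a := a) (by simpa [mul_assoc] using this))

end IndexTwo

section Dihedral

variable {G : Type*} [Group G] [Finite G]

omit [Finite G] in
theorem orderOf_eq_three {z : G} (hz : z ≠ 1) (hz3 : z ^ 3 = 1) : orderOf z = 3 := by
  have : Fact (Nat.Prime 3) := ⟨Nat.prime_three⟩
  exact orderOf_eq_prime hz3 hz

omit [Finite G] in
/-- If all conjugates of elements `x` outside `C` lie in `x⟨z⟩`, where `z` has order three, then the
elements of `C` are central up to powers of `z`. -/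
theorem exists_mul_mem_center {C : Subgroup G} (hC : ∀ x y, x ∉ C → y ∉ C → x * y ∈ C)
    {y z : G} (hy : y ∉ C) (hzC : ∀ c ∈ C, c * z = z * c)
    (hinv : y * z = z⁻¹ * y) (hz3 : z ^ 3 = 1)
    (hconj : ∀ x, x ∉ C → ∀ u, ∃ k : ℤ, u * x = x * z ^ k * u) {c : G} (hc : c ∈ C) :
    ∃ j : ℤ, z ^ j * c ∈ Subgroup.center G := by
  have hz3' : z ^ (3 : ℤ) = 1 := by exact_mod_cast hz3
  have hyz : ∀ j : ℤ, y * z ^ j = z ^ (-j) * y := fun j => by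
    have := (SemiconjBy.zpow_right (show SemiconjBy y z z⁻¹ from hinv) j).eq
    rwa [inv_zpow'] at this
  have hzc : ∀ j : ℤ, ∀ c ∈ C, c * z ^ j = z ^ j * c := fun j c hc =>
    (Commute.zpow_right (show Commute c z from hzC c hc) j).eq
  have hfix : ∀ c ∈ C, ∃ j : ℤ, z ^ j * c * y = y * (z ^ j * c) := fun c hc => by
    obtain ⟨k, hk⟩ := hconj y hy c
    refine ⟨-k, ?_⟩
    calc z ^ (-k) * c * y = z ^ (-k) * (y * z ^ k) * c := by rw [mul_assoc, hk]; group
      _ = z ^ (-(2 * k)) * y * c := by rw [hyz]; group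
      _ = (z ^ (3 : ℤ)) ^ k * z ^ (-(2 * k)) * y * c := by rw [hz3', one_zpow, one_mul]
      _ = z ^ (-(-k)) * y * c := by rw [← zpow_mul, ← zpow_add]; ring_nf
      _ = y * (z ^ (-k) * c) := by rw [← hyz, mul_assoc]
  obtain ⟨j, hj⟩ := hfix c hc
  refine ⟨j, ?_⟩
  have hcC : ∀ d ∈ C, z ^ j * c * d = d * (z ^ j * c) := fun d hd => by
    obtain ⟨l, hl⟩ := hfix d hd
    have hyd : y * d ∉ C := fun h => hy ((C.mul_mem_cancel_right hd).mp h)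
    obtain ⟨m, hm⟩ := hconj (y * d) hyd (z ^ j * c)
    have hcz : z ^ j * c * z ^ l = z ^ l * (z ^ j * c) := by
      rw [mul_assoc, hzc l c hc]; group
    generalize z ^ j * c = c' at hj hm hcz ⊢
    have h1 : c' * d = z ^ m * d * c' := by
      rw [← hzc m d hd]
      refine mul_left_cancel (a := y) ?_
      rw [← mul_assoc, ← hj, mul_assoc, hm]
      group
    have h2 : c' * (z ^ l * d) = z ^ m * ((z ^ l * d) * c') := by
      rw [← mul_assoc, hcz, mul_assoc, h1]
      group
    have h3 : z ^ m * (z ^ l * d * c' * y) = z ^ (-m) * (z ^ l * d * c' * y) := by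
      calc z ^ m * (z ^ l * d * c' * y) = c' * (z ^ l * d * y) := by rw [← mul_assoc c', h2]; group
        _ = y * (c' * (z ^ l * d)) := by rw [hl, ← mul_assoc, hj]; group
        _ = y * z ^ m * (z ^ l * d) * c' := by rw [h2]; group
        _ = z ^ (-m) * (y * (z ^ l * d)) * c' := by rw [hyz]; group
        _ = z ^ (-m) * (z ^ l * d) * (y * c') := by rw [← hl]; group
        _ = z ^ (-m) * (z ^ l * d * c' * y) := by rw [← hj]; group
    have h4 : z ^ m = 1 := by
      have h5 : z ^ m * z ^ m = 1 := by
        have h6 := mul_right_cancel h3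
        rwa [zpow_neg, eq_inv_iff_mul_eq_one] at h6
      calc z ^ m = (z ^ (3 : ℤ)) ^ m * (z ^ m * z ^ m)⁻¹ := by
            rw [← zpow_mul, ← zpow_add, ← zpow_neg, ← zpow_add]; ring_nf
        _ = 1 := by rw [hz3', h5]; simp
    rw [h1, h4, one_mul]
  refine Subgroup.mem_center_iff.mpr fun x => ?_
  by_cases hx : x ∈ C
  · exact (hcC x hx).symm
  · have h1 := hcC _ (hC y⁻¹ x (by simpa using hy) hx)
    calc x * (z ^ j * c) = y * (y⁻¹ * x * (z ^ j * c)) := by group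
      _ = y * (z ^ j * c) * (y⁻¹ * x) := by rw [← h1]; group
      _ = z ^ j * c * x := by rw [← hj]; group

/-- Inversion composed with conjugation by `y ∉ C` on an abelian subgroup `C` of index two extends
to an automorphism of the whole group. -/
theorem mul_inv_mem_orbit {C : Subgroup G} (hC : ∀ x y, x ∉ C → y ∉ C → x * y ∈ C)
    (hab : ∀ c ∈ C, ∀ d ∈ C, c * d = d * c) {y : G} (hy : y ∉ C) {c : G} (hc : c ∈ C) :
    y * c⁻¹ * y⁻¹ ∈ MulAction.orbit (MulAut G) c := by
  classical
  have hnorm : ∀ d ∈ C, ∀ t, t ∉ C → t * d * t⁻¹ ∈ C := fun d hd t ht =>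
    hC _ _ (fun h => ht ((C.mul_mem_cancel_right hd).mp h)) (by simpa using ht)
  have hconj : ∀ x ∈ C, ∀ t, t ∉ C → t * (y * x * y⁻¹) = x * t := fun x hx t ht => by
    calc t * (y * x * y⁻¹) = (t * y * x) * y⁻¹ := by group
      _ = x * t := by rw [hab _ (hC t y ht hy) x hx]; group
  let φ : G →* G := MonoidHom.mk' (fun x => if x ∈ C then y * x⁻¹ * y⁻¹ else x⁻¹) fun x t => by
    by_cases hx : x ∈ C <;> by_cases ht : t ∈ C
    · simp only [hx, ht, mul_mem hx ht, if_true]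
      rw [hab x hx t ht]
      group
    · simp only [hx, ht, C.mul_mem_cancel_left hx, if_true, if_false]
      rw [← inv_inj, inv_inv, mul_inv_rev, inv_inv, ← hconj x hx t ht]
      group
    · simp only [hx, ht, C.mul_mem_cancel_right ht, if_true, if_false]
      have h1 := hconj _ (hnorm t ht y hy) x hx
      have h2 : y * (y * t * y⁻¹) * y⁻¹ = t := by
        calc y * (y * t * y⁻¹) * y⁻¹ = y * y * t * (y⁻¹ * y⁻¹) := by group
          _ = t := by rw [hab _ (hC y y hy hy) t ht]; group
      rw [h2] at h1
      rw [h1]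
      group
    · simp only [hx, ht, hC x t hx ht, if_true, if_false]
      have h1 := hconj _ (hC x t hx ht) t⁻¹ (by simpa using ht)
      rw [mul_inv_cancel_right, inv_mul_eq_iff_eq_mul] at h1
      calc y * (x * t)⁻¹ * y⁻¹ = (y * (x * t) * y⁻¹)⁻¹ := by group
        _ = x⁻¹ * t⁻¹ := by rw [h1]; group
  have hφ : φ c = y * c⁻¹ * y⁻¹ := if_pos hc
  rw [← hφ]
  refine mem_orbit_mulAut_of_injective φ (fun x hx => ?_) c
  change (if x ∈ C then y * x⁻¹ * y⁻¹ else x⁻¹) = 1 at hx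
  split_ifs at hx with h
  · simpa using hx
  · simpa using hx

omit [Finite G] in
theorem mem_of_commute_of_inverted {C : Subgroup G} (hC : ∀ x y, x ∉ C → y ∉ C → x * y ∈ C)
    {y z : G} (hy : y ∉ C) (hcomm : ∀ c ∈ C, c * z = z * c) (hinv : y * z = z⁻¹ * y)
    (hz2 : z * z ≠ 1) {u : G} (hu : u * z = z * u) : u ∈ C := by
  by_contra h
  have h1 := hcomm _ (hC u y h hy)
  have h2 : u * z⁻¹ = z⁻¹ * u := (Commute.inv_right (show Commute u z from hu)).eq
  rw [mul_assoc, hinv, ← mul_assoc, h2, mul_assoc] at h1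
  exact hz2 (inv_eq_iff_mul_eq_one.mp (mul_right_cancel h1))

/-- A group with a subgroup of index two generated by an element `z` of order three that is
inverted by some `y` is the symmetric group of degree three. -/
theorem mulEquiv_perm_three (hG : maol G ≤ 3) {C : Subgroup G}
    (hC : ∀ x y, x ∉ C → y ∉ C → x * y ∈ C) {y z : G} (hy : y ∉ C)
    (hCz : C = Subgroup.zpowers z) (hord : orderOf z = 3) (hinv : y * z = z⁻¹ * y) :
    Nonempty (G ≃* Equiv.Perm (Fin 3)) := by
  have hz3 : z ^ 3 = 1 := hord ▸ pow_orderOf_eq_one z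
  have hz1 : z ≠ 1 := fun h => by simp [h] at hord
  have hz2 : z * z ≠ 1 := fun h => hz1 (by rwa [pow_succ, sq, h, one_mul] at hz3)
  have hzC : z ∈ C := hCz ▸ Subgroup.mem_zpowers z
  have hcomm : ∀ c ∈ C, c * z = z * c := by
    rw [hCz]
    rintro _ ⟨k, rfl⟩
    exact (Commute.zpow_self z k).eq
  have hcard : Nat.card G = 6 := by
    have h2 : C.index = 2 := Subgroup.index_eq_two_iff.mpr ⟨y, fun b => by
      by_cases hb : b ∈ C
      · exact Or.inr ⟨hb, fun h => hy ((C.mul_mem_cancel_left hb).mp h)⟩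
      · exact Or.inl ⟨hC b y hb hy, hb⟩⟩
    rw [← C.card_mul_index, h2, hCz, Nat.card_zpowers, hord]
  have o1 := MulAction.mem_orbit_self (M := MulAut G) y
  have o2 := mul_mem_orbit_of_inverted hC hy hzC hcomm hinv hy
  have o3 := mul_mem_orbit_of_inverted hC hy (inv_mem hzC)
    (fun c hc => by rw [mul_inv_eq_iff_eq_mul, mul_assoc, hcomm c hc, inv_mul_cancel_left])
    (by rw [mul_inv_eq_iff_eq_mul, inv_inv, mul_assoc, hinv, mul_inv_cancel_left]) hy
  have horb : Nat.card (MulAction.orbit (MulAut G) y) = 3 := by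
    refine le_antisymm ((card_orbit_le_maol y).trans hG) ?_
    classical
    have hs : (({y, y * z, y * z⁻¹} : Finset G) : Set G) ⊆ MulAction.orbit (MulAut G) y := by
      intro x hx
      simp only [Finset.coe_insert, Finset.coe_singleton, Set.mem_insert_iff,
        Set.mem_singleton_iff] at hx
      rcases hx with rfl | rfl | rfl <;> assumption
    have h3 : ({y, y * z, y * z⁻¹} : Finset G).card = 3 := by
      rw [Finset.card_insert_of_notMem, Finset.card_pair]
      · simpa [eq_inv_iff_mul_eq_one] using hz2
      · simp [hz1]
    have h4 := Nat.card_mono (Set.toFinite _) hs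
    simpa [h3] using h4
  let ρ : G →* Equiv.Perm (MulAction.orbit (MulAut G) y) :=
    (MulAction.toPermHom (MulAut G) (MulAction.orbit (MulAut G) y)).comp MulAut.conj
  have hρ : Function.Injective ρ := by
    refine (injective_iff_map_eq_one ρ).mpr fun u hu => ?_
    have hfix : ∀ t ∈ MulAction.orbit (MulAut G) y, u * t = t * u := fun t ht => by
      have h1 : ρ u ⟨t, ht⟩ = ⟨t, ht⟩ := by rw [hu, Equiv.Perm.one_apply]
      exact mul_inv_eq_iff_eq_mul.mp (congrArg Subtype.val h1)
    have huy := hfix y o1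
    have huz : u * z = z * u := by
      have h1 := hfix _ o2
      rw [← mul_assoc, huy, mul_assoc, mul_assoc] at h1
      exact mul_left_cancel h1
    have huC := mem_of_commute_of_inverted hC hy hcomm hinv hz2 huz
    rw [hCz] at huC
    obtain ⟨k, rfl⟩ := huC
    have h1 : y * z ^ k = (z ^ k)⁻¹ * y := by
      rw [← inv_zpow]
      exact (SemiconjBy.zpow_right (show SemiconjBy y z z⁻¹ from hinv) k).eq
    have h2 : z ^ k * z ^ k = 1 :=
      eq_inv_iff_mul_eq_one.mp (mul_right_cancel (huy.trans h1))
    have h3 : (z ^ k) ^ 3 = 1 := by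
      rw [← zpow_natCast, ← zpow_mul, mul_comm, zpow_mul, zpow_natCast, hz3, one_zpow]
    rwa [pow_succ, sq, h2, one_mul] at h3
  have hbij : Function.Bijective ρ :=
    hρ.bijective_of_nat_card_le (by rw [Nat.card_perm, horb, hcard]; decide)
  exact ⟨(MulEquiv.ofBijective ρ hbij).trans (Finite.equivFinOfCardEq horb).permCongrHom⟩

/-- If `maol G ≤ 3` and `G` has an element `z` of order three with centralizer `C` of index two,
then `G` is the symmetric group of degree three. -/
theorem mulEquiv_perm_three_of_inverted (hG : maol G ≤ 3) {C : Subgroup G}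
    (hC : ∀ x y, x ∉ C → y ∉ C → x * y ∈ C) {y z : G} (hy : y ∉ C) (hzC : z ∈ C)
    (hcomm : ∀ c ∈ C, c * z = z * c) (hinv : y * z = z⁻¹ * y) (hz : z ≠ 1) (hz3 : z ^ 3 = 1) :
    Nonempty (G ≃* Equiv.Perm (Fin 3)) := by
  have hz2 : z * z ≠ 1 := fun h => hz (by rwa [pow_succ, sq, h, one_mul] at hz3)
  have hyz' : y * z⁻¹ = z * y := by
    rw [mul_inv_eq_iff_eq_mul, mul_assoc, hinv, mul_inv_cancel_left]
  have horb : ∀ x, x ∉ C → x * z ∈ MulAction.orbit (MulAut G) x ∧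
      x * z⁻¹ ∈ MulAction.orbit (MulAut G) x := fun x hx =>
    ⟨mul_mem_orbit_of_inverted hC hy hzC hcomm hinv hx,
      mul_mem_orbit_of_inverted hC hy (inv_mem hzC)
        (fun c hc => by rw [mul_inv_eq_iff_eq_mul, mul_assoc, hcomm c hc, inv_mul_cancel_left])
        (by rw [hyz', inv_inv]) hx⟩
  have hzz : z ≠ z⁻¹ := fun h => hz2 (eq_inv_iff_mul_eq_one.mp h)
  have hconj : ∀ x, x ∉ C → ∀ u, ∃ k : ℤ, u * x = x * z ^ k * u := fun x hx u => by
    rcases exists_eq_of_maol_le_three hG (MulAction.mem_orbit_self x) (horb x hx).1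
      (horb x hx).2 (conj_mem_orbit_mulAut x u) with h | h | h | h | h | h
    · exact absurd (by simpa using h) hz
    · exact absurd (by simpa using h) hz
    · exact ⟨0, by rw [zpow_zero, mul_one]; exact (eq_mul_inv_iff_mul_eq.mp h).symm⟩
    · exact absurd (mul_left_cancel h) hzz
    · exact ⟨1, by rw [zpow_one]; exact (eq_mul_inv_iff_mul_eq.mp h).symm⟩
    · exact ⟨-1, by rw [zpow_neg_one]; exact (eq_mul_inv_iff_mul_eq.mp h).symm⟩
  have hcen := fun c hc => exists_mul_mem_center hC hy hcomm hinv hz3 hconj (c := c) hc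
  have hab : ∀ c ∈ C, ∀ d ∈ C, c * d = d * c := fun c hc d hd => by
    obtain ⟨j, hj⟩ := hcen d hd
    have h1 := Subgroup.mem_center_iff.mp hj c
    have h2 : c * z ^ j = z ^ j * c :=
      (Commute.zpow_right (show Commute c z from hcomm c hc) j).eq
    rw [← mul_assoc, h2, mul_assoc, mul_assoc] at h1
    exact mul_left_cancel h1
  have hpow : ∀ {c : G} {k : ℤ}, (∀ x, x * c = c * x) → c = z ^ k → c = 1 := by
    rintro _ k hc rfl
    have h1 : y * z ^ k = (z ^ k)⁻¹ * y := by
      rw [← inv_zpow]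
      exact (SemiconjBy.zpow_right (show SemiconjBy y z z⁻¹ from hinv) k).eq
    have h2 : z ^ k * z ^ k = 1 :=
      eq_inv_iff_mul_eq_one.mp (mul_right_cancel ((hc y).symm.trans h1))
    have h3 : (z ^ k) ^ 3 = 1 := by
      rw [← zpow_natCast, ← zpow_mul, mul_comm, zpow_mul, zpow_natCast, hz3, one_zpow]
    rwa [pow_succ, sq, h2, one_mul] at h3
  have htriv : ∀ c ∈ Subgroup.center G, c = 1 := fun c hc => by
    rw [Subgroup.mem_center_iff] at hc
    have hcC := mem_of_commute_of_inverted hC hy hcomm hinv hz2 (hc z).symm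
    by_contra hc1
    have hnz := fun k (h : c = z ^ k) => hc1 (hpow hc h)
    have hcc : c * c ≠ 1 := fun h => by
      have o := mul_mem_orbit_of_inverted hC hy hcC (fun d _ => hc d)
        (by rw [inv_eq_of_mul_eq_one_left h, hc]) hy
      rcases exists_eq_of_maol_le_three hG (MulAction.mem_orbit_self y) (horb y hy).1
        (horb y hy).2 o with h | h | h | h | h | h
      · exact hz (by simpa using h)
      · exact hz (by simpa using h)
      · exact hc1 (by simpa using h)
      · exact hzz (mul_left_cancel h)
      · exact hnz 1 (by rw [zpow_one, mul_left_cancel h])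
      · exact hnz (-1) (by rw [zpow_neg_one, mul_left_cancel h])
    have hci : ∀ x, x * c⁻¹ = c⁻¹ * x := fun x =>
      (Commute.inv_right (show Commute x c from hc x)).eq
    have o1 : z⁻¹ * c ∈ MulAction.orbit (MulAut G) (z * c) := by
      have h1 : z⁻¹ * c = y * (z * c) * y⁻¹ := by
        rw [← mul_assoc, hinv, mul_assoc z⁻¹, hc y]; group
      exact h1 ▸ conj_mem_orbit_mulAut _ _
    have h2 : y * (z * c)⁻¹ * y⁻¹ = z * c⁻¹ := by
      rw [mul_inv_rev, ← hci, ← mul_assoc, hyz', mul_assoc z, hci y]; group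
    have o2 : z * c⁻¹ ∈ MulAction.orbit (MulAut G) (z * c) :=
      h2 ▸ mul_inv_mem_orbit hC hab hy (mul_mem hzC hcC)
    have o3 : z⁻¹ * c⁻¹ ∈ MulAction.orbit (MulAut G) (z * c) := by
      rw [← MulAction.orbit_eq_iff.mpr o2]
      have h1 : z⁻¹ * c⁻¹ = y * (z * c⁻¹) * y⁻¹ := by
        rw [← mul_assoc, hinv, mul_assoc z⁻¹, hci y]; group
      exact h1 ▸ conj_mem_orbit_mulAut _ _
    have hcz : ∀ k : ℤ, c * c ≠ z ^ k := fun k h =>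
      hcc (hpow (fun x => by rw [← mul_assoc, hc x, mul_assoc, hc x, mul_assoc]) h)
    rcases exists_eq_of_maol_le_three hG (MulAction.mem_orbit_self (z * c)) o1 o2 o3
      with h | h | h | h | h | h
    · exact hzz (mul_right_cancel h)
    · exact hcc (eq_inv_iff_mul_eq_one.mp (mul_left_cancel h))
    · refine hcz (-2) ?_
      rw [← eq_inv_mul_iff_mul_eq] at h
      calc c * c = z⁻¹ * (z⁻¹ * c⁻¹) * c := by rw [← h]
        _ = z ^ (-2 : ℤ) := by group
    · refine hcz 2 ?_
      rw [inv_mul_eq_iff_eq_mul] at h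
      calc c * c = z * (z * c⁻¹) * c := by rw [← h]
        _ = z ^ (2 : ℤ) := by rw [zpow_two]; group
    · exact hcc (eq_inv_iff_mul_eq_one.mp (mul_left_cancel h))
    · exact hzz (mul_right_cancel h)
  refine mulEquiv_perm_three hG hC hy (le_antisymm (fun c hc => ?_) ?_)
    (orderOf_eq_three hz hz3) hinv
  · obtain ⟨j, hj⟩ := hcen c hc
    exact ⟨-j, (zpow_neg z j).trans <| inv_eq_of_mul_eq_one_right (htriv _ hj)⟩
  · rwa [Subgroup.zpowers_le]

end Dihedral

section Nonabelian

variable {G : Type*} [Group G] [Finite G]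

/-- If some centralizer has index two, then `maol G ≤ 3` forces `G` to be `S₃`. -/
theorem mulEquiv_perm_three_of_index_two (hG : maol G ≤ 3) {g : G}
    (hidx : (Subgroup.centralizer {g}).index = 2) : Nonempty (G ≃* Equiv.Perm (Fin 3)) := by
  have hC : ∀ x y, x ∉ Subgroup.centralizer {g} → y ∉ Subgroup.centralizer {g} →
      x * y ∈ Subgroup.centralizer {g} := fun x y hx hy => by
    rw [Subgroup.mul_mem_iff_of_index_two hidx]
    exact iff_of_false hx hy
  obtain ⟨y, hy⟩ : ∃ y, y ∉ Subgroup.centralizer {g} := by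
    by_contra! h
    rw [(Subgroup.eq_top_iff' _).mpr h, Subgroup.index_top] at hidx
    omega
  have hgC : g ∈ Subgroup.centralizer {g} := by rw [Subgroup.mem_centralizer_singleton_iff]
  have hg : ∀ c ∈ Subgroup.centralizer {g}, c * g = g * c := fun c hc =>
    Subgroup.mem_centralizer_singleton_iff.mp hc
  have hyg : y * g ≠ g * y := fun h => hy (Subgroup.mem_centralizer_singleton_iff.mpr h)
  generalize Subgroup.centralizer {g} = C at *
  have hnormal : C.Normal := Subgroup.normal_of_index_eq_two hidx
  obtain ⟨z, hz⟩ : ∃ z, z = g⁻¹ * (y * g * y⁻¹) := ⟨_, rfl⟩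
  have hzC : z ∈ C := hz ▸ mul_mem (inv_mem hgC) (hnormal.conj_mem g hgC y)
  have hyg' : y * g = g * z * y := by rw [hz]; group
  have hcomm : ∀ c ∈ C, c * z = z * c := fun c hc => by
    have h1 := hg _ (hnormal.conj_mem c hc y⁻¹)
    have h2 : c * (y * g * y⁻¹) = y * g * y⁻¹ * c := by
      calc c * (y * g * y⁻¹) = y * (y⁻¹ * c * y⁻¹⁻¹ * g) * y⁻¹ := by group
        _ = y * g * y⁻¹ * c := by rw [h1]; group
    have h3 : c * g⁻¹ = g⁻¹ * c := (Commute.inv_right (show Commute c g from hg c hc)).eq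
    rw [hz, ← mul_assoc, h3, mul_assoc, h2]
    group
  have hinv : y * z = z⁻¹ * y := by
    have h1 := hg _ (hC y y hy hy)
    have h2 : y * g * y⁻¹ = y⁻¹ * g * y := by
      calc y * g * y⁻¹ = y⁻¹ * (y * y * g) * y⁻¹ := by group
        _ = y⁻¹ * g * y := by rw [h1]; group
    calc y * z = y * g⁻¹ * (y * g * y⁻¹) := by rw [hz]; group
      _ = z⁻¹ * y := by rw [h2, hz]; group
  have hz1 : z ≠ 1 := by
    rintro rfl
    exact hyg (by rw [hyg', mul_one])
  have hzinv : ∀ c ∈ C, c * z⁻¹ = z⁻¹ * c := fun c hc =>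
    (Commute.inv_right (show Commute c z from hcomm c hc)).eq
  have hyz' : y * z⁻¹ = z * y := by
    rw [mul_inv_eq_iff_eq_mul, mul_assoc, hinv, mul_inv_cancel_left]
  by_cases hz2 : z * z = 1
  · exfalso
    have hzi : z⁻¹ = z := inv_eq_of_mul_eq_one_left hz2
    rw [hzi] at hinv
    have hout : ∀ x, x ∉ C → y⁻¹ * x ∈ C := fun x hx => hC _ _ (by simpa using hy) hx
    have hzc : ∀ x, x * z = z * x := fun x => by
      by_cases hx : x ∈ C
      · exact hcomm x hx
      · have h1 := hcomm _ (hout x hx)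
        calc x * z = y * (y⁻¹ * x * z) := by group
          _ = y * z * (y⁻¹ * x) := by rw [h1]; group
          _ = z * x := by rw [hinv]; group
    have huniq : ∀ c, (∀ x, x * c = c * x) → c * c = 1 → c = 1 ∨ c = z := fun c hc hcc => by
      have hcC : c ∈ C := by
        by_contra h
        have h1 := hg _ (hC c y h hy)
        refine hyg (mul_left_cancel (a := c) ?_)
        rw [← mul_assoc, h1, ← mul_assoc, hc g, ← mul_assoc]
      have horb := fun w (hw : w ∈ C) (hwc : ∀ x, x * w = w * x) (hw2 : w * w = 1) =>
        mul_mem_orbit_of_inverted hC hy hw (fun d _ => hwc d)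
          (by rw [inv_eq_of_mul_eq_one_left hw2, hwc]) hy
      rcases exists_eq_of_maol_le_three hG (MulAction.mem_orbit_self y) (horb z hzC hzc hz2)
        (horb c hcC hc hcc) (horb (z * c) (mul_mem hzC hcC)
          (fun x => by rw [← mul_assoc, hzc, mul_assoc, hc, mul_assoc])
          (by rw [mul_assoc, ← mul_assoc c, hzc c, mul_assoc z c, hcc, mul_one, hz2]))
        with h | h | h | h | h | h
      · exact absurd (by simpa using h) hz1
      · exact Or.inl (by simpa using h)
      · have h1 : z * c = 1 := by simpa using h
        exact Or.inr (mul_left_cancel (h1.trans hz2.symm))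
      · exact Or.inr (mul_left_cancel h).symm
      · exact Or.inl (by simpa using h)
      · exact absurd (by simpa using h) hz1
    have hout2 : ∀ x, x ∉ C → ∀ u, u * x = x * u ∨ u * x = x * u * z := fun x hx u => by
      have o1 := mul_mem_orbit_of_inverted hC hy hzC hcomm (by rw [hzi, hinv]) hx
      have o2 := conj_mem_orbit_mulAut x u
      have o3 : u * x * u⁻¹ * z ∈ MulAction.orbit (MulAut G) x := by
        rw [← MulAction.orbit_eq_iff.mpr o1]
        refine ⟨MulAut.conj u, ?_⟩
        change u * (x * z) * u⁻¹ = _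
        calc u * (x * z) * u⁻¹ = u * x * (z * u⁻¹) := by group
          _ = u * x * u⁻¹ * z := by rw [← hzc]; group
      have e1 : u * x * u⁻¹ = x → u * x = x * u := mul_inv_eq_iff_eq_mul.mp
      have e2 : u * x * u⁻¹ = x * z → u * x = x * u * z := fun h => by
        rw [mul_inv_eq_iff_eq_mul.mp h, mul_assoc, ← hzc, mul_assoc]
      rcases exists_eq_of_maol_le_three hG (MulAction.mem_orbit_self x) o1 o2 o3
        with h | h | h | h | h | h
      · exact absurd (by simpa using h) hz1
      · exact Or.inl (e1 h.symm)
      · exact Or.inr (e2 (by have := eq_mul_inv_iff_mul_eq.mpr h.symm; rwa [hzi] at this))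
      · exact Or.inr (e2 h.symm)
      · exact Or.inl (e1 (mul_right_cancel h).symm)
      · exact absurd (by simpa using h) hz1
    have hcommut : ∀ u x, u * x = x * u ∨ u * x = x * u * z := fun u x => by
      by_cases hx : x ∈ C
      · have hx' : y⁻¹ * x ∉ C := fun h => hy (by simpa using (C.mul_mem_cancel_right hx).mp h)
        have hx1 : u * x = (u * y) * (y⁻¹ * x) := by group
        have hx2 : x * u = y * ((y⁻¹ * x) * u) := by group
        rcases hout2 y hy u with h1 | h1 <;> rcases hout2 _ hx' u with h2 | h2
        · left; rw [hx1, h1, mul_assoc, h2, hx2]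
        · right; rw [hx1, h1, mul_assoc, h2, hx2]; group
        · right; rw [hx1, h1, mul_assoc, ← hzc, ← mul_assoc, mul_assoc y, h2, hx2]
        · left
          rw [hx1, h1, mul_assoc, ← hzc, ← mul_assoc, mul_assoc y, h2, hx2, ← mul_assoc y,
            mul_assoc _ z, hz2, mul_one]
      · exact hout2 x hx u
    exact hyg (commute_of_commutators_involution hG hzc hz1 hz2 hcommut huniq y g)
  · refine mulEquiv_perm_three_of_inverted hG hC hy hzC hcomm hinv hz1 ?_
    have o1 := mul_mem_orbit_of_inverted hC hy hzC hcomm hinv hy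
    have o2 := mul_mem_orbit_of_inverted hC hy (inv_mem hzC) hzinv (by rw [inv_inv, hyz']) hy
    have o3 := mul_mem_orbit_of_inverted hC hy (mul_mem hzC hzC)
      (fun c hc => by rw [← mul_assoc, hcomm c hc, mul_assoc, hcomm c hc, mul_assoc])
      (by rw [← mul_assoc, hinv, mul_assoc, hinv]; group) hy
    rcases exists_eq_of_maol_le_three hG (MulAction.mem_orbit_self y) o1 o2 o3
      with h | h | h | h | h | h
    · exact absurd (by simpa using h) hz1
    · exact absurd (by simpa using h) hz1
    · exact absurd (by simpa using h) hz2
    · exact absurd (eq_inv_iff_mul_eq_one.mp (mul_left_cancel h)) hz2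
    · exact absurd (by simpa using h) hz1
    · rw [pow_succ, sq, ← mul_left_cancel h, inv_mul_cancel]

end Nonabelian

section IndexThree

variable {G : Type*} [Group G] [Finite G]

theorem index_centralizer_le_three (hG : maol G ≤ 3) (g : G) :
    (Subgroup.centralizer {g}).index ≤ 3 := by
  refine le_trans ?_ ((card_orbit_le_maol g).trans hG)
  refine Nat.card_le_card_of_injective
    (fun q : G ⧸ Subgroup.centralizer {g} => ⟨q.out * g * q.out⁻¹, conj_mem_orbit_mulAut g q.out⟩)
    fun q r hqr => ?_
  have h : q.out * g * q.out⁻¹ = r.out * g * r.out⁻¹ := congrArg Subtype.val hqr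
  rw [← QuotientGroup.out_eq' q, ← QuotientGroup.out_eq' r, QuotientGroup.eq,
    Subgroup.mem_centralizer_singleton_iff]
  calc q.out⁻¹ * r.out * g = q.out⁻¹ * (r.out * g * r.out⁻¹) * r.out := by group
    _ = g * (q.out⁻¹ * r.out) := by rw [← h]; group

/-- If all noncentral centralizers have index three, then `G` acts on the cosets of each of them
through the alternating group. -/
theorem exists_even_perm_hom (h3 : ∀ g : G, g ∉ Subgroup.center G →
      (Subgroup.centralizer {g}).index = 3) {g : G} (hg : g ∉ Subgroup.center G) :
    ∃ ρ : G →* Equiv.Perm (Fin 3), ρ.ker ≤ Subgroup.centralizer {g} ∧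
      ∀ x, Equiv.Perm.sign (ρ x) = 1 := by
  have : Fact (Nat.Prime 3) := ⟨Nat.prime_three⟩
  obtain ⟨ρ, hρ⟩ : ∃ ρ : G →* Equiv.Perm (Fin 3),
      ρ.ker = (Subgroup.centralizer {g}).normalCore := by
    let e : G ⧸ Subgroup.centralizer {g} ≃ Fin 3 := Finite.equivFinOfCardEq (h3 g hg)
    refine ⟨e.permCongrHom.toMonoidHom.comp (MulAction.toPermHom G _), ?_⟩
    rw [Subgroup.normalCore_eq_ker]
    ext x
    simp [MonoidHom.mem_ker]
  have hker : ρ.ker ≤ Subgroup.centralizer {g} := hρ ▸ Subgroup.normalCore_le _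
  have hcenter : Subgroup.center G ≤ ρ.ker := by
    rw [hρ, Subgroup.normal_le_normalCore]
    exact Subgroup.center_le_centralizer _
  refine ⟨ρ, hker, fun x => ?_⟩
  obtain ⟨⟨t, ht⟩, hs⟩ := exists_prime_orderOf_dvd_card' (G := ρ.range) 3 (by
    rw [← Subgroup.index_ker]
    exact (h3 g hg).symm.dvd.trans (Subgroup.index_dvd_of_le hker))
  rw [Subgroup.orderOf_mk] at hs
  obtain ⟨s, rfl⟩ := ht
  have hs1 : ρ s ≠ 1 := fun h => by simp [h] at hs
  have hs3 : ρ s ^ 3 = 1 := orderOf_dvd_iff_pow_eq_one.mp hs.dvd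
  have hidx := h3 s fun h => hs1 (hcenter h)
  have hdec : ∀ σ τ : Equiv.Perm (Fin 3), σ ≠ 1 → σ ^ 3 = 1 → τ * σ = σ * τ →
      Equiv.Perm.sign τ = 1 := by decide
  have hle : Subgroup.centralizer {s} ≤ (Equiv.Perm.sign.comp ρ).ker := fun t ht =>
    hdec (ρ s) (ρ t) hs1 hs3 (by
      rw [← map_mul, ← map_mul, Subgroup.mem_centralizer_singleton_iff.mp ht])
  have h1 := Subgroup.index_dvd_of_le hle
  rw [hidx] at h1
  have h2 : (Equiv.Perm.sign.comp ρ).ker.index ∣ 2 := by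
    rw [Subgroup.index_ker]
    simpa using Subgroup.card_subgroup_dvd_card (Equiv.Perm.sign.comp ρ).range
  have h4 := Subgroup.index_eq_one.mp (Nat.dvd_one.mp (Nat.dvd_gcd h1 h2))
  exact (h4 ▸ Subgroup.mem_top x : x ∈ (Equiv.Perm.sign.comp ρ).ker)

theorem pow_three_mem_center (h3 : ∀ g : G, g ∉ Subgroup.center G →
    (Subgroup.centralizer {g}).index = 3) (x : G) : x ^ 3 ∈ Subgroup.center G := by
  refine Subgroup.mem_center_iff.mpr fun g => ?_
  by_cases hg : g ∈ Subgroup.center G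
  · exact (Subgroup.mem_center_iff.mp hg _).symm
  · obtain ⟨ρ, hρ, hs⟩ := exists_even_perm_hom h3 hg
    have hdec : ∀ σ : Equiv.Perm (Fin 3), Equiv.Perm.sign σ = 1 → σ ^ 3 = 1 := by decide
    have := hρ (show x ^ 3 ∈ ρ.ker by rw [MonoidHom.mem_ker, map_pow, hdec _ (hs x)])
    exact (Subgroup.mem_centralizer_singleton_iff.mp this).symm

theorem commutator_mem_center (h3 : ∀ g : G, g ∉ Subgroup.center G →
    (Subgroup.centralizer {g}).index = 3) (x y : G) :
    x * y * x⁻¹ * y⁻¹ ∈ Subgroup.center G := by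
  refine Subgroup.mem_center_iff.mpr fun g => ?_
  by_cases hg : g ∈ Subgroup.center G
  · exact (Subgroup.mem_center_iff.mp hg _).symm
  · obtain ⟨ρ, hρ, hs⟩ := exists_even_perm_hom h3 hg
    have hdec : ∀ σ τ : Equiv.Perm (Fin 3), Equiv.Perm.sign σ = 1 → Equiv.Perm.sign τ = 1 →
        σ * τ = τ * σ := by decide
    have := hρ (show x * y * x⁻¹ * y⁻¹ ∈ ρ.ker by
      rw [MonoidHom.mem_ker, map_mul, map_mul, map_mul, hdec _ _ (hs x) (hs y), map_inv, map_inv,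
        mul_inv_cancel_right, mul_inv_cancel])
    exact (Subgroup.mem_centralizer_singleton_iff.mp this).symm

end IndexThree

section CentralCubes

variable {G : Type*} [Group G] [Finite G]

omit [Finite G] in
theorem exists_commutator_hom (hcomm : ∀ x y : G, x * y * x⁻¹ * y⁻¹ ∈ Subgroup.center G)
    (hcube : ∀ x : G, x ^ 3 ∈ Subgroup.center G) (g : G) :
    ∃ f : G →* G, (∀ x, x * g = f x * g * x) ∧ (∀ x, f x ∈ Subgroup.center G) ∧
      (∀ x ∈ Subgroup.center G, f x = 1) ∧ ∀ x, f x ^ 3 = 1 := by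
  let f : G →* G := MonoidHom.mk' (fun x => x * g * x⁻¹ * g⁻¹) fun x y => by
    have h := Subgroup.mem_center_iff.mp (hcomm y g) x
    calc x * y * g * (x * y)⁻¹ * g⁻¹ = x * (y * g * y⁻¹ * g⁻¹) * (g * x⁻¹ * g⁻¹) := by group
      _ = (y * g * y⁻¹ * g⁻¹) * (x * g * x⁻¹ * g⁻¹) := by rw [h]; group
      _ = (x * g * x⁻¹ * g⁻¹) * (y * g * y⁻¹ * g⁻¹) :=
        (Subgroup.mem_center_iff.mp (hcomm y g) _).symm
  have hf1 : ∀ x ∈ Subgroup.center G, f x = 1 := fun x hx => by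
    change x * g * x⁻¹ * g⁻¹ = 1
    rw [← Subgroup.mem_center_iff.mp hx g]
    group
  refine ⟨f, fun x => ?_, fun x => hcomm x g, hf1, fun x => ?_⟩
  · change x * g = x * g * x⁻¹ * g⁻¹ * g * x
    group
  · rw [← map_pow, hf1 _ (hcube x)]

omit [Finite G] in
theorem zpow_eq_of_pow_three {u : G} (hu : u ^ 3 = 1) {a b : ℤ} (h : a ≡ b [ZMOD 3]) :
    u ^ a = u ^ b :=
  zpow_eq_zpow_iff_modEq.mpr
    (h.of_dvd (by exact_mod_cast orderOf_dvd_of_pow_eq_one hu))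

/-- If `f` is trivial on the centre and has image `⟨f y⟩` of order three, then some automorphism
multiplies `y` by a prescribed central element of exponent three. -/
theorem mul_mem_orbit_of_commutator_hom {f : G →* G} {y : G}
    (hf1 : ∀ x ∈ Subgroup.center G, f x = 1)
    (hy : f y ≠ 1) (hy3 : f y ^ 3 = 1) (hz : ∀ x, f x ∈ Subgroup.zpowers (f y)) {w : G}
    (hw : w ∈ Subgroup.center G) (hw3 : w ^ 3 = 1) : y * w ∈ MulAction.orbit (MulAut G) y := by
  obtain ⟨p, hp⟩ := exists_endomorphism_of_zpowers f hz (w := w)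
    (by rw [orderOf_eq_three hy hy3]; exact orderOf_dvd_of_pow_eq_one hw3)
  have hpc : ∀ x, p x ∈ Subgroup.center G := fun x => by
    obtain ⟨k, hk⟩ := hz x
    rw [hp x k hk.symm]
    exact zpow_mem hw k
  have hpy : p y = w := by simpa using hp y 1 (by simp)
  let φ : G →* G := MonoidHom.mk' (fun x => x * p x) fun x t => by
    rw [map_mul, mul_assoc, ← mul_assoc t, Subgroup.mem_center_iff.mp (hpc x) t]
    group
  have hφ : φ y = y * w := by
    change y * p y = y * w
    rw [hpy]
  rw [← hφ]
  refine mem_orbit_mulAut_of_injective φ (fun x (hx : x * p x = 1) => ?_) y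
  have h1 : x ∈ Subgroup.center G := by
    rw [mul_eq_one_iff_eq_inv.mp hx]
    exact inv_mem (hpc x)
  have h2 : p x = 1 := by simpa using hp x 0 (by simp [hf1 x h1])
  simpa [h2] using hx

/-- The commutators with a noncentral `g` form a cyclic group. -/
theorem commutator_hom_mem_zpowers (hG : maol G ≤ 3) {f : G →* G} {g y : G}
    (hfg : ∀ x, x * g = f x * g * x) (hy : f y ≠ 1) (hy3 : f y ^ 3 = 1) (x : G) :
    f x ∈ Subgroup.zpowers (f y) := by
  have hconj : ∀ x, f x * g ∈ MulAction.orbit (MulAut G) g := fun x => by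
    rw [← mul_inv_eq_iff_eq_mul.mpr (hfg x)]
    exact conj_mem_orbit_mulAut g x
  have o2 := hconj (y * y)
  rw [map_mul] at o2
  have hyy : f y * f y ≠ 1 := fun h => hy (by rwa [pow_succ, sq, h, one_mul] at hy3)
  rcases exists_eq_of_maol_le_three hG (MulAction.mem_orbit_self g) (hconj y) o2 (hconj x)
    with h | h | h | h | h | h
  · exact absurd (by simpa using h) hy
  · exact absurd (by simpa using h) hyy
  · have : f x = 1 := by simpa using h
    exact this ▸ one_mem _
  · exact absurd (by simpa using h) hy
  · exact mul_right_cancel h ▸ Subgroup.mem_zpowers _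
  · exact mul_right_cancel h ▸ mul_mem (Subgroup.mem_zpowers _) (Subgroup.mem_zpowers _)

theorem eq_pow_of_mul_mem_orbit (hG : maol G ≤ 3) {f : G →* G} {y : G}
    (hfc : ∀ x, f x ∈ Subgroup.center G) (hf1 : ∀ x ∈ Subgroup.center G, f x = 1)
    (hy : f y ≠ 1) (hy3 : f y ^ 3 = 1) (hz : ∀ x, f x ∈ Subgroup.zpowers (f y)) {w : G}
    (hw : y * w ∈ MulAction.orbit (MulAut G) y) : w = 1 ∨ w = f y ∨ w = f y ^ 2 := by
  have hyy : f y ^ 2 ≠ 1 := fun h => hy (by rwa [pow_succ, h, one_mul] at hy3)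
  rcases exists_eq_of_maol_le_three hG (MulAction.mem_orbit_self y)
      (mul_mem_orbit_of_commutator_hom hf1 hy hy3 hz (hfc y) hy3)
      (mul_mem_orbit_of_commutator_hom hf1 hy hy3 hz (pow_mem (hfc y) 2)
        (by rw [← pow_mul, mul_comm, pow_mul, hy3, one_pow])) hw
    with h | h | h | h | h | h
  · exact absurd (by simpa using h) hy
  · exact absurd (by simpa using h) hyy
  · exact Or.inl (by simpa using h)
  · have h1 := mul_left_cancel h
    rw [sq] at h1
    exact absurd (by simpa using h1) hy
  · exact Or.inr (Or.inl (mul_left_cancel h).symm)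
  · exact Or.inr (Or.inr (mul_left_cancel h).symm)

/-- A noncentral element, with commutator map `f`, has nontrivial cube. -/
theorem pow_three_ne_one_of_commutator_hom (hG : maol G ≤ 3) {f : G →* G} {g y : G}
    (hfg : ∀ x, x * g = f x * g * x) (hfc : ∀ x, f x ∈ Subgroup.center G)
    (hf1 : ∀ x ∈ Subgroup.center G, f x = 1) (hy : f y ≠ 1) (hy3 : f y ^ 3 = 1) :
    g ^ 3 ≠ 1 := fun hg3 => by
  have hz := commutator_hom_mem_zpowers hG hfg hy hy3
  have hw := fun w => eq_pow_of_mul_mem_orbit hG hfc hf1 hy hy3 hz (w := w)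
  have hcent := hfc y
  have hfgy : f y * g ∉ Subgroup.center G := fun h => hy <| by
    have h1 := (Subgroup.mul_mem_cancel_left _ hcent).mp h
    have h2 := hfg y
    rw [Subgroup.mem_center_iff.mp h1 y, mul_assoc] at h2
    simpa using h2
  obtain ⟨z, hzy⟩ : ∃ z, f y = z := ⟨_, rfl⟩
  rw [hzy] at hz hw hcent hfgy hy hy3
  choose e he using hz
  have he' : ∀ x, f x = z ^ e x := fun x => (he x).symm
  have hord := orderOf_eq_three hy hy3
  have hmod : ∀ {a b : ℤ}, z ^ a = z ^ b → a ≡ b [ZMOD 3] := fun h => by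
    have := zpow_eq_zpow_iff_modEq.mp h
    rwa [hord] at this
  have hzc : ∀ (k : ℤ) (x : G), x * z ^ k = z ^ k * x := fun k x =>
    Subgroup.mem_center_iff.mp (zpow_mem hcent k) x
  have hgt : ∀ (a : ℤ) (t : G), g ^ a * t = z ^ (-(e t * a)) * t * g ^ a := fun a t => by
    have h1 : SemiconjBy t g (z ^ e t * g) := by
      rw [← he']
      exact hfg t
    have h2 := (h1.zpow_right a).eq
    rw [(Commute.mul_zpow (show Commute (z ^ e t) g from (hzc _ g).symm) a), ← zpow_mul] at h2
    rw [mul_assoc, h2]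
    group
  let φ : G →* G := MonoidHom.mk' (fun x => x * g ^ e x * z ^ (e x * e x)) fun x t => by
    have h1 : e (x * t) ≡ e x + e t [ZMOD 3] := hmod (by
      rw [zpow_add, ← he', ← he', ← he', map_mul])
    have h2 : e (x * t) * e (x * t) ≡
        e x * e x + -(e t * e x) + e t * e t [ZMOD 3] := by
      refine (h1.mul h1).trans (Int.modEq_iff_dvd.mpr ⟨-(e x * e t), by ring⟩)
    rw [zpow_eq_of_pow_three hg3 h1, zpow_eq_of_pow_three hy3 h2]
    rw [zpow_add, zpow_add, zpow_add]
    have hB := hzc (-(e t * e x))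
    have hA := hzc (e x * e x)
    have h3 := hgt (e x) t
    generalize z ^ (-(e t * e x)) = B at hB h3 ⊢
    generalize z ^ (e x * e x) = A at hA ⊢
    generalize z ^ (e t * e t) = D
    generalize g ^ e x = p at h3 ⊢
    generalize g ^ e t = q
    calc x * t * (p * q) * (A * B * D) = x * (t * p) * (q * (A * B)) * D := by group
      _ = x * (t * p * B) * (A * q) * D := by
          rw [hB A, ← mul_assoc q, hB q, mul_assoc B, hA q]
          group
      _ = x * (B * t * p) * (A * q) * D := by rw [hB]; group
      _ = x * p * (t * A) * q * D := by rw [← h3]; group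
      _ = x * p * A * (t * q * D) := by rw [hA]; group
  have hφ : φ y = y * (z * g) := by
    have h1 : e y ≡ 1 [ZMOD 3] := hmod (by rw [← he', hzy, zpow_one])
    change y * g ^ e y * z ^ (e y * e y) = _
    rw [zpow_eq_of_pow_three hg3 h1, zpow_eq_of_pow_three hy3 (h1.mul h1), mul_assoc, hzc]
    simp
  have horb := mem_orbit_mulAut_of_injective φ
      (fun x (hx : x * g ^ e x * z ^ (e x * e x) = 1) => by
    have h1 : f g = 1 := by simpa [mul_assoc] using (hfg g).symm
    have h2 : z ^ e x = 1 := by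
      have := congrArg f hx
      rwa [map_mul, map_mul, map_zpow, map_zpow, h1, hf1 z hcent, map_one, one_zpow, one_zpow,
        mul_one, mul_one, he'] at this
    have h3 : e x ≡ 0 [ZMOD 3] := hmod (by rw [h2, zpow_zero])
    rwa [zpow_eq_of_pow_three hg3 h3, zpow_eq_of_pow_three hy3 (h3.mul h3), mul_zero, zpow_zero,
      zpow_zero, mul_one, mul_one] at hx) y
  rw [hφ] at horb
  refine hfgy ?_
  rcases hw (z * g) horb with h | h | h <;> rw [h]
  · exact one_mem _
  · exact hcent
  · exact pow_mem hcent 2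

omit [Finite G] in
theorem mul_pow_three_of_commutators_central
    (hcomm : ∀ x y : G, x * y * x⁻¹ * y⁻¹ ∈ Subgroup.center G)
    (hcube : ∀ x : G, x ^ 3 ∈ Subgroup.center G) (a b : G) : (a * b) ^ 3 = a ^ 3 * b ^ 3 := by
  obtain ⟨f, hf, hfc, -, hf3⟩ := exists_commutator_hom hcomm hcube a
  have h3 := hf3 b
  have hb := hf b
  have hc := Subgroup.mem_center_iff.mp (hfc b)
  generalize f b = c at *
  calc (a * b) ^ 3 = a * (b * a) * (b * a) * b := by rw [pow_succ, sq]; group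
    _ = a * c * a * b * (c * a) * (b * b) := by rw [hb]; group
    _ = a * c * a * (b * a) * c * (b * b) := by rw [← hc a]; group
    _ = a * c * a * (c * a) * b * c * (b * b) := by rw [hb]; group
    _ = a * c * (a * a) * c * (b * c) * (b * b) := by rw [← hc a]; group
    _ = a * c * (a * a * (c * c)) * b ^ 3 := by rw [hc b, pow_succ, sq b]; group
    _ = a * (c * c ^ 2) * (a * a) * b ^ 3 := by
        rw [← mul_assoc (a * a), hc (a * a), mul_assoc c, hc (a * a), sq]; group
    _ = a ^ 3 * b ^ 3 := by rw [← pow_succ', h3, mul_one, pow_succ' a, sq]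

open scoped IsMulCommutative in
theorem commute_of_commutators_cubes_central (hG : maol G ≤ 3)
    (hcomm : ∀ x y : G, x * y * x⁻¹ * y⁻¹ ∈ Subgroup.center G)
    (hcube : ∀ x : G, x ^ 3 ∈ Subgroup.center G) (a b : G) : a * b = b * a := by
  by_contra hab
  have key : ∀ h k : G, k * h ≠ h * k →
      ¬ ∃ d : Subgroup.center G, d ^ 3 = ⟨h ^ 3, hcube h⟩ := by
    rintro h k hk ⟨⟨d, hd⟩, hd3⟩
    have hd3' : d ^ 3 = h ^ 3 := by simpa using congrArg Subtype.val hd3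
    have hdi := Subgroup.mem_center_iff.mp (inv_mem hd)
    obtain ⟨f, hf, hfc, hf1, hf3⟩ := exists_commutator_hom hcomm hcube (h * d⁻¹)
    refine pow_three_ne_one_of_commutator_hom hG hf hfc hf1 (y := k) (fun h1 => hk ?_) (hf3 k) ?_
    · have h2 := hf k
      rw [h1, one_mul, mul_assoc h, ← hdi k, ← mul_assoc, ← mul_assoc] at h2
      exact mul_right_cancel h2
    · rw [mul_pow_three_of_commutators_central hcomm hcube, inv_pow, hd3', mul_inv_cancel]
  obtain ⟨f, hf, hfc, hf1, hf3⟩ := exists_commutator_hom hcomm hcube a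
  have hfb : f b ≠ 1 := fun h => hab (by simpa [h] using (hf b).symm)
  have hz := commutator_hom_mem_zpowers hG hf hfb (hf3 b)
  have huniq := fun w (hw : w ∈ Subgroup.center G) (hw3 : w ^ 3 = 1) =>
    eq_pow_of_mul_mem_orbit hG hfc hf1 hfb (hf3 b) hz
      (mul_mem_orbit_of_commutator_hom hf1 hfb (hf3 b) hz hw hw3)
  rcases exists_cube_of_unique_roots (Z := Subgroup.center G) (z := ⟨f b, hfc b⟩)
    (fun h => hfb (congrArg Subtype.val h)) (Subtype.ext (hf3 b))
    (fun c hc => (huniq c c.2 (congrArg Subtype.val hc)).imp Subtype.ext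
      (Or.imp Subtype.ext Subtype.ext))
    ⟨a ^ 3, hcube a⟩ ⟨b ^ 3, hcube b⟩ with h | h | ⟨d, h⟩ | ⟨d, h⟩
  · exact key a b (Ne.symm hab) h
  · exact key b a hab h
  · refine key (a * b) a (fun h' => hab ?_) ⟨d, h.trans (Subtype.ext ?_)⟩
    · exact mul_left_cancel (a := a) (by simpa [mul_assoc] using h')
    · exact (mul_pow_three_of_commutators_central hcomm hcube a b).symm
  · refine key (a * b ^ 2) b (fun h' => hab ?_) ⟨d, h.trans (Subtype.ext ?_)⟩
    · refine mul_right_cancel (b := b ^ 2) ?_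
      rw [mul_assoc b, h', mul_assoc, mul_assoc, ← pow_succ, ← pow_succ']
    · refine ((mul_pow_three_of_commutators_central hcomm hcube a (b ^ 2)).trans ?_).symm
      rw [← pow_mul, mul_comm 2, pow_mul]
      rfl

end CentralCubes

theorem stmt_0 (G : Type*) [Group G] [Finite G] :
    maol G ≤ 3 ↔
      ((∃ m ∈ ({1, 2, 3, 4, 6} : Set ℕ), Nonempty (G ≃* Multiplicative (ZMod m))) ∨
        Nonempty (G ≃* Multiplicative (ZMod 2 × ZMod 2)) ∨
        Nonempty (G ≃* Equiv.Perm (Fin 3))) := by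
  constructor
  · intro hG
    by_cases hab : ∀ a b : G, a * b = b * a
    · let _ : CommGroup G := { ‹Group G› with mul_comm := hab }
      exact (mulEquiv_of_maol_le_three_of_comm hG).imp_right Or.inl
    · by_cases hidx : ∃ g : G, (Subgroup.centralizer {g}).index = 2
      · obtain ⟨g, hg⟩ := hidx
        exact Or.inr (Or.inr (mulEquiv_perm_three_of_index_two hG hg))
      · have h3 : ∀ g : G, g ∉ Subgroup.center G → (Subgroup.centralizer {g}).index = 3 := by
          intro g hg
          have h0 : (Subgroup.centralizer {g}).index ≠ 0 := Subgroup.index_ne_zero_of_finite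
          have h1 : (Subgroup.centralizer {g}).index ≠ 1 := fun h => hg <| by
            refine Subgroup.mem_center_iff.mpr fun x => ?_
            rw [← Subgroup.mem_centralizer_singleton_iff, Subgroup.index_eq_one.mp h]
            exact Subgroup.mem_top x
          have h2 : (Subgroup.centralizer {g}).index ≠ 2 := fun h => hidx ⟨g, h⟩
          have h4 := index_centralizer_le_three hG g
          omega
        exact absurd (commute_of_commutators_cubes_central hG (commutator_mem_center h3)
          (pow_three_mem_center h3)) hab
  · rintro (⟨m, hm, ⟨e⟩⟩ | ⟨⟨e⟩⟩ | ⟨⟨e⟩⟩)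
    · exact maol_le_three_of_mulEquiv_zmod hm e
    · exact maol_le_three_of_mulEquiv_klein e
    · exact maol_le_three_of_mulEquiv_perm e
end

section
/- For every natural number N there exists a finite 2-group G (a finite group whose order is a power of 2) with |G| > N and maol(G) = 8. In particular, there are infinitely many finite 2-groups G with maol(G) = 8. -/
/-- The central extension of `V` by `W` whose cocycle is the bilinear map `B`. -/
@[ext]
structure CentralExt {V W : Type} [AddCommGroup V] [AddCommGroup W] [Module (ZMod 2) V]
    [Module (ZMod 2) W] (B : V →ₗ[ZMod 2] V →ₗ[ZMod 2] W) where
  /-- The image in the quotient `V`. -/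
  fst : V
  /-- The coordinate along the central subgroup `W`. -/
  snd : W

namespace CentralExt

variable {V W : Type} [AddCommGroup V] [AddCommGroup W] [Module (ZMod 2) V] [Module (ZMod 2) W]
  {B : V →ₗ[ZMod 2] V →ₗ[ZMod 2] W}

instance : Mul (CentralExt B) := ⟨fun g h => ⟨g.fst + h.fst, g.snd + h.snd + B g.fst h.fst⟩⟩

instance : One (CentralExt B) := ⟨⟨0, 0⟩⟩

instance : Inv (CentralExt B) := ⟨fun g => ⟨-g.fst, -g.snd + B g.fst g.fst⟩⟩

@[simp] theorem mul_fst (g h : CentralExt B) : (g * h).fst = g.fst + h.fst := rfl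

@[simp] theorem mul_snd (g h : CentralExt B) :
    (g * h).snd = g.snd + h.snd + B g.fst h.fst := rfl

@[simp] theorem one_fst : (1 : CentralExt B).fst = 0 := rfl

@[simp] theorem one_snd : (1 : CentralExt B).snd = 0 := rfl

@[simp] theorem inv_fst (g : CentralExt B) : (g⁻¹).fst = -g.fst := rfl

@[simp] theorem inv_snd (g : CentralExt B) : (g⁻¹).snd = -g.snd + B g.fst g.fst := rfl

instance : Group (CentralExt B) :=
  Group.ofLeftAxioms
    (fun a b c => by ext <;> simp <;> abel)
    (fun a => by ext <;> simp)
    (fun a => by ext <;> simp)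

/-- The underlying set of a central extension is the product. -/
def equivProd (B : V →ₗ[ZMod 2] V →ₗ[ZMod 2] W) : CentralExt B ≃ V × W where
  toFun g := (g.fst, g.snd)
  invFun p := ⟨p.1, p.2⟩
  left_inv _ := rfl
  right_inv _ := rfl

instance [Finite V] [Finite W] : Finite (CentralExt B) := Finite.of_equiv _ (equivProd B).symm

theorem isPGroup : IsPGroup 2 (CentralExt B) := by
  intro g
  refine ⟨2, ?_⟩
  rw [show 2 ^ 2 = 2 + 2 from rfl, pow_add, pow_two]
  ext <;> simp [ZModModule.add_self]

/-- The automorphism shifting the central coordinate by a linear map. -/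
def shift (B : V →ₗ[ZMod 2] V →ₗ[ZMod 2] W) (l : V →ₗ[ZMod 2] W) : MulAut (CentralExt B) where
  toFun g := ⟨g.fst, g.snd + l g.fst⟩
  invFun g := ⟨g.fst, g.snd - l g.fst⟩
  left_inv g := by ext <;> simp
  right_inv g := by ext <;> simp
  map_mul' g h := by ext <;> simp; abel

theorem mul_comm_of_fst_eq_zero {g : CentralExt B} (hg : g.fst = 0) (h : CentralExt B) :
    g * h = h * g := by
  ext <;> simp [hg, add_comm]

theorem fst_map_eq_zero (hB : ∀ v, (∀ x, B v x = B x v) → v = 0) (φ : MulAut (CentralExt B))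
    {g : CentralExt B} (hg : g.fst = 0) : (φ g).fst = 0 := by
  refine hB _ fun x => ?_
  have h := congrArg φ (mul_comm_of_fst_eq_zero hg (φ.symm ⟨x, 0⟩))
  rw [map_mul, map_mul, MulEquiv.apply_symm_apply] at h
  simpa using congrArg CentralExt.snd h

theorem fst_map_mk (hB : ∀ v, (∀ x, B v x = B x v) → v = 0) (φ : MulAut (CentralExt B))
    (v : V) (w : W) : (φ ⟨v, w⟩).fst = (φ ⟨v, 0⟩).fst := by
  have h : (⟨v, w⟩ : CentralExt B) = ⟨v, 0⟩ * ⟨0, w⟩ := by ext <;> simp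
  rw [h, map_mul, mul_fst, fst_map_eq_zero hB φ (g := ⟨0, w⟩) rfl, add_zero]

/-- The linear map induced by an automorphism on the quotient by the centre. -/
noncomputable def quotMap (hB : ∀ v, (∀ x, B v x = B x v) → v = 0) (φ : MulAut (CentralExt B)) :
    V →ₗ[ZMod 2] V :=
  AddMonoidHom.toZModLinearMap 2 <| AddMonoidHom.mk' (fun v => (φ ⟨v, 0⟩).fst) fun v x => by
    have h : (⟨v, 0⟩ * ⟨x, 0⟩ : CentralExt B) = ⟨v + x, B v x⟩ := by ext <;> simp
    rw [← fst_map_mk hB φ (v + x) (B v x), ← h, map_mul, mul_fst]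

theorem quotMap_apply (hB : ∀ v, (∀ x, B v x = B x v) → v = 0) (φ : MulAut (CentralExt B))
    (v : V) : quotMap hB φ v = (φ ⟨v, 0⟩).fst := rfl

/-- The linear map induced by an automorphism on the centre. -/
noncomputable def centerMap (hB : ∀ v, (∀ x, B v x = B x v) → v = 0)
    (φ : MulAut (CentralExt B)) : W →ₗ[ZMod 2] W :=
  AddMonoidHom.toZModLinearMap 2 <| AddMonoidHom.mk' (fun w => (φ ⟨0, w⟩).snd) fun v x => by
    have h : (⟨0, v⟩ * ⟨0, x⟩ : CentralExt B) = ⟨0, v + x⟩ := by ext <;> simp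
    rw [← h, map_mul, mul_snd, fst_map_eq_zero hB φ rfl]
    simp

theorem map_zero_mk (hB : ∀ v, (∀ x, B v x = B x v) → v = 0) (φ : MulAut (CentralExt B))
    (w : W) : φ ⟨0, w⟩ = ⟨0, centerMap hB φ w⟩ := by
  ext
  · exact fst_map_eq_zero hB φ rfl
  · rfl

theorem quotMap_surjective (hB : ∀ v, (∀ x, B v x = B x v) → v = 0)
    (φ : MulAut (CentralExt B)) : Function.Surjective (quotMap hB φ) := by
  intro v
  obtain ⟨⟨x, w⟩, h⟩ := φ.surjective ⟨v, 0⟩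
  exact ⟨x, by rw [quotMap_apply, ← fst_map_mk hB φ x w, h]⟩

theorem quotMap_injective (hB : ∀ v, (∀ x, B v x = B x v) → v = 0)
    (φ : MulAut (CentralExt B)) : Function.Injective (quotMap hB φ) := by
  rw [injective_iff_map_eq_zero]
  intro v hv
  have h := fst_map_eq_zero hB φ.symm (g := φ ⟨v, 0⟩) hv
  rwa [MulEquiv.symm_apply_apply] at h

theorem centerMap_injective (hB : ∀ v, (∀ x, B v x = B x v) → v = 0)
    (φ : MulAut (CentralExt B)) : Function.Injective (centerMap hB φ) := by
  intro w w' h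
  have h' : φ ⟨0, w⟩ = φ ⟨0, w'⟩ := by rw [map_zero_mk hB, map_zero_mk hB, h]
  exact congrArg CentralExt.snd (φ.injective h')

theorem centerMap_commutator (hB : ∀ v, (∀ x, B v x = B x v) → v = 0)
    (φ : MulAut (CentralExt B)) (v x : V) :
    centerMap hB φ (B v x - B x v) =
      B (quotMap hB φ v) (quotMap hB φ x) - B (quotMap hB φ x) (quotMap hB φ v) := by
  have h : (⟨v, 0⟩ * ⟨x, 0⟩ : CentralExt B) = (⟨x, 0⟩ * ⟨v, 0⟩) * ⟨0, B v x - B x v⟩ := by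
    ext <;> simp [add_comm]
  have h' := congrArg CentralExt.snd (congrArg φ h)
  simp only [map_mul, mul_snd, map_zero_mk hB, mul_fst, map_zero, add_zero] at h'
  simp only [quotMap_apply]
  rw [eq_sub_iff_add_eq, ← add_right_inj ((φ ⟨v, 0⟩).snd + (φ ⟨x, 0⟩).snd), h']
  abel

theorem centerMap_square (hB : ∀ v, (∀ x, B v x = B x v) → v = 0)
    (φ : MulAut (CentralExt B)) (v : V) :
    centerMap hB φ (B v v) = B (quotMap hB φ v) (quotMap hB φ v) := by
  have h : (⟨v, 0⟩ * ⟨v, 0⟩ : CentralExt B) = ⟨0, B v v⟩ := by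
    ext <;> simp [ZModModule.add_self]
  have h' := congrArg CentralExt.snd (congrArg φ h)
  simp only [map_mul, mul_snd, map_zero_mk hB, ZModModule.add_self, zero_add] at h'
  exact h'.symm

/-- If every automorphism acts trivially on the quotient `V`, then the largest automorphism orbits
are the cosets of `W`. -/
theorem maol_eq [Finite V] [Finite W] (hB : ∀ v, (∀ x, B v x = B x v) → v = 0)
    (hid : ∀ φ : MulAut (CentralExt B), quotMap hB φ = LinearMap.id)
    (v : V) (hv : ∀ w : W, ∃ l : V →ₗ[ZMod 2] W, l v = w) :
    maol (CentralExt B) = Nat.card W := by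
  apply le_antisymm
  · refine ciSup_le fun g => ?_
    refine Nat.card_le_card_of_injective (fun x => x.1.snd) ?_
    have key : ∀ x ∈ MulAction.orbit (MulAut (CentralExt B)) g, x.fst = g.fst := by
      rintro _ ⟨φ, rfl⟩
      change (φ ⟨g.fst, g.snd⟩).fst = g.fst
      rw [fst_map_mk hB, ← quotMap_apply hB, hid, LinearMap.id_apply]
    rintro ⟨x, hx⟩ ⟨y, hy⟩ h
    exact Subtype.ext (CentralExt.ext ((key x hx).trans (key y hy).symm) h)
  · have hbdd : BddAbove (Set.range fun g : CentralExt B =>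
        Nat.card (MulAction.orbit (MulAut (CentralExt B)) g)) := (Set.finite_range _).bddAbove
    refine le_trans ?_ (le_ciSup hbdd ⟨v, 0⟩)
    refine Nat.card_le_card_of_injective (fun w => ⟨⟨v, w⟩, ?_⟩) ?_
    · obtain ⟨l, rfl⟩ := hv w
      exact ⟨shift B l, CentralExt.ext rfl (zero_add _)⟩
    · intro w w' h
      exact congrArg CentralExt.snd (congrArg Subtype.val h)

end CentralExt

namespace RigidForm

/-- The domain of the rigid quadratic map. -/
abbrev Dom (n : ℕ) : Type := (Fin (n + 3) → ZMod 2) × (Fin (n + 2) → ZMod 2)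

/-- The codomain of the rigid quadratic map. -/
abbrev Cod : Type := ZMod 2 × ZMod 2 × ZMod 2

/-- A bilinear map whose associated quadratic map has no nontrivial symmetry. -/
def form (n : ℕ) : Dom n →ₗ[ZMod 2] Dom n →ₗ[ZMod 2] Cod :=
  LinearMap.mk₂ (ZMod 2)
    (fun v x => (∑ i, v.2 i * x.1 i.castSucc + v.1 1 * x.1 1, ∑ i, v.2 i * x.1 i.succ,
      (v.1 0 + v.1 1) * (x.1 0 + x.1 1)))
    (fun v v' x => by ext <;> simp [add_mul, Finset.sum_add_distrib] <;> ring)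
    (fun c v x => by ext <;> simp [Finset.mul_sum, mul_assoc, mul_add, add_mul])
    (fun v x x' => by ext <;> simp [mul_add, Finset.sum_add_distrib] <;> ring)
    (fun c v x => by ext <;> simp [Finset.mul_sum, mul_add, add_mul, mul_left_comm])

/-- The alternating map associated with `form`. -/
def comm {n : ℕ} (v x : Dom n) : Cod := form n v x - form n x v

variable {n : ℕ}

theorem form_apply (v x : Dom n) : form n v x =
    (∑ i, v.2 i * x.1 i.castSucc + v.1 1 * x.1 1, ∑ i, v.2 i * x.1 i.succ,
      (v.1 0 + v.1 1) * (x.1 0 + x.1 1)) := rfl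

theorem comm_apply (v x : Dom n) : comm v x =
    (∑ i, v.2 i * x.1 i.castSucc - ∑ i, x.2 i * v.1 i.castSucc,
      ∑ i, v.2 i * x.1 i.succ - ∑ i, x.2 i * v.1 i.succ, 0) := by
  simp only [comm, form_apply, Prod.mk_sub_mk]
  ext <;> simp <;> ring

/-- The standard basis vectors of the first factor. -/
def dvec (j : Fin (n + 3)) : Dom n := (Pi.single j 1, 0)

/-- The standard basis vectors of the second factor. -/
def cvec (i : Fin (n + 2)) : Dom n := (0, Pi.single i 1)

theorem comm_cvec (v : Dom n) (i : Fin (n + 2)) :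
    comm v (cvec i) = (-v.1 i.castSucc, -v.1 i.succ, 0) := by
  simp [comm_apply, cvec, Pi.single_apply]

theorem comm_dvec (v : Dom n) (j : Fin (n + 3)) :
    comm v (dvec j) =
      (∑ i, v.2 i * if i.castSucc = j then 1 else 0, ∑ i, v.2 i * if i.succ = j then 1 else 0,
        0) := by
  simp [comm_apply, dvec, Pi.single_apply]

theorem comm_dvec_castSucc (v : Dom n) (i : Fin (n + 2)) :
    (comm v (dvec i.castSucc)).1 = v.2 i := by
  simp [comm_dvec]

theorem comm_dvec_succ (v : Dom n) (i : Fin (n + 2)) :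
    (comm v (dvec i.succ)).2.1 = v.2 i := by
  simp [comm_dvec]

theorem eq_zero_or_one (a : ZMod 2) : a = 0 ∨ a = 1 := by
  revert a; decide

theorem comm_nondegenerate (v : Dom n) (h : ∀ x, form n v x = form n x v) : v = 0 := by
  have h' : ∀ x, comm v x = 0 := fun x => sub_eq_zero.2 (h x)
  ext j
  · refine Fin.cases ?_ (fun i => ?_) j
    · simpa [comm_cvec] using congrArg Prod.fst (h' (cvec 0))
    · simpa [comm_cvec] using congrArg (fun w => w.2.1) (h' (cvec i))
  · simpa [comm_dvec_castSucc] using congrArg Prod.fst (h' (dvec j.castSucc))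

theorem eq_dvec_zero {v : Dom n} (hv : v ≠ 0) (h : ∀ x, (comm v x).2.1 = 0) : v = dvec 0 := by
  have hc : v.2 = 0 := by
    ext i
    simpa [comm_dvec_succ] using h (dvec i.succ)
  have hd : ∀ i : Fin (n + 2), v.1 i.succ = 0 := fun i => by simpa [comm_cvec] using h (cvec i)
  rcases eq_zero_or_one (v.1 0) with h0 | h0
  · refine absurd (Prod.ext (funext fun j => ?_) hc) hv
    exact Fin.cases h0 hd j
  · refine Prod.ext (funext fun j => ?_) hc
    refine Fin.cases ?_ (fun i => ?_) j
    · simpa [dvec] using h0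
    · simpa [dvec] using hd i

theorem eq_dvec_last {v : Dom n} (hv : v ≠ 0) (h : ∀ x, (comm v x).1 = 0) :
    v = dvec (Fin.last _) := by
  have hc : v.2 = 0 := by
    ext i
    simpa [comm_dvec_castSucc] using h (dvec i.castSucc)
  have hd : ∀ i : Fin (n + 2), v.1 i.castSucc = 0 := fun i => by
    simpa [comm_cvec] using h (cvec i)
  rcases eq_zero_or_one (v.1 (Fin.last _)) with h0 | h0
  · refine absurd (Prod.ext (funext fun j => ?_) hc) hv
    exact Fin.lastCases h0 hd j
  · refine Prod.ext (funext fun j => ?_) hc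
    refine Fin.lastCases ?_ (fun i => ?_) j
    · simpa [dvec] using h0
    · simpa [dvec, (Fin.castSucc_lt_last i).ne] using hd i

theorem eq_const_one {v : Dom n} (hv : v ≠ 0) (h : ∀ x, (comm v x).1 = (comm v x).2.1) :
    v = (fun _ => 1, 0) := by
  have hc : v.2 = 0 := by
    ext i
    induction i using Fin.induction with
    | zero =>
      have := h (dvec 0)
      rw [show (0 : Fin (n + 3)) = Fin.castSucc 0 from rfl, comm_dvec_castSucc] at this
      rw [this, comm_dvec]
      simp [Fin.succ_ne_zero]
    | succ i ih =>
      have := h (dvec i.succ.castSucc)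
      rw [comm_dvec_castSucc, ← Fin.succ_castSucc, comm_dvec_succ, ih] at this
      exact this
  have hd : ∀ i : Fin (n + 2), v.1 i.castSucc = v.1 i.succ := fun i => by
    simpa [comm_cvec] using h (cvec i)
  have hd' : ∀ j, v.1 j = v.1 0 := fun j => by
    induction j using Fin.induction with
    | zero => rfl
    | succ i ih => rw [← hd, ih]
  rcases eq_zero_or_one (v.1 0) with h0 | h0
  · exact absurd (Prod.ext (funext fun j => (hd' j).trans h0) hc) hv
  · exact Prod.ext (funext fun j => (hd' j).trans h0) hc

/-- The vectors whose commutators with all others lie in a line. -/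
theorem comm_line {v : Dom n} (hv : v ≠ 0) {w : Cod} (hw : w ≠ 0) (hw' : w.2.2 = 0)
    (h : ∀ x, comm v x = 0 ∨ comm v x = w) :
    (v = dvec 0 ∧ w = (1, 0, 0)) ∨ (v = dvec (Fin.last _) ∧ w = (0, 1, 0)) ∨
      v = (fun _ => 1, 0) := by
  obtain ⟨a, b, c⟩ := w
  obtain rfl : c = 0 := hw'
  rcases eq_zero_or_one a with rfl | rfl <;> rcases eq_zero_or_one b with rfl | rfl
  · exact absurd rfl hw
  · exact Or.inr (Or.inl ⟨eq_dvec_last hv fun x => by rcases h x with h | h <;> simp [h], rfl⟩)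
  · exact Or.inl ⟨eq_dvec_zero hv fun x => by rcases h x with h | h <;> simp [h], rfl⟩
  · exact Or.inr (Or.inr (eq_const_one hv fun x => by rcases h x with h | h <;> simp [h]))

theorem dvec_ne_zero (j : Fin (n + 3)) : (dvec j : Dom n) ≠ 0 := fun h => by
  simpa [dvec] using congrFun (congrArg Prod.fst h) j

theorem comm_dvec_zero (x : Dom n) : comm (dvec 0) x = 0 ∨ comm (dvec 0) x = (1, 0, 0) := by
  have h : comm (dvec 0) x = (x.2 0, 0, 0) := by
    have h0 : ∀ i : Fin (n + 2), i.castSucc = 0 ↔ i = 0 := fun _ => Fin.castSucc_eq_zero_iff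
    simp [comm_apply, dvec, Pi.single_apply, h0, Fin.succ_ne_zero]
  rcases eq_zero_or_one (x.2 0) with h0 | h0 <;> simp [h, h0]

theorem comm_dvec_last (x : Dom n) :
    comm (dvec (Fin.last _)) x = 0 ∨ comm (dvec (Fin.last _)) x = (0, 1, 0) := by
  have h : comm (dvec (Fin.last _)) x = (0, x.2 (Fin.last _), 0) := by
    have h0 : ∀ i : Fin (n + 2), i.succ = Fin.last _ ↔ i = Fin.last _ := fun i => by
      simp [Fin.ext_iff]
    simp [comm_apply, dvec, Pi.single_apply, h0, (Fin.castSucc_lt_last _).ne]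
  rcases eq_zero_or_one (x.2 (Fin.last _)) with h0 | h0 <;> simp [h, h0]

theorem comm_snd_snd (v x : Dom n) : (comm v x).2.2 = 0 := by rw [comm_apply]

theorem form_self_snd_snd (v : Dom n) : (form n v v).2.2 = v.1 0 + v.1 1 := by
  rw [form_apply]
  have h : ∀ a : ZMod 2, a * a = a := by decide
  exact h _

theorem form_dvec_zero : form n (dvec 0) (dvec 0) = (0, 0, 1) := by
  simp [form_apply, dvec]

theorem last_ne_one : Fin.last (n + 2) ≠ 1 := by simp [Fin.ext_iff]

theorem last_ne_zero : Fin.last (n + 2) ≠ 0 := by simp [Fin.ext_iff]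

theorem form_dvec_last : form n (dvec (Fin.last _)) (dvec (Fin.last _)) = 0 := by
  simp [form_apply, dvec, last_ne_one.symm, last_ne_zero.symm]

theorem form_const_one :
    form n (fun _ => 1, 0) (fun _ => 1, 0) = (1, 0, 0) := by
  simp [form_apply, CharTwo.add_self_eq_zero]

theorem comm_cvec_dvec_zero : comm (n := n) (cvec 0) (dvec 0) = (1, 0, 0) := by
  have h0 : ∀ i : Fin (n + 2), i.castSucc = 0 ↔ i = 0 := fun _ => Fin.castSucc_eq_zero_iff
  simp [comm_dvec, cvec, h0, Fin.succ_ne_zero]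

theorem comm_cvec_dvec_last :
    comm (n := n) (cvec (Fin.last _)) (dvec (Fin.last _)) = (0, 1, 0) := by
  have h0 : ∀ i : Fin (n + 2), i.succ = Fin.last _ ↔ i = Fin.last _ := fun i => by
    simp [Fin.ext_iff]
  simp [comm_dvec, cvec, h0, (Fin.castSucc_lt_last _).ne]

theorem cod_decomp (w : Cod) :
    w = w.1 • (1, 0, 0) + w.2.1 • (0, 1, 0) + w.2.2 • (0, 0, 1) := by
  ext <;> simp

section Symmetry

variable {α : Dom n →ₗ[ZMod 2] Dom n} {β : Cod →ₗ[ZMod 2] Cod}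

theorem map_snd_snd (hβ : Function.Injective β)
    (hcomm : ∀ v x, β (comm v x) = comm (α v) (α x)) (w : Cod) : (β w).2.2 = w.2.2 := by
  have h1 : (β (1, 0, 0)).2.2 = 0 := by
    rw [← comm_cvec_dvec_zero (n := n), hcomm, comm_snd_snd]
  have h2 : (β (0, 1, 0)).2.2 = 0 := by
    rw [← comm_cvec_dvec_last (n := n), hcomm, comm_snd_snd]
  have key : ∀ w, (β w).2.2 = w.2.2 * (β (0, 0, 1)).2.2 := fun w => by
    conv_lhs => rw [cod_decomp w]
    simp only [map_add, map_smul, Prod.snd_add, Prod.smul_snd, h1, h2, smul_eq_mul,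
      mul_zero, zero_add]
  have h3 : (β (0, 0, 1)).2.2 = 1 := by
    obtain ⟨w, hw⟩ := Finite.injective_iff_surjective.1 hβ (0, 0, 1)
    have := key w
    rw [hw] at this
    rcases eq_zero_or_one (β (0, 0, 1)).2.2 with h | h
    · rw [h, mul_zero] at this
      exact absurd this one_ne_zero
    · exact h
  rw [key, h3, mul_one]

theorem fixed_ends (hα : Function.Injective α) (hα' : Function.Surjective α)
    (hβ : Function.Injective β) (hcomm : ∀ v x, β (comm v x) = comm (α v) (α x))
    (hq : ∀ v, β (form n v v) = form n (α v) (α v)) :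
    α (dvec 0) = dvec 0 ∧ α (dvec (Fin.last _)) = dvec (Fin.last _) ∧ β = LinearMap.id := by
  have hs := map_snd_snd hβ hcomm
  have hL : ∀ v, (α v).1 0 + (α v).1 1 = v.1 0 + v.1 1 := fun v => by
    rw [← form_self_snd_snd, ← hq, hs, form_self_snd_snd]
  have line : ∀ (v : Dom n) (w : Cod), v ≠ 0 → w ≠ 0 → w.2.2 = 0 →
      (∀ x, comm v x = 0 ∨ comm v x = w) →
      (α v = dvec 0 ∧ β w = (1, 0, 0)) ∨ (α v = dvec (Fin.last _) ∧ β w = (0, 1, 0)) ∨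
        α v = (fun _ => 1, 0) := by
    intro v w hv hw hw' h
    refine comm_line ((map_ne_zero_iff α hα).2 hv) ((map_ne_zero_iff β hβ).2 hw)
      ((hs w).trans hw') fun x => ?_
    obtain ⟨y, rfl⟩ := hα' x
    rw [← hcomm]
    rcases h y with h | h <;> simp [h]
  have h0 : α (dvec 0) = dvec 0 ∧ β (1, 0, 0) = (1, 0, 0) := by
    have hl := hL (dvec 0)
    rcases line _ _ (dvec_ne_zero 0) (by simp) rfl comm_dvec_zero with h | h | h
    · exact h
    · rw [h.1] at hl
      simp [dvec, last_ne_one.symm, last_ne_zero.symm] at hl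
    · rw [h] at hl
      simp [dvec, CharTwo.add_self_eq_zero] at hl
  have h1 : α (dvec (Fin.last _)) = dvec (Fin.last _) ∧ β (0, 1, 0) = (0, 1, 0) := by
    have hl := hL (dvec (Fin.last _))
    rcases line _ _ (dvec_ne_zero (Fin.last _)) (by simp) rfl comm_dvec_last with h | h | h
    · rw [h.1] at hl
      simp [dvec, last_ne_one.symm, last_ne_zero.symm] at hl
    · exact h
    · have := hq (dvec (Fin.last _))
      rw [h, form_dvec_last, form_const_one, map_zero] at this
      exact absurd (congrArg Prod.fst this) zero_ne_one
  have h2 : β (0, 0, 1) = (0, 0, 1) := by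
    rw [← form_dvec_zero (n := n), hq, h0.1]
  refine ⟨h0.1, h1.1, LinearMap.ext fun w => ?_⟩
  conv_lhs => rw [cod_decomp w]
  rw [map_add, map_add, map_smul, map_smul, map_smul, h0.2, h1.2, h2, ← cod_decomp]
  rfl

theorem comm_dvec_shift (i : Fin (n + 2)) (x : Dom n) :
    (comm (dvec i.succ) x).2.1 = (comm (dvec i.castSucc) x).1 := by
  simp [comm_apply, dvec, Pi.single_apply]

/-- A shift-invariant matrix agreeing with the identity in its first and last row. -/
theorem toeplitz_eq_single {A : Fin (n + 3) → Fin (n + 3) → ZMod 2}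
    (hA : ∀ k i : Fin (n + 2), A k.succ i.succ = A k.castSucc i.castSucc)
    (h0 : A 0 = Pi.single 0 1) (h1 : A (Fin.last _) = Pi.single (Fin.last _) 1) (k : Fin (n + 3)) :
    A k = Pi.single k 1 := by
  have low : ∀ (j : ℕ) (k i : Fin (n + 3)), (k : ℕ) + j = n + 2 → i < k → A k i = 0 := by
    intro j
    induction j with
    | zero =>
      intro k i hk hi
      obtain rfl : k = Fin.last _ := Fin.ext hk
      simp [h1, hi.ne]
    | succ j ih =>
      intro k i hk hi
      have hk' : (k : ℕ) < n + 2 := by omega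
      have hi' : (i : ℕ) < n + 2 := lt_trans hi hk'
      have := hA ⟨k, hk'⟩ ⟨i, hi'⟩
      rw [show A k i = A (Fin.castSucc ⟨k, hk'⟩) (Fin.castSucc ⟨i, hi'⟩) from rfl, ← this]
      refine ih _ _ ?_ (Fin.succ_lt_succ_iff.2 hi)
      simp only [Fin.val_succ]
      omega
  induction k using Fin.induction with
  | zero => exact h0
  | succ k ih =>
    ext i
    refine Fin.cases ?_ (fun i => ?_) i
    · rw [low (n + 2 - k.succ) k.succ 0 (by omega) (Fin.succ_pos k)]
      simp [(Fin.succ_ne_zero k).symm]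
    · rw [hA, ih]
      simp [Pi.single_apply]

theorem fixed_dvec (hα' : Function.Surjective α)
    (hcomm : ∀ v x, comm v x = comm (α v) (α x)) (h0 : α (dvec 0) = dvec 0)
    (h1 : α (dvec (Fin.last _)) = dvec (Fin.last _)) (k : Fin (n + 3)) : α (dvec k) = dvec k := by
  have hshift : ∀ (k : Fin (n + 2)) (x : Dom n),
      (comm (α (dvec k.succ)) x).2.1 = (comm (α (dvec k.castSucc)) x).1 := fun k x => by
    obtain ⟨y, rfl⟩ := hα' x
    rw [← hcomm, ← hcomm, comm_dvec_shift]
  have hc : ∀ k, (α (dvec k)).2 = 0 := fun k => by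
    induction k using Fin.induction with
    | zero => rw [h0]; rfl
    | succ k ih =>
      ext i
      rw [← comm_dvec_succ, hshift, comm_dvec, ih]
      simp
  refine Prod.ext ?_ (hc k)
  refine toeplitz_eq_single (A := fun k => (α (dvec k)).1) (fun k i => ?_) ?_ ?_ k
  · simpa [comm_cvec] using hshift k (cvec i)
  · simp only [h0]; rfl
  · simp only [h1]; rfl

/-- The vanishing argument for the Hankel matrix describing the images of the vectors `cvec i`. -/
theorem hankel_eq_zero {h : Fin (n + 2) → Fin (n + 3) → ZMod 2}
    (hsymm : ∀ i j, h i j.castSucc = h j i.castSucc) (hsymm' : ∀ i j, h i j.succ = h j i.succ)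
    (hfirst : ∀ i, h i 0 = h i 1) (hdiag : ∀ i, h i i.castSucc = h i 1)
    (hdiag' : ∀ i, h i i.succ = 0) : h = 0 := by
  have hank : ∀ i j : Fin (n + 1), h i.castSucc j.succ.succ = h i.succ j.succ.castSucc := by
    intro i j
    rw [hsymm', Fin.succ_castSucc, hsymm]
  have hzero : ∀ i, h i 0 = 0 := by
    intro i
    induction i using Fin.induction with
    | zero => rw [hfirst]; exact hdiag' 0
    | succ i ih =>
      rw [← ih, hfirst i.castSucc]
      have e := hsymm i.succ 0
      have e' := hsymm' i.castSucc 0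
      rw [show (1 : Fin (n + 3)) = Fin.succ 0 from rfl, e', Fin.succ_castSucc, ← e]
      rfl
  have hd : ∀ i, h i i.castSucc = 0 := fun i => by rw [hdiag, ← hfirst, hzero]
  have up : ∀ (k : ℕ) (i : Fin (n + 2)) (j : Fin (n + 3)), (i : ℕ) + k = j → h i j = 0 := by
    intro k
    induction k using Nat.strong_induction_on with
    | _ k ih =>
      intro i j hij
      match k, ih, hij with
      | 0, _, hij =>
        obtain rfl : j = i.castSucc := Fin.ext hij.symm
        exact hd i
      | 1, _, hij =>
        obtain rfl : j = i.succ := Fin.ext (by rw [← hij]; rfl)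
        exact hdiag' i
      | k + 2, ih, hij =>
        have hi : (i : ℕ) < n + 1 := by omega
        have hj : (j : ℕ) - 2 < n + 1 := by omega
        have hj' : j = Fin.succ (Fin.succ ⟨j - 2, hj⟩) := Fin.ext (by simp; omega)
        rw [show i = Fin.castSucc ⟨i, hi⟩ from rfl, hj', hank]
        refine ih k (by omega) _ _ ?_
        simp
        omega
  ext i j
  rcases le_or_gt (i : ℕ) j with hij | hij
  · exact up (j - i) i j (by omega)
  · have hj : (j : ℕ) < n + 2 := by omega
    rw [show j = Fin.castSucc ⟨j, hj⟩ from rfl, hsymm]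
    exact up (i - j) _ _ (by simp; omega)

theorem fixed_cvec (hcomm : ∀ v x, comm v x = comm (α v) (α x))
    (hq : ∀ v, form n v v = form n (α v) (α v)) (hd : ∀ k, α (dvec k) = dvec k)
    (i : Fin (n + 2)) : α (cvec i) = cvec i := by
  have hc : ∀ i, (α (cvec i)).2 = Pi.single i 1 := fun i => by
    ext j
    rw [← comm_dvec_castSucc, ← hd, ← hcomm, comm_dvec_castSucc]
    rfl
  have hform : ∀ i j, comm (α (cvec i)) (α (cvec j)) = 0 := fun i j => by
    rw [← hcomm, comm_cvec]
    simp [cvec]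
  have hsq : ∀ i, form n (α (cvec i)) (α (cvec i)) = 0 := fun i => by
    rw [← hq]
    simp [form_apply, cvec]
  have sq : ∀ a : ZMod 2, a * a = a := by decide
  refine Prod.ext ?_ (hc i)
  refine congrFun (hankel_eq_zero (h := fun i => (α (cvec i)).1) ?_ ?_ ?_ ?_ ?_) i
  · intro i j
    have := congrArg Prod.fst (hform i j)
    exact Eq.symm (by simpa [comm_apply, hc, Pi.single_apply, sub_eq_zero] using this)
  · intro i j
    have := congrArg (fun w => w.2.1) (hform i j)
    exact Eq.symm (by simpa [comm_apply, hc, Pi.single_apply, sub_eq_zero] using this)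
  · intro i
    have := congrArg (fun w => w.2.2) (hsq i)
    rw [form_self_snd_snd] at this
    exact CharTwo.add_eq_zero.1 this
  · intro i
    have := congrArg Prod.fst (hsq i)
    simp only [form_apply, hc, sq, Pi.single_apply, ite_mul, one_mul, zero_mul,
      Finset.sum_ite_eq', Finset.mem_univ, if_true] at this
    exact CharTwo.add_eq_zero.1 this
  · intro i
    have := congrArg (fun w => w.2.1) (hsq i)
    simpa [form_apply, hc, Pi.single_apply] using this

/-- The quadratic map attached to `form` has no nontrivial symmetries. -/
theorem rigid (hα : Function.Injective α) (hα' : Function.Surjective α)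
    (hβ : Function.Injective β) (hcomm : ∀ v x, β (comm v x) = comm (α v) (α x))
    (hq : ∀ v, β (form n v v) = form n (α v) (α v)) : α = LinearMap.id := by
  obtain ⟨h0, h1, rfl⟩ := fixed_ends hα hα' hβ hcomm hq
  have hd := fixed_dvec hα' hcomm h0 h1
  have hc := fixed_cvec hcomm hq hd
  refine LinearMap.prod_ext (LinearMap.pi_ext' fun k => LinearMap.ext_ring ?_)
    (LinearMap.pi_ext' fun i => LinearMap.ext_ring ?_)
  · exact hd k
  · exact hc i

end Symmetry

theorem maol_form (n : ℕ) : maol (CentralExt (form n)) = 8 := by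
  rw [CentralExt.maol_eq comm_nondegenerate (fun φ => ?_) (dvec 0) (fun w => ?_)]
  · simp [Nat.card_eq_fintype_card]
  · exact rigid (CentralExt.quotMap_injective _ φ) (CentralExt.quotMap_surjective _ φ)
      (CentralExt.centerMap_injective _ φ) (CentralExt.centerMap_commutator _ φ)
      (CentralExt.centerMap_square _ φ)
  · refine ⟨(LinearMap.toSpanSingleton (ZMod 2) Cod w).comp
      ((LinearMap.proj 0).comp (LinearMap.fst (ZMod 2) _ _)), ?_⟩
    simp [dvec]

theorem lt_card (n : ℕ) : n < Nat.card (CentralExt (form n)) := by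
  have h : n < 2 ^ n := Nat.lt_two_pow_self
  have hcard : Nat.card (CentralExt (form n)) = 2 ^ (n + 3) * 2 ^ (n + 2) * 8 := by
    rw [Nat.card_congr (CentralExt.equivProd _), Nat.card_prod, Nat.card_prod]
    simp [Nat.card_eq_fintype_card]
  rw [hcard, pow_add, pow_add]
  nlinarith

end RigidForm

theorem stmt_1 (N : ℕ) :
    ∃ (G : Type) (_ : Group G) (_ : Finite G),
      IsPGroup 2 G ∧ N < Nat.card G ∧ maol G = 8 := by
  exact ⟨CentralExt (RigidForm.form N), inferInstance, inferInstance, CentralExt.isPGroup,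
    RigidForm.lt_card N, RigidForm.maol_form N⟩
end

section
/- Every finite group G with maol(G) ≤ 23 is solvable. -/
theorem Subgroup.relIndex_ne_zero_of_finite {G : Type*} [Group G] [Finite G] (H K : Subgroup G) :
    H.relIndex K ≠ 0 :=
  Subgroup.index_ne_zero_of_finite

section SimpleGroup

open Subgroup

variable {S : Type*} [Group S] [IsSimpleGroup S]

theorem commute_of_center_ne_bot (h : center S ≠ ⊥) (a b : S) : a * b = b * a := by
  have ht := (Normal.eq_bot_or_eq_top (inferInstance : (center S).Normal)).resolve_left h
  exact (mem_center_iff.1 (ht ▸ mem_top a : a ∈ center S) b).symm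

theorem eq_one_of_centralizer_eq_top (hS : ¬ ∀ a b : S, a * b = b * a) {x : S}
    (hx : centralizer {x} = ⊤) : x = 1 := by
  by_contra h1
  refine hS (commute_of_center_ne_bot fun hb => h1 ?_)
  rw [centralizer_eq_top_iff_subset, Set.singleton_subset_iff] at hx
  rwa [SetLike.mem_coe, hb, mem_bot] at hx

variable [Finite S]

theorem not_isPGroup_of_noncomm (hS : ¬ ∀ a b : S, a * b = b * a) {p : ℕ} [Fact p.Prime] :
    ¬ IsPGroup p S := fun h => hS (commute_of_center_ne_bot h.bot_lt_center.ne')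

theorem two_mul_card_dvd_factorial_index (hS : ¬ ∀ a b : S, a * b = b * a) {H : Subgroup S}
    (hH : H ≠ ⊤) : 2 * Nat.card S ∣ H.index.factorial := by
  classical
  have : Fintype (S ⧸ H) := Fintype.ofFinite _
  have : Nontrivial (S ⧸ H) := by
    rw [← Finite.one_lt_card_iff_nontrivial]
    have h1 : H.index ≠ 1 := fun h => hH (index_eq_one.1 h)
    have h0 : H.index ≠ 0 := index_ne_zero_of_finite
    rw [index] at h0 h1
    omega
  have hinj : Function.Injective (MulAction.toPermHom S (S ⧸ H)) := by
    rw [← MonoidHom.ker_eq_bot_iff, ← normalCore_eq_ker]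
    refine (Normal.eq_bot_or_eq_top H.normalCore_normal).resolve_right fun h => hH ?_
    exact top_le_iff.1 (h ▸ normalCore_le H)
  have hle : (MulAction.toPermHom S (S ⧸ H)).range ≤ alternatingGroup (S ⧸ H) := by
    have hk : (Equiv.Perm.sign.comp (MulAction.toPermHom S (S ⧸ H))).ker = ⊤ := by
      refine (Normal.eq_bot_or_eq_top inferInstance).resolve_left fun h => hS fun a b => ?_
      apply (MonoidHom.ker_eq_bot_iff _).1 h
      simp only [map_mul, mul_comm]
    rintro _ ⟨g, rfl⟩
    rw [Equiv.Perm.mem_alternatingGroup]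
    have : g ∈ (Equiv.Perm.sign.comp (MulAction.toPermHom S (S ⧸ H))).ker := hk ▸ mem_top g
    simpa using this
  have h1 := card_dvd_of_le hle
  rw [Nat.card_congr (MonoidHom.ofInjective hinj).toEquiv.symm] at h1
  have h2 := Nat.mul_dvd_mul_left 2 h1
  rwa [two_mul_nat_card_alternatingGroup, Nat.card_perm, ← index] at h2

theorem not_normalizer_le_centralizer (hS : ¬ ∀ a b : S, a * b = b * a) {p : ℕ} [Fact p.Prime]
    (hp : p ∣ Nat.card S) (P : Sylow p S) :
    ¬ normalizer (P : Set S) ≤ centralizer (P : Set S) := by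
  intro h
  have hc := MonoidHom.ker_transferSylow_isComplement' P h
  rcases Normal.eq_bot_or_eq_top (inferInstance : (MonoidHom.transferSylow P h).ker.Normal) with h0 | h0
  · rw [h0, isComplement'_bot_left] at hc
    apply not_isPGroup_of_noncomm hS (p := p)
    have := P.2
    rw [hc] at this
    exact this.of_equiv topEquiv
  · rw [h0, isComplement'_top_left] at hc
    exact P.ne_bot_of_dvd_card hp hc

theorem normalizer_sylow_ne_top (hS : ¬ ∀ a b : S, a * b = b * a) {p : ℕ} [Fact p.Prime]
    (hp : p ∣ Nat.card S) (P : Sylow p S) : normalizer (P : Set S) ≠ ⊤ := by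
  intro h
  have hn : (P : Subgroup S).Normal := normalizer_eq_top_iff.1 h
  rcases Normal.eq_bot_or_eq_top hn with h0 | h0
  · exact P.ne_bot_of_dvd_card hp h0
  · apply not_isPGroup_of_noncomm hS (p := p)
    have := P.2
    rw [h0] at this
    exact this.of_equiv topEquiv

theorem index_normalizer_sylow (hS : ¬ ∀ a b : S, a * b = b * a) {p : ℕ} [Fact p.Prime]
    (hp : p ∣ Nat.card S) (P : Sylow p S) :
    (normalizer (P : Set S)).index ≡ 1 [MOD p] ∧ p + 1 ≤ (normalizer (P : Set S)).index := by
  have h1 := card_sylow_modEq_one p S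
  rw [P.card_eq_index_normalizer] at h1
  have h2 : (normalizer (P : Set S)).index ≠ 1 := fun h =>
    normalizer_sylow_ne_top hS hp P (index_eq_one.1 h)
  have h0 : (normalizer (P : Set S)).index ≠ 0 := index_ne_zero_of_finite
  refine ⟨h1, ?_⟩
  have := (Nat.modEq_iff_dvd' (show 1 ≤ (normalizer (P : Set S)).index by omega)).1 h1.symm
  have := Nat.le_of_dvd (by omega) this
  omega

/-- The index of `N(P)` is a proper divisor of that of `C(P)`. -/
theorem index_normalizer_mul_two_le (hS : ¬ ∀ a b : S, a * b = b * a) {p : ℕ} [Fact p.Prime]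
    (hp : p ∣ Nat.card S) (P : Sylow p S) :
    ∃ k, 2 ≤ k ∧ (normalizer (P : Set S)).index * k = (centralizer (P : Set S)).index := by
  have hle := centralizer_le_normalizer (P : Set S)
  refine ⟨(centralizer (P : Set S)).relIndex (normalizer (P : Set S)), ?_, ?_⟩
  · have h1 : (centralizer (P : Set S)).relIndex (normalizer (P : Set S)) ≠ 1 := fun h =>
      not_normalizer_le_centralizer hS hp P (relIndex_eq_one.1 h)
    have h0 : (centralizer (P : Set S)).relIndex (normalizer (P : Set S)) ≠ 0 :=
      relIndex_ne_zero_of_finite _ _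
    omega
  · rw [mul_comm]; exact relIndex_mul_index hle

theorem five_le_index (hS : ¬ ∀ a b : S, a * b = b * a) {H : Subgroup S}
    (hH : H ≠ ⊤) : 5 ≤ H.index := by
  by_contra hlt
  have h1 := two_mul_card_dvd_factorial_index hS hH
  have h24 : H.index.factorial ∣ 24 := Nat.factorial_dvd_factorial (show H.index ≤ 4 by omega)
  have h12 : Nat.card S ∣ 12 := by
    have := h1.trans h24
    exact Nat.dvd_of_mul_dvd_mul_left (k := 2) (by norm_num) this
  have : Fact (Nat.Prime 3) := ⟨Nat.prime_three⟩
  have : Fact (Nat.Prime 2) := ⟨Nat.prime_two⟩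
  have hle : Nat.card S ≤ 12 := Nat.le_of_dvd (by norm_num) h12
  by_cases h3 : 3 ∣ Nat.card S
  · obtain ⟨P⟩ := (inferInstance : Nonempty (Sylow 3 S))
    obtain ⟨k, hk, hk'⟩ := index_normalizer_mul_two_le hS h3 P
    have hm := (index_normalizer_sylow hS h3 P).2
    have hPc : Nat.card P = 3 := by
      obtain ⟨n, hn⟩ := (IsPGroup.iff_card (p := 3)).1 P.2
      have h3P := P.dvd_card_of_dvd_card h3
      have hd : Nat.card P ∣ 12 := (card_subgroup_dvd_card _).trans h12
      change Nat.card P = 3 ^ n at hn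
      have : n = 1 := by
        rcases n with _ | _ | n
        · rw [hn] at h3P; norm_num at h3P
        · rfl
        · have : 9 ∣ 12 := (hn ▸ (Dvd.intro (3 ^ n) (by ring) : 9 ∣ 3 ^ (n + 1 + 1))).trans hd
          norm_num at this
      rw [hn, this]; norm_num
    have hcyc : IsCyclic P := isCyclic_of_prime_card hPc
    have hPle : (P : Subgroup S) ≤ centralizer (P : Set S) := by
      have := hcyc.isMulCommutative
      exact le_centralizer P.1
    have hc : 3 ≤ Nat.card (centralizer (P : Set S)) := by
      have := card_le_of_le hPle
      have h' : Nat.card P.1 = 3 := hPc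
      omega
    have := card_mul_index (centralizer (P : Set S))
    nlinarith
  · have : Nat.card S ∣ 4 := by
      have hco : Nat.Coprime (Nat.card S) 3 := ((Nat.Prime.coprime_iff_not_dvd Nat.prime_three).2 h3).symm
      exact hco.dvd_of_dvd_mul_right (show Nat.card S ∣ 4 * 3 from h12)
    exact not_isPGroup_of_noncomm hS (p := 2) (IsPGroup.of_card_dvd_pow (n := 2) this)

end SimpleGroup

section Group

open Subgroup

variable {G : Type*} [Group G]

theorem centralizer_mul_le_of_coprime {z y : G} (hzy : Commute z y)
    (hc : (orderOf z).Coprime (orderOf y)) :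
    centralizer {z * y} ≤ centralizer {z} ⊓ centralizer {y} := by
  have key : ∀ a b : G, Commute a b → (orderOf a).Coprime (orderOf b) →
      centralizer {a * b} ≤ centralizer {a} := by
    intro a b hab hco g hg
    rw [mem_centralizer_singleton_iff] at hg ⊢
    obtain ⟨m, hm⟩ := exists_pow_eq_self_of_coprime hco.symm
    have h1 : Commute g ((a * b) ^ orderOf b) := Commute.pow_right hg _
    rw [hab.mul_pow, pow_orderOf_eq_one, mul_one] at h1
    have h2 := h1.pow_right m
    rw [hm] at h2
    exact h2
  refine le_inf (key z y hzy hc) ?_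
  rw [hzy.eq]
  exact key y z hzy.symm hc.symm

theorem exists_mul_eq_of_relIndex_eq [Finite G] {H K : Subgroup G} (h : H.relIndex K = H.index)
    (g : G) : ∃ k ∈ K, ∃ h ∈ H, g = k * h := by
  have hst : MulAction.stabilizer K ((1 : G) : G ⧸ H) = H.subgroupOf K := by
    ext k
    rw [MulAction.mem_stabilizer_iff, mem_subgroupOf]
    change (((k : G) * 1 : G) : G ⧸ H) = _ ↔ _
    rw [mul_one, eq_comm, QuotientGroup.eq]
    simp
  have h1 := MulAction.index_stabilizer K ((1 : G) : G ⧸ H)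
  rw [hst] at h1
  change H.relIndex K = _ at h1
  rw [h, index, ← Set.ncard_univ] at h1
  have h2 := Set.eq_of_subset_of_ncard_le (Set.subset_univ _) h1.le (Set.toFinite _)
  obtain ⟨k, hk⟩ : (g : G ⧸ H) ∈ MulAction.orbit K ((1 : G) : G ⧸ H) := h2 ▸ Set.mem_univ _
  change (((k : G) * 1 : G) : G ⧸ H) = _ at hk
  rw [mul_one, QuotientGroup.eq] at hk
  exact ⟨k, k.2, _, hk, by group⟩

theorem exists_mul_eq_of_coprime_index [Finite G] {H K : Subgroup G}
    (h : H.index.Coprime K.index) (g : G) : ∃ k ∈ K, ∃ h ∈ H, g = k * h := by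
  refine exists_mul_eq_of_relIndex_eq (le_antisymm ?_ ?_) g
  · have := relIndex_le_of_le_right (H := H) (le_top : K ≤ ⊤)
      (by rw [relIndex_top_right]; exact index_ne_zero_of_finite)
    rwa [relIndex_top_right] at this
  · refine Nat.le_of_dvd (Nat.pos_of_ne_zero (relIndex_ne_zero_of_finite _ _)) ?_
    refine h.dvd_of_dvd_mul_right ?_
    rw [← inf_relIndex_right, relIndex_mul_index inf_le_right]
    exact index_dvd_of_le inf_le_left

theorem IsPGroup.orderOf_coprime_of_mem {p q : ℕ} (hpq : p.Coprime q) {P Q : Subgroup G}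
    (hP : IsPGroup p P) (hQ : IsPGroup q Q) {x y : G} (hx : x ∈ P) (hy : y ∈ Q) :
    (orderOf x).Coprime (orderOf y) := by
  obtain ⟨k, hk⟩ := isPGroup_iff_orderOf_dvd_pow.1 hP ⟨x, hx⟩
  obtain ⟨l, hl⟩ := isPGroup_iff_orderOf_dvd_pow.1 hQ ⟨y, hy⟩
  rw [orderOf_mk] at hk hl
  exact Nat.Coprime.of_dvd hk hl (Nat.Coprime.pow _ _ hpq)

end Group

section SimpleGroup

open Subgroup

variable {S : Type*} [Group S] [Finite S] [IsSimpleGroup S]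

theorem not_commute_of_coprime_index (hS : ¬ ∀ a b : S, a * b = b * a) {x y : S} (hx : x ≠ 1)
    (hy : y ≠ 1) (h : (centralizer {x}).index.Coprime (centralizer {y}).index) :
    ¬ Commute x y := by
  intro hxy
  have hle : normalClosure {x} ≤ centralizer {y} := by
    rw [normalClosure, closure_le]
    intro w hw
    obtain ⟨x', hx', hw'⟩ := Group.mem_conjugatesOfSet_iff.1 hw
    rw [Set.mem_singleton_iff] at hx'
    subst hx'
    obtain ⟨g, rfl⟩ := isConj_iff.1 hw'
    obtain ⟨k, hk, c, hc, rfl⟩ := exists_mul_eq_of_coprime_index h g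
    have : k * c * x' * (k * c)⁻¹ = k * x' * k⁻¹ := by
      rw [mem_centralizer_singleton_iff] at hc
      rw [mul_assoc k c, hc]; group
    rw [this]
    exact mul_mem (mul_mem hk (mem_centralizer_singleton_iff.2 hxy)) (inv_mem hk)
  rcases Normal.eq_bot_or_eq_top (normalClosure_normal : (normalClosure {x}).Normal) with h0 | h0
  · apply hx
    have := subset_normalClosure (Set.mem_singleton x)
    rw [h0] at this
    simpa using this
  · rw [h0, top_le_iff] at hle
    exact hy (eq_one_of_centralizer_eq_top hS hle)

theorem five_le_index_centralizer (hS : ¬ ∀ a b : S, a * b = b * a) {x : S} (hx : x ≠ 1) :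
    5 ≤ (centralizer {x}).index :=
  five_le_index hS fun h => hx (eq_one_of_centralizer_eq_top hS h)

theorem exists_mem_center_sylow (hS : ¬ ∀ a b : S, a * b = b * a) {p : ℕ} [hpp : Fact p.Prime]
    (hp : p ∣ Nat.card S) (P : Sylow p S) :
    ∃ z ∈ P, z ≠ 1 ∧ (P : Subgroup S) ≤ centralizer {z} ∧ ¬ p ∣ (centralizer {z}).index ∧
      5 ≤ (centralizer {z}).index ∧ (centralizer {z}).index ∣ Nat.card S := by
  have : Nontrivial P := by
    rw [← Finite.one_lt_card_iff_nontrivial]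
    exact lt_of_lt_of_le hpp.out.one_lt (Nat.le_of_dvd Nat.card_pos (P.dvd_card_of_dvd_card hp))
  have : Nontrivial (center P) := P.2.center_nontrivial
  obtain ⟨⟨⟨z, hzP⟩, hz⟩, hz1⟩ := exists_ne (1 : center P)
  have hz1' : z ≠ 1 := fun h => hz1 (Subtype.ext (Subtype.ext h))
  have hle : (P : Subgroup S) ≤ centralizer {z} := fun g hg =>
    mem_centralizer_singleton_iff.2 (congrArg Subtype.val (mem_center_iff.1 hz ⟨g, hg⟩))
  exact ⟨z, hzP, hz1', hle, fun h => P.not_dvd_index (h.trans (index_dvd_of_le hle)),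
    five_le_index_centralizer hS hz1', index_dvd_card _⟩

end SimpleGroup

section SimpleGroup

open Subgroup

theorem Subgroup.eq_top_of_sylow_le {G : Type*} [Group G] [Finite G] {K : Subgroup G}
    (h : ∀ q : ℕ, [Fact q.Prime] → ∃ R : Sylow q G, (R : Subgroup G) ≤ K) : K = ⊤ := by
  rw [← index_eq_one]
  by_contra h1
  obtain ⟨q, hq, hqd⟩ := Nat.exists_prime_and_dvd h1
  have : Fact q.Prime := ⟨hq⟩
  obtain ⟨R, hR⟩ := h q
  exact R.not_dvd_index (hqd.trans (index_dvd_of_le hR))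

theorem IsPGroup.normal_of_index_eq {G : Type*} [Group G] [Finite G] {p : ℕ}
    [hp : Fact p.Prime] (hG : IsPGroup p G) {D : Subgroup G} (hD : D.index = p) : D.Normal := by
  obtain ⟨n, hn⟩ := (IsPGroup.iff_card (p := p)).1 hG
  have hn0 : n ≠ 0 := by
    rintro rfl
    have : p ∣ 1 := by
      rw [← pow_zero p, ← hn, ← hD]; exact D.index_dvd_card
    exact hp.out.one_lt.ne' (Nat.dvd_one.1 this)
  refine normal_of_index_eq_minFac_card ?_
  rw [hn, hp.out.pow_minFac hn0, hD]

theorem IsPGroup.mul_mul_inv_mem_of_index_eq {G : Type*} [Group G] [Finite G] {p : ℕ}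
    [hp : Fact p.Prime] (hG : IsPGroup p G) {D : Subgroup G} (hD : D.index = p) (a b : G) :
    a * b * (b * a)⁻¹ ∈ D := by
  have hn : D.Normal := hG.normal_of_index_eq hD
  have hcyc : IsCyclic (G ⧸ D) := isCyclic_of_prime_card (p := p) hD
  rw [← QuotientGroup.eq_one_iff]
  have := hcyc.isMulCommutative.is_comm.comm (a : G ⧸ D) (b : G ⧸ D)
  change (a : G ⧸ D) * b * ((b : G ⧸ D) * (a : G ⧸ D))⁻¹ = 1
  rw [this, mul_inv_cancel]

theorem centralizer_le_centralizer_sylow_of_twelve_le {S : Type*} [Group S] [Finite S]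
    (hcl : ∀ g : S, (centralizer {g}).index ≤ 23) {p : ℕ} [hp : Fact p.Prime]
    (P : Sylow p S) (hP : (P : Subgroup S) ≤ centralizer (P : Set S)) {z : S} (hz : z ∈ P)
    (hn : 12 ≤ (centralizer {z}).index) : centralizer {z} ≤ centralizer (P : Set S) := by
  rw [← subgroupOf_eq_top]
  apply eq_top_of_sylow_le
  intro q hq
  have hPz : (P : Subgroup S) ≤ centralizer {z} :=
    hP.trans (centralizer_le (Set.singleton_subset_iff.2 hz))
  by_cases hqp : q = p
  · subst hqp
    exact ⟨P.subtype hPz, fun x hx => hP hx⟩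
  obtain ⟨R⟩ := (inferInstance : Nonempty (Sylow q (centralizer {z})))
  refine ⟨R, ?_⟩
  rintro ⟨y, hy⟩ hyR
  rw [mem_subgroupOf]
  have hzy : Commute z y := (mem_centralizer_singleton_iff.1 hy).symm
  have hco : (orderOf z).Coprime (orderOf y) := by
    refine IsPGroup.orderOf_coprime_of_mem
      ((Nat.coprime_primes hp.out hq.out).2 (Ne.symm hqp)) P.2
      (R.2.map (centralizer {z}).subtype) hz ?_
    exact ⟨⟨y, hy⟩, hyR, rfl⟩
  have hle := centralizer_mul_le_of_coprime hzy hco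
  have hle1 := hle.trans inf_le_left
  have heq : centralizer {z * y} = centralizer {z} := by
    have h1 := relIndex_mul_index hle1
    have h2 := hcl (z * y)
    have h0 := relIndex_ne_zero_of_finite (centralizer {z * y}) (centralizer {z})
    refine le_antisymm hle1 (relIndex_eq_one.1 ?_)
    by_contra h3
    have : 2 ≤ (centralizer {z * y}).relIndex (centralizer {z}) := by omega
    nlinarith
  rw [heq] at hle
  rw [mem_centralizer_iff]
  intro x hx
  exact mem_centralizer_singleton_iff.1 (hle (hPz hx)).2

variable {S : Type*} [Group S] [Finite S] [IsSimpleGroup S]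

theorem sylow_le_centralizer_of_five_le (hS : ¬ ∀ a b : S, a * b = b * a)
    (hcl : ∀ g : S, (centralizer {g}).index ≤ 23) {p : ℕ} [hp : Fact p.Prime] (h5 : 5 ≤ p)
    (P : Sylow p S) : (P : Subgroup S) ≤ centralizer (P : Set S) := by
  intro a ha
  rw [mem_centralizer_iff]
  intro b hb
  have key : ∀ x : S, b * a * (a * b)⁻¹ ∈ centralizer {x} := by
    intro x
    have hle : (centralizer {x}).relIndex (P : Subgroup S) ≤ 23 := by
      have := relIndex_le_of_le_right (H := centralizer {x}) (le_top : (P : Subgroup S) ≤ ⊤)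
        (by rw [relIndex_top_right]; exact index_ne_zero_of_finite)
      rw [relIndex_top_right] at this
      exact this.trans (hcl x)
    obtain ⟨n, hn⟩ := IsPGroup.index P.2 ((centralizer {x}).subgroupOf (P : Subgroup S))
    change (centralizer {x}).relIndex (P : Subgroup S) = _ at hn
    rw [hn] at hle
    have hmem : (⟨b, hb⟩ * ⟨a, ha⟩ * (⟨a, ha⟩ * ⟨b, hb⟩)⁻¹ : P) ∈
        (centralizer {x}).subgroupOf (P : Subgroup S) := by
      rcases n with _ | _ | n
      · rw [pow_zero, relIndex_eq_one] at hn
        exact hn (by simp only [coe_subtype]; exact SetLike.coe_mem _)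
      · rw [zero_add, pow_one] at hn
        exact P.2.mul_mul_inv_mem_of_index_eq hn _ _
      · exfalso
        have : p ^ 2 ≤ p ^ (n + 1 + 1) := Nat.pow_le_pow_right (by omega) (by omega)
        nlinarith
    exact hmem
  have h1 : b * a * (a * b)⁻¹ ∈ center S := mem_center_iff.2 fun x =>
    (mem_centralizer_singleton_iff.1 (key x)).symm
  have hc : center S = ⊥ := by
    by_contra h
    exact hS (commute_of_center_ne_bot h)
  rw [hc, mem_bot, mul_inv_eq_one] at h1
  exact h1

theorem centralizer_le_centralizer_sylow (hS : ¬ ∀ a b : S, a * b = b * a)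
    (hcl : ∀ g : S, (centralizer {g}).index ≤ 23) {p : ℕ} [hp : Fact p.Prime] (h5 : 5 ≤ p)
    (h11 : p = 5 → ¬ 11 ∣ Nat.card S) (hpS : p ∣ Nat.card S)
    (P : Sylow p S) {z : S} (hz : z ∈ P) (hz1 : z ≠ 1)
    (hpz : ¬ p ∣ (centralizer {z}).index) : centralizer {z} ≤ centralizer (P : Set S) := by
  have hPab := sylow_le_centralizer_of_five_le hS hcl h5 P
  by_cases hn : 12 ≤ (centralizer {z}).index
  · exact centralizer_le_centralizer_sylow_of_twelve_le hcl P hPab hz hn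
  have hfac := two_mul_card_dvd_factorial_index hS
    (fun h => hz1 (eq_one_of_centralizer_eq_top hS h) : centralizer {z} ≠ ⊤)
  have hnS := index_dvd_card (centralizer {z})
  generalize (centralizer {z}).index = n at *
  have hn0 : n < 12 := by omega
  have hpn : p ≤ n := (hp.out.dvd_factorial).1 ((hpS.trans (Dvd.intro_left 2 rfl)).trans hfac)
  have hPc : Nat.card P = p := by
    obtain ⟨k, hk⟩ := (IsPGroup.iff_card (p := p)).1 P.2
    change Nat.card P = p ^ k at hk
    have h1 : p ^ k ∣ n.factorial := by
      rw [← hk]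
      exact ((card_subgroup_dvd_card (P : Subgroup S)).trans (Dvd.intro_left 2 rfl)).trans hfac
    have h2 := P.dvd_card_of_dvd_card hpS
    rcases k with _ | _ | k
    · rw [hk, pow_zero] at h2
      exact absurd (Nat.dvd_one.1 h2) hp.out.one_lt.ne'
    · rw [hk]; simp
    · exfalso
      have h3 : p ^ 2 ∣ n.factorial := (pow_dvd_pow p (by omega)).trans h1
      have hp11 : p ≤ 11 := by omega
      have hpp := hp.out
      clear h1 hk h2
      interval_cases p
      · have h' := h11 rfl
        have : n ≠ 11 := fun h => h' (h ▸ hnS)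
        have : n ≤ 9 := by omega
        have := h3.trans (Nat.factorial_dvd_factorial this)
        revert this; decide
      · revert hpp; decide
      · have := h3.trans (Nat.factorial_dvd_factorial (show n ≤ 11 by omega))
        revert this; decide
      · revert hpp; decide
      · revert hpp; decide
      · revert hpp; decide
      · exact hpz ⟨1, by omega⟩
  have hzp : (P : Subgroup S) ≤ zpowers z := by
    have hle : zpowers z ≤ (P : Subgroup S) := by rwa [zpowers_le]
    refine (eq_of_le_of_card_ge hle ?_).ge
    have hd := card_dvd_of_le hle
    change _ ∣ Nat.card P at hd
    change Nat.card P ≤ _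
    rw [hPc] at hd ⊢
    rcases (Nat.dvd_prime hp.out).1 hd with h | h
    · rw [Nat.card_zpowers, orderOf_eq_one_iff] at h
      exact absurd h hz1
    · exact h.ge
  intro g hg
  rw [mem_centralizer_iff]
  intro x hx
  obtain ⟨i, rfl⟩ := mem_zpowers_iff.1 (hzp hx)
  have : Commute z g := (mem_centralizer_singleton_iff.1 hg).symm
  exact (this.zpow_left i).eq

theorem card_centralizer_sylow_le {p : ℕ} (hS : ¬ ∀ a b : S, a * b = b * a)
    [hp : Fact p.Prime] (hpS : p ∣ Nat.card S) (P : Sylow p S)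
    (hm : (normalizer (P : Set S)).index = p + 1) :
    Nat.card (centralizer (P : Set S)) ≤ p := by
  rw [← P.card_eq_index_normalizer] at hm
  have : Nontrivial (Sylow p S) := by
    rw [← Finite.one_lt_card_iff_nontrivial, hm]
    have := hp.out.pos
    omega
  obtain ⟨Q, hQ⟩ := exists_ne P
  have hcomp : ({P}ᶜ : Set (Sylow p S)).ncard = p := by
    have := Set.ncard_add_ncard_compl ({P} : Set (Sylow p S))
    rw [Set.ncard_singleton, hm] at this
    omega
  have hsub : ∀ g ∈ normalizer (P : Set S), g • Q ∈ ({P}ᶜ : Set (Sylow p S)) := by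
    intro g hg h
    apply hQ
    have h2 := Sylow.smul_eq_iff_mem_normalizer.2 hg
    rw [Set.mem_singleton_iff] at h
    exact smul_left_cancel g (h.trans h2.symm)
  have hPN : (P : Subgroup S) ≤ normalizer (P : Set S) := le_normalizer
  have horb : MulAction.orbit P Q = {P}ᶜ := by
    have hss : MulAction.orbit P Q ⊆ {P}ᶜ := by
      rintro _ ⟨g, rfl⟩
      exact hsub g (hPN g.2)
    refine Set.eq_of_subset_of_ncard_le hss ?_ (Set.toFinite _)
    rw [hcomp]
    obtain ⟨n, hn⟩ := IsPGroup.card_orbit P.2 Q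
    change Set.ncard _ = _ at hn
    rw [hn]
    rcases n with _ | n
    · exfalso
      apply hQ
      have hfix : (P : Subgroup S) ≤ normalizer (Q : Set S) := by
        intro g hg
        rw [← Sylow.smul_eq_iff_mem_normalizer]
        rw [pow_zero, Set.ncard_eq_one] at hn
        obtain ⟨R, hR⟩ := hn
        have h1 : Q ∈ MulAction.orbit P Q := MulAction.mem_orbit_self Q
        have h2 : (⟨g, hg⟩ : P) • Q ∈ MulAction.orbit P Q := MulAction.mem_orbit _ _
        rw [hR, Set.mem_singleton_iff] at h1 h2
        exact h2.trans h1.symm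
      have h1 := P.2.inf_normalizer_sylow Q
      rw [inf_eq_left.2 hfix] at h1
      have h2 : (P : Subgroup S) ≤ Q := h1 ▸ inf_le_right
      exact Sylow.ext (P.3 Q.2 h2)
    · exact Nat.le_self_pow (by omega) p
  refine le_of_le_of_eq ?_ hcomp
  have hinj : Function.Injective (fun g : centralizer (P : Set S) =>
      (⟨(g : S) • Q, hsub g (centralizer_le_normalizer _ g.2)⟩ : ({P}ᶜ : Set (Sylow p S)))) := by
    intro g h hgh
    have hgh : (g : S) • Q = (h : S) • Q := congrArg Subtype.val hgh
    have hker : (MulAction.toPermHom S (Sylow p S)).ker = ⊥ := by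
      refine (Normal.eq_bot_or_eq_top inferInstance).resolve_right fun h =>
        normalizer_sylow_ne_top hS hpS P ?_
      rw [eq_top_iff]
      intro g _
      have : g ∈ (MulAction.toPermHom S (Sylow p S)).ker := h ▸ mem_top g
      exact Sylow.smul_eq_iff_mem_normalizer.1 (DFunLike.congr_fun (MonoidHom.mem_ker.1 this) P)
    rw [MonoidHom.ker_eq_bot_iff] at hker
    apply Subtype.ext
    apply hker
    ext1 R
    change (g : S) • R = (h : S) • R
    by_cases hR : R = P
    · subst hR
      rw [Sylow.smul_eq_iff_mem_normalizer.2 (centralizer_le_normalizer _ g.2),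
        Sylow.smul_eq_iff_mem_normalizer.2 (centralizer_le_normalizer _ h.2)]
    · have : R ∈ MulAction.orbit P Q := horb ▸ hR
      obtain ⟨x, rfl⟩ := this
      change (g : S) • (x : S) • Q = (h : S) • (x : S) • Q
      rw [smul_smul, smul_smul, ← mem_centralizer_iff.1 g.2 x x.2,
        ← mem_centralizer_iff.1 h.2 x x.2, mul_smul, mul_smul, hgh]
  exact Nat.card_le_card_of_injective _ hinj

theorem index_eq_of_five_le (hS : ¬ ∀ a b : S, a * b = b * a)
    (hcl : ∀ g : S, (centralizer {g}).index ≤ 23) {p : ℕ} [hp : Fact p.Prime] (h5 : 5 ≤ p)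
    (h11 : p = 5 → ¬ 11 ∣ Nat.card S) (hpS : p ∣ Nat.card S) :
    (p = 5 ∨ p = 7) ∧ ∃ k, 2 ≤ k ∧ (p + 1) * k ≤ 23 ∧ ¬ p ∣ (p + 1) * k ∧
      Nat.card S = p * ((p + 1) * k) := by
  obtain ⟨P⟩ := (inferInstance : Nonempty (Sylow p S))
  obtain ⟨z, hz, hz1, hPz, hpz, hn5, hnS⟩ := exists_mem_center_sylow hS hpS P
  have hle := centralizer_le_centralizer_sylow hS hcl h5 h11 hpS P hz hz1 hpz
  have heq : centralizer {z} = centralizer (P : Set S) :=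
    le_antisymm hle (centralizer_le (Set.singleton_subset_iff.2 hz))
  obtain ⟨k, hk, hmk⟩ := index_normalizer_mul_two_le hS hpS P
  obtain ⟨hm1, hm2⟩ := index_normalizer_sylow hS hpS P
  have hn := hcl z
  rw [heq] at hn hpz hnS
  have hPab := sylow_le_centralizer_of_five_le hS hcl h5 P
  have hcard := card_centralizer_sylow_le hS hpS P
  have hP : p ≤ Nat.card (centralizer (P : Set S)) :=
    (Nat.le_of_dvd Nat.card_pos (P.dvd_card_of_dvd_card hpS)).trans (card_le_of_le hPab)
  have hmul := card_mul_index (centralizer (P : Set S))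
  have hmS : (normalizer (P : Set S)).index ∣ Nat.card S := index_dvd_card _
  rw [← hmk] at hmul hn hpz
  generalize (normalizer (P : Set S)).index = m at *
  have hm11 : m ≤ 11 := by nlinarith
  have hp57 : p = 5 ∨ p = 7 := by
    have hpp := hp.out
    have : p ≤ 10 := by omega
    clear hmul hcard hP hPab hpz hm1
    interval_cases p <;> first | omega | (revert hpp; decide)
  have hm : m = p + 1 := by
    rcases hp57 with rfl | rfl
    · have hne : m ≠ 11 := fun h => h11 rfl (h ▸ hmS)
      unfold Nat.ModEq at hm1
      omega
    · unfold Nat.ModEq at hm1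
      omega
  subst hm
  refine ⟨hp57, k, hk, hn, hpz, ?_⟩
  rw [← hmul, le_antisymm (hcard rfl) hP]

end SimpleGroup

section SimpleGroup

open Subgroup

variable {S : Type*} [Group S] [Finite S] [IsSimpleGroup S]

theorem exists_dvd_card_index_centralizer_two (hS : ¬ ∀ a b : S, a * b = b * a)
    (h2 : 2 ∣ Nat.card S) : ∃ z : S, z ≠ 1 ∧ ¬ 2 ∣ (centralizer {z}).index ∧
      5 ≤ (centralizer {z}).index ∧ (centralizer {z}).index ∣ Nat.card S := by
  have : Fact (Nat.Prime 2) := ⟨Nat.prime_two⟩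
  obtain ⟨P⟩ := (inferInstance : Nonempty (Sylow 2 S))
  obtain ⟨z, -, hz1, -, h⟩ := exists_mem_center_sylow hS h2 P
  exact ⟨z, hz1, h⟩

theorem not_seven_dvd_card (hS : ¬ ∀ a b : S, a * b = b * a)
    (hcl : ∀ g : S, (centralizer {g}).index ≤ 23) : ¬ 7 ∣ Nat.card S := by
  intro h7
  have : Fact (Nat.Prime 7) := ⟨by norm_num⟩
  obtain ⟨-, k, hk, hk23, -, hcard⟩ := index_eq_of_five_le hS hcl (by norm_num) (by norm_num) h7
  have hk2 : k = 2 := by omega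
  subst hk2
  norm_num at hcard
  obtain ⟨z, hz1, hzo, hz5, hzd⟩ := exists_dvd_card_index_centralizer_two hS (by omega)
  have hf := two_mul_card_dvd_factorial_index hS
    (fun h => hz1 (eq_one_of_centralizer_eq_top hS h) : centralizer {z} ≠ ⊤)
  have h23 := hcl z
  rw [hcard] at hf hzd
  generalize (centralizer {z}).index = n at *
  have : n = 7 := by
    clear hf
    interval_cases n <;> omega
  subst this
  revert hf; decide

theorem not_dvd_card_of_seven_le (hS : ¬ ∀ a b : S, a * b = b * a)
    (hcl : ∀ g : S, (centralizer {g}).index ≤ 23) {p : ℕ} (hp : p.Prime) (h7 : 7 ≤ p) :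
    ¬ p ∣ Nat.card S := by
  intro hpS
  have : Fact p.Prime := ⟨hp⟩
  rcases (index_eq_of_five_le hS hcl (by omega) (by omega) hpS).1 with rfl | rfl
  · omega
  · exact not_seven_dvd_card hS hcl hpS

theorem not_card_eq_ninety (hS : ¬ ∀ a b : S, a * b = b * a) : Nat.card S ≠ 90 := by
  intro hcard
  have : Fact (Nat.Prime 2) := ⟨Nat.prime_two⟩
  obtain ⟨P⟩ := (inferInstance : Nonempty (Sylow 2 S))
  refine not_normalizer_le_centralizer hS (by rw [hcard]; norm_num) P ?_
  refine IsCyclic.normalizer_le_centralizer (p := 2) (by rw [hcard]; norm_num) ?_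
  have h1 : Nat.card P = 2 := by
    rw [P.card_eq_multiplicity, hcard]
    have : (Nat.factorization 90) 2 = 1 := by
      rw [Nat.factorization_def _ Nat.prime_two]
      have : padicValNat 2 (2 * 45) = 1 := by
        rw [padicValNat.mul (by norm_num) (by norm_num), padicValNat_self,
          padicValNat.eq_zero_of_not_dvd (by norm_num)]
      exact this
    rw [this, pow_one]
  exact isCyclic_of_prime_card h1

theorem card_eq_sixty (hS : ¬ ∀ a b : S, a * b = b * a)
    (hcl : ∀ g : S, (centralizer {g}).index ≤ 23) (h5 : 5 ∣ Nat.card S) :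
    Nat.card S = 60 := by
  have : Fact (Nat.Prime 5) := ⟨by norm_num⟩
  obtain ⟨-, k, hk, hk23, -, hcard⟩ := index_eq_of_five_le hS hcl (by norm_num)
    (fun _ => not_dvd_card_of_seven_le hS hcl (by norm_num) (by norm_num)) h5
  have := not_card_eq_ninety hS
  have : k = 2 ∨ k = 3 := by omega
  omega

theorem exists_index_eq_five (hS : ¬ ∀ a b : S, a * b = b * a)
    (hcl : ∀ g : S, (centralizer {g}).index ≤ 23) (hcard : Nat.card S = 60) :
    ∃ H : Subgroup S, H.index = 5 := by
  have : Fact (Nat.Prime 2) := ⟨Nat.prime_two⟩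
  have h2 : 2 ∣ Nat.card S := by rw [hcard]; norm_num
  obtain ⟨P⟩ := (inferInstance : Nonempty (Sylow 2 S))
  obtain ⟨z, hzP, hz1, hPz, hz2, hz5, hzS⟩ := exists_mem_center_sylow hS h2 P
  by_cases hn : (centralizer {z}).index = 5
  · exact ⟨_, hn⟩
  have hn15 : (centralizer {z}).index = 15 := by
    have := hcl z
    rw [hcard] at hzS
    generalize (centralizer {z}).index = n at *
    interval_cases n <;> omega
  have hP4 : Nat.card P = 2 ^ 2 := by
    rw [P.card_eq_multiplicity, hcard]
    have : (Nat.factorization 60) 2 = 2 := by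
      rw [Nat.factorization_def _ Nat.prime_two]
      have : padicValNat 2 (2 * (2 * 15)) = 2 := by
        rw [padicValNat.mul (by norm_num) (by norm_num),
          padicValNat.mul (by norm_num) (by norm_num), padicValNat_self,
          padicValNat.eq_zero_of_not_dvd (by norm_num)]
      exact this
    rw [this]
  have hPab : (P : Subgroup S) ≤ centralizer (P : Set S) := by
    have := IsPGroup.isMulCommutative_of_card_eq_prime_sq hP4
    exact le_centralizer P.1
  obtain ⟨k, hk, hmk⟩ := index_normalizer_mul_two_le hS h2 P
  have hc : (centralizer (P : Set S)).index ∣ 15 := by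
    have h1 := card_mul_index (P : Subgroup S)
    change Nat.card P * _ = _ at h1
    rw [hP4, hcard] at h1
    have h2 := index_dvd_of_le hPab
    have : (P : Subgroup S).index = 15 := by omega
    rwa [this] at h2
  have hm5 := five_le_index hS (normalizer_sylow_ne_top hS h2 P)
  refine ⟨normalizer (P : Set S), ?_⟩
  have hm15 : (normalizer (P : Set S)).index ∣ 15 := (Dvd.intro _ hmk).trans hc
  have := Nat.le_of_dvd (by norm_num) hc
  generalize (normalizer (P : Set S)).index = m at *
  have : m ≤ 7 := by nlinarith
  interval_cases m <;> omega

theorem nonempty_mulEquiv_alternatingGroup_of_card (hS : ¬ ∀ a b : S, a * b = b * a)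
    (hcard : Nat.card S = 60) {H : Subgroup S} (hH : H.index = 5) :
    Nonempty (S ≃* alternatingGroup (Fin 5)) := by
  classical
  have : Fintype (S ⧸ H) := Fintype.ofFinite _
  have e : S ⧸ H ≃ Fin 5 := Finite.equivFinOfCardEq hH
  let f : S →* Equiv.Perm (Fin 5) :=
    e.permCongrHom.toMonoidHom.comp (MulAction.toPermHom S (S ⧸ H))
  have hinj : Function.Injective f := by
    refine e.permCongrHom.injective.comp ?_
    rw [← MonoidHom.ker_eq_bot_iff, ← normalCore_eq_ker]
    refine (Normal.eq_bot_or_eq_top H.normalCore_normal).resolve_right fun h => ?_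
    have : H = ⊤ := top_le_iff.1 (h ▸ normalCore_le H)
    rw [this, index_top] at hH
    norm_num at hH
  have hle : ∀ g, f g ∈ alternatingGroup (Fin 5) := by
    have hk : (Equiv.Perm.sign.comp f).ker = ⊤ := by
      refine (Normal.eq_bot_or_eq_top inferInstance).resolve_left fun h => hS fun a b => ?_
      apply (MonoidHom.ker_eq_bot_iff _).1 h
      simp only [map_mul, mul_comm]
    intro g
    rw [Equiv.Perm.mem_alternatingGroup]
    have : g ∈ (Equiv.Perm.sign.comp f).ker := hk ▸ mem_top g
    simpa using this
  have hA : Nat.card (alternatingGroup (Fin 5)) = 60 := by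
    have := two_mul_nat_card_alternatingGroup (α := Fin 5)
    rw [Nat.card_perm, Nat.card_fin] at this
    have h5 : Nat.factorial 5 = 120 := rfl
    omega
  refine ⟨MulEquiv.ofBijective (f.codRestrict _ hle) ?_⟩
  refine (Nat.bijective_iff_injective_and_card _).2 ⟨?_, by rw [hcard, hA]⟩
  intro a b h
  exact hinj (congrArg Subtype.val h)

end SimpleGroup

section SimpleGroup

open Subgroup

theorem exists_sylow_relIndex_eq_three {G : Type*} [Group G] [Finite G] [Fact (Nat.Prime 3)]
    (h16 : Nat.card (Sylow 3 G) = 16) (P : Sylow 3 G) :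
    ∃ Q : Sylow 3 G, Q ≠ P ∧ (Q : Subgroup G).relIndex P = 3 := by
  have hcomp : ({P}ᶜ : Set (Sylow 3 G)).ncard = 15 := by
    have := Set.ncard_add_ncard_compl ({P} : Set (Sylow 3 G))
    rw [Set.ncard_singleton, h16] at this
    omega
  have hidx : ∀ Q : Sylow 3 G, (Q : Subgroup G).relIndex P = (MulAction.orbit P Q).ncard := by
    intro Q
    rw [← MulAction.index_stabilizer]
    change ((Q : Subgroup G).subgroupOf P).index = _
    congr 1
    ext ⟨g, hg⟩
    rw [mem_subgroupOf, MulAction.mem_stabilizer_iff]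
    change _ ↔ g • Q = Q
    rw [Sylow.smul_eq_iff_mem_normalizer]
    have h1 := P.2.inf_normalizer_sylow Q
    have h2 : g ∈ (P : Subgroup G) ⊓ normalizer (Q : Set G) ↔ g ∈ (P : Subgroup G) ⊓ Q := by
      rw [← h1]
    rw [mem_inf, mem_inf] at h2
    exact ⟨fun h => (h2.2 ⟨hg, h⟩).2, fun h => (h2.1 ⟨hg, h⟩).2⟩
  have horb : ∀ Q : Sylow 3 G, Q ≠ P → MulAction.orbit P Q ⊆ {P}ᶜ := by
    rintro Q hQ _ ⟨g, rfl⟩ h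
    apply hQ
    have h2 : g • P = P :=
      Sylow.smul_eq_iff_mem_normalizer.2 ((le_normalizer : (P : Subgroup G) ≤ _) g.2)
    rw [Set.mem_singleton_iff] at h
    exact smul_left_cancel g (h.trans h2.symm)
  by_contra! hne
  have h9 : ∀ Q : Sylow 3 G, Q ≠ P → 9 ≤ (MulAction.orbit P Q).ncard := by
    intro Q hQ
    have h3 := hne Q hQ
    obtain ⟨n, hn⟩ := IsPGroup.card_orbit P.2 Q
    change Set.ncard _ = _ at hn
    rw [hidx, hn] at h3
    rw [hn]
    rcases n with _ | _ | n
    · exfalso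
      rw [pow_zero, ← hidx, relIndex_eq_one] at hn
      exact hQ (Sylow.ext (P.3 Q.2 hn))
    · exact absurd rfl h3
    · have := Nat.one_le_pow n 3 (by norm_num)
      rw [pow_add, pow_add]; omega
  obtain ⟨Q, hQ⟩ : ({P}ᶜ : Set (Sylow 3 G)).Nonempty := by
    apply Set.nonempty_of_ncard_ne_zero; omega
  have hQ9 : (MulAction.orbit P Q).ncard ≠ 15 := by
    obtain ⟨n, hn⟩ := IsPGroup.card_orbit P.2 Q
    change Set.ncard _ = _ at hn
    rw [hn]
    rcases n with _ | _ | _ | n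
    · norm_num
    · norm_num
    · norm_num
    · have := Nat.one_le_pow n 3 (by norm_num)
      rw [pow_add, pow_add, pow_add]; omega
  obtain ⟨R, hR, hRQ⟩ : ∃ R ∈ ({P}ᶜ : Set (Sylow 3 G)), R ∉ MulAction.orbit P Q := by
    by_contra! h
    exact hQ9 (by rw [(horb Q hQ).antisymm h, hcomp])
  have hdis : Disjoint (MulAction.orbit P Q) (MulAction.orbit P R) := by
    rw [Set.disjoint_left]
    intro T hT1 hT2
    apply hRQ
    rw [← MulAction.orbit_eq_iff.2 hT1, MulAction.orbit_eq_iff.2 hT2]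
    exact MulAction.mem_orbit_self R
  have h1 := Set.ncard_union_eq hdis (Set.toFinite _) (Set.toFinite _)
  have h2 := Set.ncard_le_ncard (Set.union_subset (horb Q hQ) (horb R hR)) (Set.toFinite _)
  have h3 := h9 Q hQ
  have h4 := h9 R hR
  omega

theorem IsPGroup.le_normalizer_of_relIndex_eq {G : Type*} [Group G] [Finite G] {p : ℕ}
    [hp : Fact p.Prime] {P D : Subgroup G} (hP : IsPGroup p P) (hD : D ≤ P)
    (h : D.relIndex P = p) : P ≤ normalizer (D : Set G) := by
  rw [← normal_subgroupOf_iff_le_normalizer hD]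
  exact hP.normal_of_index_eq h

variable {S : Type*} [Group S] [Finite S] [IsSimpleGroup S]

theorem not_sylow_three_self_normalizing (hS : ¬ ∀ a b : S, a * b = b * a)
    [Fact (Nat.Prime 3)] (h9 : 9 ∣ Nat.card S) (P : Sylow 3 S)
    (hPN : normalizer (P : Set S) = P) : (P : Subgroup S).index ≠ 16 := by
  intro hP16
  have h16 : Nat.card (Sylow 3 S) = 16 := by rw [P.card_eq_index_normalizer, hPN, hP16]
  obtain ⟨Q, hQP, hQ3⟩ := exists_sylow_relIndex_eq_three h16 P
  have hcardPQ : Nat.card (P : Subgroup S) = Nat.card (Q : Subgroup S) :=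
    P.card_eq_multiplicity.trans Q.card_eq_multiplicity.symm
  set D : Subgroup S := P ⊓ Q with hD
  have hDP : D.relIndex P = 3 := by rw [hD, inf_relIndex_left, hQ3]
  have hcP : Nat.card D * D.relIndex P = Nat.card (P : Subgroup S) := by
    rw [← relIndex_bot_left, ← relIndex_bot_left]
    exact relIndex_mul_relIndex _ _ _ bot_le inf_le_left
  have hcQ : Nat.card D * D.relIndex Q = Nat.card (Q : Subgroup S) := by
    rw [← relIndex_bot_left, ← relIndex_bot_left]
    exact relIndex_mul_relIndex _ _ _ bot_le inf_le_right
  rw [hDP] at hcP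
  have hDpos : 0 < Nat.card D := Nat.card_pos
  have hDQ : D.relIndex Q = 3 := by
    rw [← hcardPQ, ← hcP] at hcQ
    exact Nat.eq_of_mul_eq_mul_left hDpos hcQ
  have hPD := P.2.le_normalizer_of_relIndex_eq (inf_le_left : D ≤ P) hDP
  have hQD := Q.2.le_normalizer_of_relIndex_eq (inf_le_right : D ≤ Q) hDQ
  have hmul := card_mul_index (P : Subgroup S)
  rw [hP16] at hmul
  have hD1 : D ≠ ⊥ := by
    intro h
    rw [h, card_bot] at hcP
    omega
  have hDtop : D ≠ ⊤ := by
    intro h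
    rw [h, relIndex_top_left] at hDP
    norm_num at hDP
  have hN : normalizer (D : Set S) ≠ ⊤ := fun h =>
    (Normal.eq_bot_or_eq_top (normalizer_eq_top_iff.1 h)).elim hD1 hDtop
  have h5 := five_le_index hS hN
  have hidx := relIndex_mul_index hPD
  rw [hP16] at hidx
  have hor : (P : Subgroup S).relIndex (normalizer (D : Set S)) = 1 ∨
      (P : Subgroup S).relIndex (normalizer (D : Set S)) = 2 := by
    generalize (P : Subgroup S).relIndex (normalizer (D : Set S)) = a at *
    generalize (normalizer (D : Set S)).index = b at *
    have : a ≤ 3 := by nlinarith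
    interval_cases a <;> omega
  rcases hor with h | h
  · rw [relIndex_eq_one] at h
    exact hQP (Sylow.ext (Q.3 P.2 (hQD.trans h)).symm)
  · have hn : ((P : Subgroup S).subgroupOf (normalizer (D : Set S))).Normal :=
      normal_of_index_eq_two h
    rw [normal_subgroupOf_iff_le_normalizer hPD] at hn
    have : normalizer (D : Set S) ≤ P := hn.trans hPN.le
    rw [relIndex_eq_one.2 this] at h
    norm_num at h

theorem five_dvd_card (hS : ¬ ∀ a b : S, a * b = b * a)
    (hcl : ∀ g : S, (centralizer {g}).index ≤ 23) : 5 ∣ Nat.card S := by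
  by_contra h5
  have hpr := fun (p : ℕ) (hp : p.Prime) (h7 : 7 ≤ p) => not_dvd_card_of_seven_le hS hcl hp h7
  have i2 : Fact (Nat.Prime 2) := ⟨Nat.prime_two⟩
  have i3 : Fact (Nat.Prime 3) := ⟨Nat.prime_three⟩
  have h23 : ∀ p : ℕ, p.Prime → p ∣ Nat.card S → p = 2 ∨ p = 3 := by
    intro p hp hpS
    by_contra hne
    have h7 : p < 7 := by
      by_contra h
      exact hpr p hp (by omega) hpS
    interval_cases p <;> first | omega | (revert hp; decide)
  have h2 : 2 ∣ Nat.card S := by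
    by_contra h
    refine not_isPGroup_of_noncomm hS (p := 3) (IsPGroup.of_card
      (Nat.eq_prime_pow_of_unique_prime_dvd Nat.card_pos.ne' ?_))
    intro d hd hdS
    rcases h23 d hd hdS with rfl | rfl
    · exact absurd hdS h
    · rfl
  have h3 : 3 ∣ Nat.card S := by
    by_contra h
    refine not_isPGroup_of_noncomm hS (p := 2) (IsPGroup.of_card
      (Nat.eq_prime_pow_of_unique_prime_dvd Nat.card_pos.ne' ?_))
    intro d hd hdS
    rcases h23 d hd hdS with rfl | rfl
    · rfl
    · exact absurd hdS h
  have hn : ∀ n, n ∣ Nat.card S → 5 ≤ n → n ≤ 23 → (¬ 2 ∣ n → n = 9) ∧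
      (¬ 3 ∣ n → n = 8 ∨ n = 16) := by
    intro n hnS hn5 hn23
    have h7 := hpr 7 (by norm_num) (by norm_num)
    have h11 := hpr 11 (by norm_num) (by norm_num)
    have h13 := hpr 13 (by norm_num) (by norm_num)
    have h17 := hpr 17 (by norm_num) (by norm_num)
    have h19 := hpr 19 (by norm_num) (by norm_num)
    have h23 := hpr 23 (by norm_num) (by norm_num)
    interval_cases n <;> omega
  have hn2 : ∀ Q : Sylow 2 S, ∃ z, z ≠ 1 ∧ (Q : Subgroup S) ≤ centralizer {z} ∧
      (centralizer {z}).index = 9 := by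
    intro Q
    obtain ⟨z, -, hz1, hQz, hz2, hz5, hzS⟩ := exists_mem_center_sylow hS h2 Q
    exact ⟨z, hz1, hQz, (hn _ hzS hz5 (hcl z)).1 hz2⟩
  have h9 : 9 ∣ Nat.card S := by
    obtain ⟨Q⟩ := (inferInstance : Nonempty (Sylow 2 S))
    obtain ⟨z, -, -, hz⟩ := hn2 Q
    rw [← hz]; exact index_dvd_card _
  obtain ⟨P⟩ := (inferInstance : Nonempty (Sylow 3 S))
  obtain ⟨z, hzP, hz1, hPz, hz3, hz5, hzS⟩ := exists_mem_center_sylow hS h3 P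
  have hz8 := (hn _ hzS hz5 (hcl z)).2 hz3
  have hC : IsPGroup 3 (centralizer {z}) := by
    refine IsPGroup.of_card (Nat.eq_prime_pow_of_unique_prime_dvd Nat.card_pos.ne' ?_)
    intro d hd hdS
    refine (h23 d hd (hdS.trans (card_subgroup_dvd_card _))).resolve_left ?_
    rintro rfl
    obtain ⟨⟨t, ht⟩, ht2⟩ := exists_prime_orderOf_dvd_card' 2 hdS
    rw [orderOf_mk] at ht2
    have ht1 : t ≠ 1 := by
      rintro rfl
      rw [orderOf_one] at ht2
      norm_num at ht2
    have hzt : Commute z t := (mem_centralizer_singleton_iff.1 ht).symm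
    have htp : IsPGroup 2 (zpowers t) :=
      IsPGroup.of_card (n := 1) (by rw [Nat.card_zpowers, ht2, pow_one])
    obtain ⟨Q, hQ⟩ := htp.exists_le_sylow
    obtain ⟨y, hy1, hQy, hy9⟩ := hn2 Q
    have hty : Commute t y :=
      mem_centralizer_singleton_iff.1 (hQy (hQ (mem_zpowers t)))
    have hco : (orderOf z).Coprime (orderOf t) :=
      IsPGroup.orderOf_coprime_of_mem (by norm_num) P.2 htp hzP (mem_zpowers t)
    have hle := centralizer_mul_le_of_coprime hzt hco
    have hd1 := index_dvd_of_le (hle.trans inf_le_left)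
    have hd2 := index_dvd_of_le (hle.trans inf_le_right)
    have h23' := hcl (z * t)
    have h16 : (centralizer {z * t}).index ∣ 16 := by
      have h0 : (centralizer {z * t}).index ≠ 0 := index_ne_zero_of_finite
      generalize (centralizer {z * t}).index = a at *
      rcases hz8 with h | h <;> rw [h] at hd1 <;> interval_cases a <;> omega
    refine not_commute_of_coprime_index hS ht1 hy1 ?_ hty
    rw [hy9]
    exact Nat.Coprime.coprime_dvd_left (hd2.trans h16) (by norm_num)
  have hCP : centralizer {z} = P := P.3 hC hPz
  rw [hCP] at hz8
  obtain ⟨hm1, hm4⟩ := index_normalizer_sylow hS h3 P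
  have hPN : (P : Subgroup S) ≤ normalizer (P : Set S) := le_normalizer
  have hm5 := five_le_index hS (normalizer_sylow_ne_top hS h3 P)
  have hmd := index_dvd_of_le hPN
  have hm16 : (normalizer (P : Set S)).index = 16 ∧ (P : Subgroup S).index = 16 := by
    have := Nat.le_of_dvd (by omega) hmd
    generalize (normalizer (P : Set S)).index = m at *
    unfold Nat.ModEq at hm1
    rcases hz8 with h | h <;> rw [h] at hmd this ⊢ <;> interval_cases m <;> omega
  refine not_sylow_three_self_normalizing hS h9 P (le_antisymm ?_ hPN) hm16.2
  have := relIndex_mul_index hPN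
  rw [hm16.1, hm16.2] at this
  exact relIndex_eq_one.1 (by omega)

theorem nonempty_mulEquiv_alternatingGroup (hS : ¬ ∀ a b : S, a * b = b * a)
    (hcl : ∀ g : S, (centralizer {g}).index ≤ 23) :
    Nonempty (S ≃* alternatingGroup (Fin 5)) := by
  have hcard := card_eq_sixty hS hcl (five_dvd_card hS hcl)
  obtain ⟨H, hH⟩ := exists_index_eq_five hS hcl hcard
  exact nonempty_mulEquiv_alternatingGroup_of_card hS hcard hH

end SimpleGroup

/-- The alternating group on five letters. -/
abbrev AltFive : Type := alternatingGroup (Fin 5)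

namespace AltFive

open Subgroup

/-- A five-cycle. -/
def fiveCycle : AltFive := ⟨finRotate 5, Equiv.Perm.mem_alternatingGroup.2 (by decide)⟩

/-- A double transposition. -/
def doubleSwap : AltFive :=
  ⟨Equiv.swap 0 1 * Equiv.swap 2 3, Equiv.Perm.mem_alternatingGroup.2 (by decide)⟩

/-- A three-cycle. -/
def threeCycle : AltFive :=
  ⟨Equiv.swap 0 1 * Equiv.swap 1 2, Equiv.Perm.mem_alternatingGroup.2 (by decide)⟩

theorem card_eq : Nat.card AltFive = 60 := by
  rw [Nat.card_eq_fintype_card]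
  decide +kernel

theorem doubleSwap_ne_one : doubleSwap ≠ 1 := by decide +kernel

theorem orderOf_fiveCycle : orderOf fiveCycle = 5 := by
  have : Fact (Nat.Prime 5) := ⟨by norm_num⟩
  exact orderOf_eq_prime (by decide +kernel) (by decide +kernel)

theorem orderOf_threeCycle : orderOf threeCycle = 3 := by
  have : Fact (Nat.Prime 3) := ⟨by norm_num⟩
  exact orderOf_eq_prime (by decide +kernel) (by decide +kernel)

theorem orderOf_doubleSwap : orderOf doubleSwap = 2 := by
  have : Fact (Nat.Prime 2) := ⟨by norm_num⟩
  exact orderOf_eq_prime (by decide +kernel) (by decide +kernel)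

theorem index_centralizer_doubleSwap : (centralizer {doubleSwap}).index = 15 := by
  have h1 : Nat.card (centralizer {doubleSwap}) =
      Nat.card {g : AltFive // g * doubleSwap = doubleSwap * g} :=
    Nat.card_congr (Equiv.subtypeEquivRight fun g => mem_centralizer_singleton_iff)
  have h2 : Nat.card {g : AltFive // g * doubleSwap = doubleSwap * g} = 4 := by
    rw [Nat.card_eq_fintype_card]
    decide +kernel
  have h3 := card_mul_index (centralizer {doubleSwap})
  rw [h1, h2, card_eq] at h3
  omega

theorem centralizer_eq_of_commute_doubleSwap {e : AltFive} (he : e * doubleSwap = doubleSwap * e)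
    (he1 : e ≠ 1) : centralizer {e} = centralizer {doubleSwap} := by
  have key : ∀ e : AltFive, e * doubleSwap = doubleSwap * e → e ≠ 1 →
      ∀ g : AltFive, g * e = e * g ↔ g * doubleSwap = doubleSwap * g := by
    decide +kernel
  ext g
  rw [mem_centralizer_singleton_iff, mem_centralizer_singleton_iff]
  exact key e he he1 g

end AltFive

section Perfect

open Subgroup

variable {T : Type*} [Group T]

open scoped IsMulCommutative in
/-- Transfer into an abelian subgroup of a perfect group kills central elements. -/
theorem pow_index_eq_one_of_mem_center (hT : commutator T = ⊤) (H : Subgroup T) [H.FiniteIndex]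
    (hH : ∀ a ∈ H, ∀ b ∈ H, a * b = b * a) {z : T} (hz : z ∈ center T) :
    z ^ H.index = 1 := by
  have : IsMulCommutative H := ⟨⟨fun a b => Subtype.ext (hH a a.2 b b.2)⟩⟩
  have h1 := MonoidHom.transfer_eq_pow (MonoidHom.id H) z fun k g _ => by
    have : g * z ^ k = z ^ k * g := mem_center_iff.1 (pow_mem hz k) g
    rw [mul_assoc, ← this, inv_mul_cancel_left]
  have h2 : z ∈ (MonoidHom.transfer (MonoidHom.id H)).ker :=
    Abelianization.commutator_subset_ker _ (hT ▸ mem_top z)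
  rw [MonoidHom.mem_ker.1 h2] at h1
  exact (congrArg Subtype.val h1).symm

theorem index_centralizer_map_dvd {Q : Type*} [Group Q] {f : T →* Q}
    (hf : Function.Surjective f) (x : T) :
    (centralizer {f x}).index ∣ (centralizer {x}).index := by
  rw [← index_comap_of_surjective _ hf]
  refine index_dvd_of_le fun g hg => ?_
  rw [mem_comap, mem_centralizer_singleton_iff, ← map_mul, ← map_mul,
    mem_centralizer_singleton_iff.1 hg]

theorem commute_of_mem_comap_zpowers {Q : Type*} [Group Q] {f : T →* Q}
    (hf : Function.Surjective f) (hker : f.ker ≤ center T) (c : Q) :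
    ∀ a ∈ (zpowers c).comap f, ∀ b ∈ (zpowers c).comap f, a * b = b * a := by
  obtain ⟨u, rfl⟩ := hf c
  have key : ∀ a ∈ (zpowers (f u)).comap f, ∃ (i : ℤ) (m : T), m ∈ center T ∧ a = u ^ i * m := by
    intro a ha
    obtain ⟨i, hi⟩ := mem_zpowers_iff.1 (mem_comap.1 ha)
    refine ⟨i, (u ^ i)⁻¹ * a, hker ?_, by group⟩
    rw [MonoidHom.mem_ker, map_mul, map_inv, map_zpow, hi, inv_mul_cancel]
  intro a ha b hb
  obtain ⟨i, m, hm, rfl⟩ := key a ha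
  obtain ⟨j, n, hn, rfl⟩ := key b hb
  have h1 : Commute (u ^ i) (u ^ j) := (Commute.refl u).zpow_zpow i j
  have hm' : ∀ g, Commute g m := mem_center_iff.1 hm
  have hn' : ∀ g, Commute g n := mem_center_iff.1 hn
  exact ((h1.mul_right (hn' _)).mul_left (hm' _).symm).eq

variable [Finite T]

theorem centralizer_eq_comap_of_map_eq (hcl : ∀ g : T, (centralizer {g}).index ≤ 23)
    {f : T →* AltFive} (hf : Function.Surjective f) {x : T}
    (hx : (centralizer {f x}).index = 15) :
    centralizer {x} = (centralizer {f x}).comap f := by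
  have hle : centralizer {x} ≤ (centralizer {f x}).comap f := by
    intro g hg
    rw [mem_comap, mem_centralizer_singleton_iff, ← map_mul, ← map_mul,
      mem_centralizer_singleton_iff.1 hg]
  have h1 := relIndex_mul_index hle
  rw [index_comap_of_surjective _ hf, hx] at h1
  have h2 := hcl x
  have h0 := relIndex_ne_zero_of_finite (centralizer {x}) ((centralizer {f x}).comap f)
  exact le_antisymm hle (relIndex_eq_one.1 (by omega))

theorem ker_le_center_of_surjective_altFive (hcl : ∀ g : T, (centralizer {g}).index ≤ 23)
    {f : T →* AltFive} (hf : Function.Surjective f) : f.ker ≤ center T := by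
  have key : ∀ x : T, f x = AltFive.doubleSwap → x ∈ centralizer (f.ker : Set T) := by
    intro x hx
    have hc := centralizer_eq_comap_of_map_eq hcl hf
      (by rw [hx]; exact AltFive.index_centralizer_doubleSwap : (centralizer {f x}).index = 15)
    rw [mem_centralizer_iff]
    intro m hm
    have : m ∈ centralizer {x} := by
      rw [hc, mem_comap, MonoidHom.mem_ker.1 hm]
      exact one_mem _
    exact mem_centralizer_singleton_iff.1 this
  obtain ⟨x, hx⟩ := hf AltFive.doubleSwap
  have hN : (centralizer (f.ker : Set T)).Normal := normal_centralizer
  have hker : f.ker ≤ centralizer (f.ker : Set T) := by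
    intro m hm
    have h1 := key (x * m) (by rw [map_mul, MonoidHom.mem_ker.1 hm, mul_one, hx])
    exact (mul_mem_cancel_left (key x hx)).1 h1
  have hmap : (centralizer (f.ker : Set T)).map f = ⊤ := by
    refine (Normal.eq_bot_or_eq_top (hN.map f hf)).resolve_left fun h => ?_
    have : f x ∈ (centralizer (f.ker : Set T)).map f := mem_map_of_mem f (key x hx)
    rw [h, mem_bot, hx] at this
    exact AltFive.doubleSwap_ne_one this
  have htop : centralizer (f.ker : Set T) = ⊤ := by
    rw [eq_top_iff]
    intro g _
    obtain ⟨y, hy, hyg⟩ : f g ∈ (centralizer (f.ker : Set T)).map f := hmap ▸ mem_top _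
    have : y⁻¹ * g ∈ f.ker := by rw [MonoidHom.mem_ker, map_mul, map_inv, hyg, inv_mul_cancel]
    have := mul_mem hy (hker this)
    rwa [mul_inv_cancel_left] at this
  rwa [centralizer_eq_top_iff_subset] at htop

theorem injective_of_surjective_altFive (hT : commutator T = ⊤)
    (hcl : ∀ g : T, (centralizer {g}).index ≤ 23) {f : T →* AltFive}
    (hf : Function.Surjective f) : Function.Injective f := by
  have hker := ker_le_center_of_surjective_altFive hcl hf
  rw [← MonoidHom.ker_eq_bot_iff, eq_bot_iff]
  intro z hz
  have hzc := hker hz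
  have hcyc : ∀ c : AltFive, z ^ (zpowers c).index = 1 := by
    intro c
    have := pow_index_eq_one_of_mem_center hT _ (commute_of_mem_comap_zpowers hf hker c) hzc
    rwa [index_comap_of_surjective _ hf] at this
  have h12 : z ^ 12 = 1 := by
    have h := hcyc AltFive.fiveCycle
    have h1 := card_mul_index (zpowers AltFive.fiveCycle)
    rw [Nat.card_zpowers, AltFive.orderOf_fiveCycle, AltFive.card_eq] at h1
    rwa [show (zpowers AltFive.fiveCycle).index = 12 by omega] at h
  have h20 : z ^ 20 = 1 := by
    have h := hcyc AltFive.threeCycle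
    have h1 := card_mul_index (zpowers AltFive.threeCycle)
    rw [Nat.card_zpowers, AltFive.orderOf_threeCycle, AltFive.card_eq] at h1
    rwa [show (zpowers AltFive.threeCycle).index = 20 by omega] at h
  have h15 : z ^ 15 = 1 := by
    have hab : ∀ a ∈ (centralizer {AltFive.doubleSwap}).comap f,
        ∀ b ∈ (centralizer {AltFive.doubleSwap}).comap f, a * b = b * a := by
      intro a ha b hb
      by_cases h1 : f a = 1
      · exact (mem_center_iff.1 (hker h1) b).symm
      have hc := AltFive.centralizer_eq_of_commute_doubleSwap
        (mem_centralizer_singleton_iff.1 (mem_comap.1 ha)) h1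
      have h := centralizer_eq_comap_of_map_eq hcl hf
        (by rw [hc]; exact AltFive.index_centralizer_doubleSwap : (centralizer {f a}).index = 15)
      rw [hc] at h
      rw [← h] at hb
      exact (mem_centralizer_singleton_iff.1 hb).symm
    have := pow_index_eq_one_of_mem_center hT _ hab hzc
    rwa [index_comap_of_surjective _ hf, AltFive.index_centralizer_doubleSwap] at this
  rw [mem_bot, ← orderOf_eq_one_iff]
  exact Nat.dvd_one.1 (Nat.dvd_gcd (Nat.dvd_gcd (orderOf_dvd_of_pow_eq_one h12)
    (orderOf_dvd_of_pow_eq_one h20)) (orderOf_dvd_of_pow_eq_one h15))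

theorem exists_isSimpleGroup_quotient (T : Type*) [Group T] [Finite T] [Nontrivial T] :
    ∃ (M : Subgroup T) (_ : M.Normal), IsSimpleGroup (T ⧸ M) := by
  obtain ⟨M, ⟨hM, hMtop⟩, hmax⟩ := (Set.toFinite {M : Subgroup T | M.Normal ∧ M ≠ ⊤}).exists_maximal
    ⟨⊥, inferInstance, bot_ne_top⟩
  refine ⟨M, hM, ?_⟩
  have hnt : Nontrivial (T ⧸ M) := QuotientGroup.nontrivial_iff.2 hMtop
  refine ⟨fun H hH => ?_⟩
  have hinj := comap_injective (QuotientGroup.mk'_surjective M)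
  by_cases h : H.comap (QuotientGroup.mk' M) = ⊤
  · right
    apply hinj
    rw [h, comap_top]
  · left
    have hle : M ≤ H.comap (QuotientGroup.mk' M) := QuotientGroup.le_comap_mk' M H
    have := hmax ⟨hH.comap _, h⟩ hle
    apply hinj
    rw [MonoidHom.comap_bot, QuotientGroup.ker_mk']
    exact le_antisymm this hle

theorem nonempty_mulEquiv_altFive_of_perfect [Nontrivial T] (hT : commutator T = ⊤)
    (hcl : ∀ g : T, (centralizer {g}).index ≤ 23) : Nonempty (T ≃* AltFive) := by
  obtain ⟨M, hM, hsimple⟩ := exists_isSimpleGroup_quotient T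
  have hsurj := QuotientGroup.mk'_surjective M
  have hcomm : ¬ ∀ a b : T ⧸ M, a * b = b * a := by
    intro h
    have hle : commutator T ≤ M := by
      rw [commutator_def, commutator_le]
      intro a _ b _
      rw [← QuotientGroup.eq_one_iff]
      change (a : T ⧸ M) * (b : T ⧸ M) * (a : T ⧸ M)⁻¹ * (b : T ⧸ M)⁻¹ = 1
      rw [h (a : T ⧸ M), mul_inv_cancel_right, mul_inv_cancel]
    rw [hT, top_le_iff] at hle
    have := QuotientGroup.nontrivial_iff.1 hsimple.toNontrivial
    exact this hle
  have hcl' : ∀ g : T ⧸ M, (centralizer {g}).index ≤ 23 := by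
    intro g
    obtain ⟨x, rfl⟩ := hsurj g
    exact (Nat.le_of_dvd (Nat.pos_of_ne_zero index_ne_zero_of_finite)
      (index_centralizer_map_dvd hsurj x)).trans (hcl x)
  obtain ⟨e⟩ := nonempty_mulEquiv_alternatingGroup hcomm hcl'
  have hf : Function.Surjective (e.toMonoidHom.comp (QuotientGroup.mk' M)) :=
    e.surjective.comp hsurj
  exact ⟨MulEquiv.ofBijective _ ⟨injective_of_surjective_altFive hT hcl hf, hf⟩⟩

end Perfect

namespace AltFive

open Subgroup

theorem not_comm : ¬ ∀ a b : AltFive, a * b = b * a := fun h =>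
  (by decide +kernel : fiveCycle * doubleSwap ≠ doubleSwap * fiveCycle) (h _ _)

theorem center_eq_bot : center AltFive = ⊥ := by
  by_contra h
  exact not_comm (commute_of_center_ne_bot h)

theorem closure_eq_top : closure {fiveCycle, doubleSwap} = ⊤ := by
  by_contra hne
  have h5i := five_le_index not_comm hne
  have hs : fiveCycle ∈ closure {fiveCycle, doubleSwap} := subset_closure (by simp)
  have hr : doubleSwap ∈ closure {fiveCycle, doubleSwap} := subset_closure (by simp)
  have h5 := (closure {fiveCycle, doubleSwap}).orderOf_dvd_natCard hs
  have h2 := (closure {fiveCycle, doubleSwap}).orderOf_dvd_natCard hr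
  have h3 := (closure {fiveCycle, doubleSwap}).orderOf_dvd_natCard (mul_mem hs hr)
  have h3' : orderOf (fiveCycle * doubleSwap) = 3 := by
    have : Fact (Nat.Prime 3) := ⟨Nat.prime_three⟩
    exact orderOf_eq_prime (by decide +kernel) (by decide +kernel)
  rw [orderOf_fiveCycle] at h5
  rw [orderOf_doubleSwap] at h2
  rw [h3'] at h3
  have hmul := card_mul_index (closure {fiveCycle, doubleSwap})
  rw [card_eq] at hmul
  have : 30 ∣ Nat.card (closure {fiveCycle, doubleSwap}) := by omega
  have := Nat.le_of_dvd Nat.card_pos this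
  nlinarith

theorem exists_conj_eq_fiveCycle : ∀ t : AltFive, t ^ 5 = 1 → t ≠ 1 →
    ∃ g : AltFive, g * t * g⁻¹ = fiveCycle ∨ g * t * g⁻¹ = fiveCycle ^ 2 := by
  decide +kernel

theorem card_pow_five_eq_one : Nat.card {t : AltFive // t ^ 5 = 1 ∧ t ≠ 1} = 24 := by
  rw [Nat.card_eq_fintype_card]
  decide +kernel

theorem exists_eq_conj_doubleSwap : ∀ r : AltFive, r ^ 2 = 1 → r ≠ 1 →
    (fiveCycle * r) ^ 3 = 1 →
      ∃ i : Fin 5, r = fiveCycle ^ (i : ℕ) * doubleSwap * (fiveCycle ^ (i : ℕ))⁻¹ := by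
  decide +kernel

theorem fiveCycle_mul_doubleSwap_pow : (fiveCycle * doubleSwap) ^ 3 = 1 := by
  decide +kernel

theorem fiveCycle_pow : fiveCycle ^ 5 = 1 := by decide +kernel

theorem exists_mulAut_apply_fiveCycle : ∃ α : MulAut AltFive, α fiveCycle = fiveCycle ^ 2 := by
  have h : ∃ u : Equiv.Perm (Fin 5), u * finRotate 5 * u⁻¹ = finRotate 5 ^ 2 := by
    decide +kernel
  obtain ⟨u, hu⟩ := h
  exact ⟨MulAut.conjNormal u, Subtype.ext hu⟩

end AltFive

section MulAut

open Subgroup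

variable {G : Type*} [Group G]

theorem card_orbit_mulAut_le_maol [Finite G] (g : G) :
    Nat.card (MulAction.orbit (MulAut G) g) ≤ maol G :=
  le_ciSup (f := fun g : G => Nat.card (MulAction.orbit (MulAut G) g))
    (Set.finite_range _).bddAbove g

theorem index_centralizer_le_maol [Finite G] (g : G) : (centralizer {g}).index ≤ maol G := by
  have h1 : (MulAction.stabilizer (MulAut G) g).comap MulAut.conj = centralizer {g} := by
    ext x
    rw [mem_comap, MulAction.mem_stabilizer_iff, mem_centralizer_singleton_iff]
    change x * g * x⁻¹ = g ↔ _
    rw [mul_inv_eq_iff_eq_mul]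
  have hfin : (MulAction.stabilizer (MulAut G) g).index ≠ 0 := index_ne_zero_of_finite
  have h2 := relIndex_le_of_le_right (H := MulAction.stabilizer (MulAut G) g)
    (le_top : (MulAut.conj : G →* MulAut G).range ≤ ⊤) (by rwa [relIndex_top_right])
  rw [relIndex_top_right, ← index_comap, h1, MulAction.index_stabilizer] at h2
  exact h2.trans (card_orbit_mulAut_le_maol g)

theorem index_centralizer_subgroup_le [Finite G] (K : Subgroup G) (t : K) :
    (centralizer {t}).index ≤ (centralizer {(t : G)}).index := by
  have h1 : centralizer {t} = (centralizer {(t : G)}).subgroupOf K := by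
    ext x
    rw [mem_subgroupOf, mem_centralizer_singleton_iff, mem_centralizer_singleton_iff, Subtype.ext_iff]
    rfl
  have h2 := relIndex_le_of_le_right (H := centralizer {(t : G)}) (le_top : K ≤ ⊤)
    (by rw [relIndex_top_right]; exact index_ne_zero_of_finite)
  rw [relIndex_top_right] at h2
  rw [h1]
  exact h2

theorem exists_normal_perfect_of_not_isSolvable [Finite G] (h : ¬ Group.IsSolvable G) :
    ∃ K : Subgroup G, K.Normal ∧ K ≠ ⊥ ∧ commutator K = ⊤ := by
  obtain ⟨n, hn⟩ : ∃ n, derivedSeries G (n + 1) = derivedSeries G n := by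
    by_contra! hne
    have : StrictAnti (derivedSeries G) := strictAnti_nat_of_succ_lt fun n =>
      lt_of_le_of_ne (derivedSeries_antitone G n.le_succ) (hne n)
    exact not_injective_infinite_finite _ this.injective
  refine ⟨derivedSeries G n, derivedSeries_normal G n, fun hb =>
    h ((Group.isSolvable_def G).2 ⟨n, hb⟩), ?_⟩
  apply map_injective (derivedSeries G n).subtype_injective
  rw [map_subtype_commutator, ← derivedSeries_succ, hn, ← MonoidHom.range_eq_map, range_subtype]

/-- If `G = K * C(K)` and `K` has trivial centre, automorphisms of `K` extend to `G`. -/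
theorem exists_mulAut_extend (K : Subgroup G) (hK : center K = ⊥)
    (hG : ∀ g : G, ∃ k ∈ K, k * g ∈ centralizer (K : Set G)) (α : MulAut K) :
    ∃ φ : MulAut G, ∀ k : K, φ k = α k := by
  let F : K × centralizer (K : Set G) →* G :=
    MonoidHom.noncommCoprod K.subtype (centralizer (K : Set G)).subtype
      fun k c => mem_centralizer_iff.1 c.2 k k.2
  have hF : ∀ k c, F (k, c) = k * c := fun k c => rfl
  have hbij : Function.Bijective F := by
    constructor
    · rw [← MonoidHom.ker_eq_bot_iff, eq_bot_iff]
      rintro ⟨k, c⟩ h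
      rw [MonoidHom.mem_ker, hF] at h
      have hk : k ∈ center K := by
        rw [mem_center_iff]
        intro x
        have hkc : (k : G) = (c : G)⁻¹ := eq_inv_of_mul_eq_one_left h
        have := mem_centralizer_iff.1 (inv_mem c.2) x x.2
        apply Subtype.ext
        change (x : G) * k = k * x
        rw [hkc]
        exact this
      rw [hK, mem_bot] at hk
      subst hk
      rw [OneMemClass.coe_one, one_mul] at h
      rw [mem_bot]
      exact Prod.ext rfl (Subtype.ext h)
    · intro g
      obtain ⟨k, hk, hc⟩ := hG g
      exact ⟨(⟨k⁻¹, inv_mem hk⟩, ⟨_, hc⟩), by rw [hF]; simp⟩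
  let E := MulEquiv.ofBijective F hbij
  refine ⟨E.symm.trans ((α.prodCongr (MulEquiv.refl _)).trans E), fun k => ?_⟩
  have h1 : E (k, 1) = k := by change F (k, 1) = k; rw [hF]; simp
  have h2 : E.symm k = (k, 1) := by rw [← h1, E.symm_apply_apply]
  change E ((α.prodCongr (MulEquiv.refl _)) (E.symm k)) = _
  rw [h2]
  change F (α k, 1) = _
  rw [hF]; simp

/-- The automorphism of a normal subgroup isomorphic to the alternating group induced by
conjugation. -/
def conjAltFive {K : Subgroup G} [K.Normal] (e : K ≃* AltFive) (g : G) : MulAut AltFive :=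
  e.symm.trans ((MulAut.conjNormal g).trans e)

theorem coe_symm_conjAltFive {K : Subgroup G} [K.Normal] (e : K ≃* AltFive) (g : G)
    (t : AltFive) : (e.symm (conjAltFive e g t) : G) = g * e.symm t * g⁻¹ := by
  change (e.symm (e (MulAut.conjNormal g (e.symm t))) : G) = _
  rw [e.symm_apply_apply, MulAut.conjNormal_apply]

variable [Finite G]

theorem sq_notMem_orbit (h : maol G ≤ 23) {K : Subgroup G} (e : K ≃* AltFive) :
    (e.symm (AltFive.fiveCycle ^ 2) : G) ∉
      MulAction.orbit (MulAut G) (e.symm AltFive.fiveCycle : G) := by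
  intro hsq
  have hconj : ∀ a ∈ MulAction.orbit (MulAut G) (e.symm AltFive.fiveCycle : G), ∀ g : G,
      g⁻¹ * a * g ∈ MulAction.orbit (MulAut G) (e.symm AltFive.fiveCycle : G) := by
    intro a ha g
    have := MulAction.mem_orbit_of_mem_orbit (MulAut.conj g⁻¹) ha
    change g⁻¹ * a * g⁻¹⁻¹ ∈ _ at this
    rwa [inv_inv] at this
  have hmem : ∀ t : AltFive, t ^ 5 = 1 → t ≠ 1 → (e.symm t : G) ∈
      MulAction.orbit (MulAut G) (e.symm AltFive.fiveCycle : G) := by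
    intro t ht ht1
    obtain ⟨g, hg⟩ := AltFive.exists_conj_eq_fiveCycle t ht ht1
    have hrec : ∀ a : AltFive, g * t * g⁻¹ = a →
        (e.symm t : G) = (e.symm g : G)⁻¹ * e.symm a * (e.symm g : G) := by
      rintro a rfl
      have : t = g⁻¹ * (g * t * g⁻¹) * g := by group
      conv_lhs => rw [this]
      simp only [map_mul, map_inv, Subgroup.coe_mul, Subgroup.coe_inv]
    rcases hg with hg | hg
    · rw [hrec _ hg]
      exact hconj _ (MulAction.mem_orbit_self _) _
    · rw [hrec _ hg]
      exact hconj _ hsq _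
  have hinj : Function.Injective (fun t : {t : AltFive // t ^ 5 = 1 ∧ t ≠ 1} =>
      (⟨(e.symm t : G), hmem t t.2.1 t.2.2⟩ :
        MulAction.orbit (MulAut G) (e.symm AltFive.fiveCycle : G))) := by
    intro a b hab
    have h1 := congrArg Subtype.val hab
    exact Subtype.ext (e.symm.injective (Subtype.ext h1))
  have h1 := Nat.card_le_card_of_injective _ hinj
  rw [AltFive.card_pow_five_eq_one] at h1
  exact absurd ((h1.trans (card_orbit_mulAut_le_maol _)).trans h) (by norm_num)

theorem exists_mul_mem_centralizer (h : maol G ≤ 23) {K : Subgroup G} [K.Normal]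
    (e : K ≃* AltFive) (g : G) : ∃ k ∈ K, k * g ∈ centralizer (K : Set G) := by
  obtain ⟨a, ha⟩ := AltFive.exists_conj_eq_fiveCycle (conjAltFive e g AltFive.fiveCycle)
    (by rw [← map_pow, AltFive.fiveCycle_pow, map_one])
    (by
      rw [ne_eq, EmbeddingLike.map_eq_one_iff]
      intro h1
      have := AltFive.orderOf_fiveCycle
      rw [h1, orderOf_one] at this
      norm_num at this)
  have hconj : ∀ (a : AltFive) (g : G) (t : AltFive),
      conjAltFive e (e.symm a * g) t = a * conjAltFive e g t * a⁻¹ := by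
    intro a g t
    apply e.symm.injective
    apply Subtype.ext
    rw [coe_symm_conjAltFive, map_mul, map_mul, map_inv, coe_mul, coe_mul, coe_inv,
      coe_symm_conjAltFive]
    group
  rw [← hconj] at ha
  replace ha := ha.resolve_right fun hsq => sq_notMem_orbit h e (by
    rw [← hsq, coe_symm_conjAltFive]
    exact ⟨MulAut.conj (e.symm a * g), rfl⟩)
  have hd2 : AltFive.doubleSwap ^ 2 = 1 := by
    rw [← AltFive.orderOf_doubleSwap, pow_orderOf_eq_one]
  obtain ⟨i, hi⟩ := AltFive.exists_eq_conj_doubleSwap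
    (conjAltFive e (e.symm a * g) AltFive.doubleSwap)
    (by rw [← map_pow, hd2, map_one])
    (by rw [ne_eq, EmbeddingLike.map_eq_one_iff]; exact AltFive.doubleSwap_ne_one)
    (by
      nth_rewrite 1 [← ha]
      rw [← map_mul, ← map_pow, AltFive.fiveCycle_mul_doubleSwap_pow, map_one])
  set b : AltFive := (AltFive.fiveCycle ^ (i : ℕ))⁻¹ with hb
  have hx : ∀ t, conjAltFive e (e.symm b * (e.symm a * g)) t = t := by
    have hle : closure {AltFive.fiveCycle, AltFive.doubleSwap} ≤
        (conjAltFive e (e.symm b * (e.symm a * g))).toMonoidHom.eqLocus (MonoidHom.id _) := by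
      rw [closure_le]
      rintro t (rfl | rfl)
      · change conjAltFive e _ _ = _
        rw [hconj, ha, hb, MonoidHom.id_apply, inv_inv, mul_assoc, ← pow_succ', pow_succ,
          inv_mul_cancel_left]
      · change conjAltFive e _ _ = _
        rw [hconj, hi, hb, MonoidHom.id_apply]
        group
    rw [AltFive.closure_eq_top] at hle
    intro t
    exact hle (mem_top t)
  refine ⟨e.symm b * e.symm a, (e.symm b * e.symm a).2, ?_⟩
  rw [mem_centralizer_iff]
  intro y hy
  have h1 := coe_symm_conjAltFive e (e.symm b * (e.symm a * g)) (e ⟨y, hy⟩)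
  rw [hx, e.symm_apply_apply] at h1
  rw [mul_assoc]
  exact mul_inv_eq_iff_eq_mul.1 h1.symm |>.symm

theorem not_mulEquiv_altFive (h : maol G ≤ 23) {K : Subgroup G} [K.Normal]
    (e : K ≃* AltFive) : False := by
  have hK : center K = ⊥ := by
    rw [eq_bot_iff]
    intro z hz
    have : e z ∈ center AltFive := by
      rw [mem_center_iff]
      intro t
      obtain ⟨y, rfl⟩ := e.surjective t
      rw [← map_mul, ← map_mul, mem_center_iff.1 hz]
    rw [AltFive.center_eq_bot, mem_bot, EmbeddingLike.map_eq_one_iff] at this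
    exact this
  obtain ⟨α, hα⟩ := AltFive.exists_mulAut_apply_fiveCycle
  obtain ⟨φ, hφ⟩ := exists_mulAut_extend K hK (exists_mul_mem_centralizer h e)
    (e.trans (α.trans e.symm))
  refine sq_notMem_orbit h e ⟨φ, ?_⟩
  change φ _ = _
  rw [hφ]
  change (e.symm (α (e (e.symm AltFive.fiveCycle))) : G) = _
  rw [e.apply_symm_apply, hα]

end MulAut

theorem stmt_3 (G : Type*) [Group G] [Finite G] (h : maol G ≤ 23) : IsSolvable G := by
  by_contra hG
  obtain ⟨K, hK, hK1, hKp⟩ := exists_normal_perfect_of_not_isSolvable hG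
  have : Nontrivial K := (Subgroup.nontrivial_iff_ne_bot K).2 hK1
  obtain ⟨e⟩ := nonempty_mulEquiv_altFive_of_perfect hKp fun t =>
    (index_centralizer_subgroup_le K t).trans ((index_centralizer_le_maol (t : G)).trans h)
  exact not_mulEquiv_altFive h e
end
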